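/- Assume ξ is even (c_k = 0 for all odd k). Let M_N = Σ_{k=2}^P N^k, identify the collection of all entries of (G^{(k)})_{2 ≤ k ≤ P} with a standard Gaussian vector G ∈ ℝ^{M_N}, and write H_N^g for the Hamiltonian built from the coupling vector g ∈ ℝ^{M_N}. Fix L > 0 and for each N let 𝒜_N : ℝ^{M_N} → ℝ^N be a measurable map satisfying ‖𝒜_N(g)‖₂² ≤ N for all g and ‖𝒜_N(g) − 𝒜_N(g')‖₂ ≤ L √N ‖g − g'‖₂ for all g, g'. Then for every ε > 0, lim_{N→∞} P( H_N^G( 𝒜_N(G) ) ≥ N ( ∫₀¹ √(ξ''(t)) dt + ε ) ) = 0. -/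

import Mathlib

open MeasureTheory ProbabilityTheory Filter
open scoped ENNReal NNReal

noncomputable section

/-- Euclidean dot product on `ℝ^N`. -/
def dotp {N : ℕ} (σ τ : Fin N → ℝ) : ℝ := ∑ i, σ i * τ i

/-- The sphere `S_N = {σ : ‖σ‖₂² = N}`. -/
def sphereSet (N : ℕ) : Set (Fin N → ℝ) := {σ | ∑ i, (σ i) ^ 2 = (N : ℝ)}

/-- The mixture `ξ(x) = Σ_{k=2}^P c_k² x^k`. -/
def xiFun (P : ℕ) (c : ℕ → ℝ) (x : ℝ) : ℝ := ∑ k ∈ Finset.Icc 2 P, (c k) ^ 2 * x ^ k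

/-- `ξ'`. -/
def xiD1 (P : ℕ) (c : ℕ → ℝ) (x : ℝ) : ℝ :=
  ∑ k ∈ Finset.Icc 2 P, (k : ℝ) * (c k) ^ 2 * x ^ (k - 1)

/-- `ξ''`. -/
def xiD2 (P : ℕ) (c : ℕ → ℝ) (x : ℝ) : ℝ :=
  ∑ k ∈ Finset.Icc 2 P, (k : ℝ) * ((k : ℝ) - 1) * (c k) ^ 2 * x ^ (k - 2)

/-- The mixed p-spin Hamiltonian built from couplings `g`. -/
def hamiltonian (N P : ℕ) (c : ℕ → ℝ) (g : (k : ℕ) → (Fin k → Fin N) → ℝ)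
    (σ : Fin N → ℝ) : ℝ :=
  ∑ k ∈ Finset.Icc 2 P, c k * (N : ℝ) ^ (-(((k : ℝ) - 1) / 2)) *
    ∑ j : Fin k → Fin N, g k j * ∏ i, σ (j i)

/-- Index set for the entries of all the coupling tensors. -/
abbrev GIdx (N P : ℕ) : Type := Σ k : {k : ℕ // k ∈ Finset.Icc 2 P}, (Fin (k : ℕ) → Fin N)

/-- Flatten the couplings into a single Gaussian vector. -/
def flatten (N P : ℕ) (g : (k : ℕ) → (Fin k → Fin N) → ℝ) : GIdx N P → ℝ :=
  fun i => g i.1 i.2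

/-- The couplings `(G^{(k)})_{2 ≤ k ≤ P}` are i.i.d. standard Gaussians. -/
def StdGaussianCouplings {Ω : Type*} [MeasureSpace Ω] (N P : ℕ)
    (G : Ω → (k : ℕ) → (Fin k → Fin N) → ℝ) : Prop :=
  Measure.map (fun ω => flatten N P (G ω)) ℙ = Measure.pi fun _ : GIdx N P => gaussianReal 0 1

/-- The maximum of the Hamiltonian over the sphere. -/
def maxH (N P : ℕ) (c : ℕ → ℝ) (g : (k : ℕ) → (Fin k → Fin N) → ℝ) : ℝ :=
  ⨆ σ : sphereSet N, hamiltonian N P c g σ.1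


/-- Euclidean gradient of the Hamiltonian. -/
def gradH (N P : ℕ) (c : ℕ → ℝ) (g : (k : ℕ) → (Fin k → Fin N) → ℝ)
    (σ : Fin N → ℝ) : Fin N → ℝ :=
  fun i => fderiv ℝ (hamiltonian N P c g) σ (Pi.single i 1)

/-- Euclidean Hessian of the Hamiltonian, as a bilinear form. -/
def hessH (N P : ℕ) (c : ℕ → ℝ) (g : (k : ℕ) → (Fin k → Fin N) → ℝ)
    (σ v w : Fin N → ℝ) : ℝ :=
  fderiv ℝ (fun τ => fderiv ℝ (hamiltonian N P c g) τ w) σ v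

/-- `σ` is a spherical critical point: `∇H(σ) = (⟨∇H(σ),σ⟩/N) σ`. -/
def IsCritPt (N P : ℕ) (c : ℕ → ℝ) (g : (k : ℕ) → (Fin k → Fin N) → ℝ)
    (σ : Fin N → ℝ) : Prop :=
  σ ∈ sphereSet N ∧ gradH N P c g σ = (dotp (gradH N P c g σ) σ / N) • σ

/-- Cardinality of a set, valued in `ℝ≥0∞`. -/
def ecount {α : Type*} (s : Set α) : ℝ≥0∞ := ∑' _ : s, 1

/-- Spherical critical points with energy at least `Nη`. -/
def crtSet (N P : ℕ) (c : ℕ → ℝ) (g : (k : ℕ) → (Fin k → Fin N) → ℝ)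
    (η : ℝ) : Set (Fin N → ℝ) :=
  {σ | IsCritPt N P c g σ ∧ (N : ℝ) * η ≤ hamiltonian N P c g σ}

/-- Index (number of negative eigenvalues) of the spherical Hessian quadratic form at `σ`:
maximal dimension of a subspace of the tangent space on which the form is negative definite. -/
def critIndex (N P : ℕ) (c : ℕ → ℝ) (g : (k : ℕ) → (Fin k → Fin N) → ℝ)
    (σ : Fin N → ℝ) : ℕ :=
  sSup {d : ℕ | ∃ W : Submodule ℝ (Fin N → ℝ), Module.finrank ℝ W = d ∧
    (∀ v ∈ W, dotp v σ = 0) ∧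
    ∀ v ∈ W, v ≠ 0 →
      hessH N P c g σ v v - (dotp (gradH N P c g σ) σ / N) * ∑ i, (v i) ^ 2 < 0}

/-- Critical points of index `N-1-k` in the superlevel set. -/
def crtSetIdx (N P : ℕ) (c : ℕ → ℝ) (g : (k : ℕ) → (Fin k → Fin N) → ℝ)
    (η : ℝ) (k : ℕ) : Set (Fin N → ℝ) :=
  {σ | σ ∈ crtSet N P c g η ∧ critIndex N P c g σ = N - 1 - k}

/-- Coefficients of the pure p-spin model. -/
def pureC (p : ℕ) : ℕ → ℝ := fun k => if k = p then 1 else 0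

/-- The uniform probability measure on the sphere `S_N`. -/
def sphereUniform (N : ℕ) : Measure (Fin N → ℝ) :=
  Measure.map (fun g i => Real.sqrt N * g i / Real.sqrt (∑ j, (g j) ^ 2))
    (Measure.pi fun _ : Fin N => gaussianReal 0 1)

/-- The band around `m`. -/
def band (N : ℕ) (m : Fin N → ℝ) (δ : ℝ) : Set (Fin N → ℝ) :=
  {σ | σ ∈ sphereSet N ∧ |dotp (σ - m) m| < N * δ}

/-- `k`-tuples from the band with pairwise overlaps close to `⟨m,m⟩`. -/
def bandK (N k : ℕ) (m : Fin N → ℝ) (δ ε : ℝ) : Set (Fin k → Fin N → ℝ) :=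
  {σs | (∀ i, σs i ∈ band N m δ) ∧
    ∀ i j, i ≠ j → |dotp (σs i) (σs j) - dotp m m| < N * ε}

/-- `∫₀ᵗ γ(s) ds`, valued in `ℝ≥0∞`. -/
def gammaLInt (γ : ℝ → ℝ) (t : ℝ) : ℝ≥0∞ := ∫⁻ s in Set.Ioo 0 t, ENNReal.ofReal (γ s)

/-- The zero-temperature spherical Parisi functional (Crisanti–Sommers form), with the
convention `1/0 = +∞`. -/
def PFunE (P : ℕ) (c : ℕ → ℝ) (γ : ℝ → ℝ) : ℝ≥0∞ :=
  ⨅ L ∈ {L : ℝ | gammaLInt γ 1 ≤ ENNReal.ofReal L},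
    (∫⁻ t in Set.Ioo (0 : ℝ) 1,
      (ENNReal.ofReal (xiD2 P c t * (L - (gammaLInt γ t).toReal))
        + (ENNReal.ofReal (L - (gammaLInt γ t).toReal))⁻¹)) / 2

/-- The space `𝒰` of order parameters: non-decreasing, non-negative, integrable on `[0,1)`. -/
def calU : Set (ℝ → ℝ) :=
  {γ | (∀ t ∈ Set.Ico (0 : ℝ) 1, 0 ≤ γ t) ∧ MonotoneOn γ (Set.Ico 0 1) ∧
    IntegrableOn γ (Set.Ioo 0 1)}

/-- The support of `γ`: points of `[0,1]` near which `γ` is not constant. -/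
def suppGamma (γ : ℝ → ℝ) : Set ℝ :=
  {q | q ∈ Set.Icc (0 : ℝ) 1 ∧ ∀ ε > 0, ∃ s ∈ Set.Ico (0 : ℝ) 1, ∃ t ∈ Set.Ico (0 : ℝ) 1,
    |s - q| < ε ∧ |t - q| < ε ∧ γ s ≠ γ t}

/-- The superlevel set `L_N(η)`. -/
def levelSet (N P : ℕ) (c : ℕ → ℝ) (g : (k : ℕ) → (Fin k → Fin N) → ℝ)
    (η : ℝ) : Set (Fin N → ℝ) :=
  {σ | σ ∈ sphereSet N ∧ (N : ℝ) * η ≤ hamiltonian N P c g σ}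

/-- Threshold energy of the pure p-spin model. -/
def THRp (p : ℕ) : ℝ := 2 * Real.sqrt (((p : ℝ) - 1) / p)

/-- The function `J` of the pure p-spin complexity. -/
def Jp (p : ℕ) (η : ℝ) : ℝ :=
  η / (THRp p) ^ 2 * Real.sqrt (η ^ 2 - (THRp p) ^ 2)
    - Real.log (η + Real.sqrt (η ^ 2 - (THRp p) ^ 2)) + Real.log (THRp p)

/-- The annealed complexity of the pure p-spin spherical model. -/
def SigmaPure (p : ℕ) (η : ℝ) : ℝ :=
  if η ≤ 0 then Real.log ((p : ℝ) - 1) / 2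
  else if η ≤ THRp p then
    Real.log ((p : ℝ) - 1) / 2 - ((p : ℝ) - 2) / (4 * ((p : ℝ) - 1)) * η ^ 2
  else Real.log ((p : ℝ) - 1) / 2 - ((p : ℝ) - 2) / (4 * ((p : ℝ) - 1)) * η ^ 2 - Jp p η

/-- Couplings, unflattened from a vector indexed by `GIdx N P`. -/
def unflatten (N P : ℕ) (g : GIdx N P → ℝ) : (k : ℕ) → (Fin k → Fin N) → ℝ :=
  fun k j => if h : k ∈ Finset.Icc 2 P then g ⟨⟨k, h⟩, j⟩ else 0

/-- `ξ'''`. -/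
def xiD3 (P : ℕ) (c : ℕ → ℝ) (x : ℝ) : ℝ :=
  ∑ k ∈ Finset.Icc 2 P, (k : ℝ) * ((k : ℝ) - 1) * ((k : ℝ) - 2) * (c k) ^ 2 * x ^ (k - 3)

namespace SpinGlass

set_option linter.unusedSectionVars false

section GaussianBasics

variable {V : Type*} [NormedAddCommGroup V] [InnerProductSpace ℝ V] [FiniteDimensional ℝ V]
  [MeasurableSpace V] [BorelSpace V]

lemma pi_absolutelyContinuous {n : ℕ} (μ ν : Measure ℝ) [SigmaFinite μ] [SigmaFinite ν]
    (h : μ ≪ ν) :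
    Measure.pi (fun _ : Fin n => μ) ≪ Measure.pi (fun _ : Fin n => ν) := by
  induction n with
  | zero =>
    rw [Measure.pi_of_empty, Measure.pi_of_empty]
  | succ n ih =>
    have h1 := (measurePreserving_piFinSuccAbove (fun _ : Fin (n + 1) => μ) 0).symm
    have h2 := (measurePreserving_piFinSuccAbove (fun _ : Fin (n + 1) => ν) 0).symm
    rw [← h1.map_eq, ← h2.map_eq]
    exact (h.prod ih).map (MeasurableEquiv.measurable _)

lemma stdGaussian_ae_of_volume {p : V → Prop} (h : ∀ᵐ x ∂(volume : Measure V), p x) :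
    ∀ᵐ x ∂(stdGaussian V), p x := by
  have hac : stdGaussian V ≪ (volume : Measure V) := by
    unfold stdGaussian
    have hb := (stdOrthonormalBasis ℝ V).measurePreserving_repr_symm
    have hv := PiLp.volume_preserving_toLp (Fin (Module.finrank ℝ V))
    have h3 := (hb.comp hv).map_eq
    rw [← h3]
    have : (fun x : Fin (Module.finrank ℝ V) → ℝ => ∑ i, x i • stdOrthonormalBasis ℝ V i) =
        (⇑(stdOrthonormalBasis ℝ V).repr.symm ∘ WithLp.toLp 2) := by
      ext x
      simp [← (stdOrthonormalBasis ℝ V).sum_repr_symm]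
    rw [this, volume_pi]
    refine (pi_absolutelyContinuous _ _ (gaussianReal_absolutelyContinuous 0 one_ne_zero)).map ?_
    exact (hb.comp hv).measurable
  exact hac.ae_le h

lemma integral_inner_sq_stdGaussian (v : V) :
    ∫ x, (inner ℝ v x) ^ 2 ∂(stdGaussian V) = ‖v‖ ^ 2 := by
  have h := variance_dual_stdGaussian (E := V) (innerSL ℝ v)
  rw [variance_eq_sub (IsGaussian.memLp_dual (stdGaussian V) (innerSL ℝ v) 2 (by simp))] at h
  rw [integral_strongDual_stdGaussian] at h
  simpa using h

lemma integrable_norm_sq_stdGaussian : Integrable (fun x : V => ‖x‖ ^ 2) (stdGaussian V) :=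
  (IsGaussian.memLp_two_id (μ := stdGaussian V)).integrable_norm_pow (by norm_num)

lemma integrable_norm_stdGaussian : Integrable (fun x : V => ‖x‖) (stdGaussian V) :=
  (IsGaussian.integrable_id (μ := stdGaussian V)).norm

lemma integral_norm_sq_stdGaussian :
    ∫ x, ‖x‖ ^ 2 ∂(stdGaussian V) = Module.finrank ℝ V := by
  have : ∀ x : V, ‖x‖ ^ 2 = ∑ i, (inner ℝ (stdOrthonormalBasis ℝ V i) x) ^ 2 := fun x => by
    rw [(stdOrthonormalBasis ℝ V).sum_sq_inner_right]
  simp_rw [this]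
  rw [integral_finsetSum]
  · simp_rw [integral_inner_sq_stdGaussian]
    simp
  · intro i _
    exact (IsGaussian.memLp_dual (stdGaussian V)
      (innerSL ℝ (stdOrthonormalBasis ℝ V i)) 2 (by simp)).integrable_sq

lemma integral_norm_stdGaussian_le :
    ∫ x, ‖x‖ ∂(stdGaussian V) ≤ √(Module.finrank ℝ V) := by
  apply Real.le_sqrt_of_sq_le
  rw [← integral_norm_sq_stdGaussian]
  have hm : MemLp (fun x : V => ‖x‖) 2 (stdGaussian V) :=
    (IsGaussian.memLp_two_id (μ := stdGaussian V)).norm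
  have h := variance_nonneg (fun x : V => ‖x‖) (stdGaussian V)
  rw [variance_eq_sub hm] at h
  simpa using h

/-- Rotation of a pair of points. -/
def rot (θ : ℝ) (p : V × V) : V × V :=
  (Real.cos θ • p.1 + Real.sin θ • p.2, -Real.sin θ • p.1 + Real.cos θ • p.2)

lemma measurePreserving_rot (θ : ℝ) :
    MeasurePreserving (rot (V := V) θ) ((stdGaussian V).prod (stdGaussian V))
      ((stdGaussian V).prod (stdGaussian V)) := by
  refine ⟨by unfold rot; fun_prop, ?_⟩
  have h := IsGaussian.map_rotation_eq_self (μ := stdGaussian V)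
    (by simp) θ
  convert h using 2
  funext p
  rw [ContinuousLinearMap.rotation_apply, rot]

lemma integral_rot {F : Type*} [NormedAddCommGroup F] [NormedSpace ℝ F] (θ : ℝ) (f : V × V → F)
    (hf : AEStronglyMeasurable f ((stdGaussian V).prod (stdGaussian V))) :
    ∫ p, f (rot θ p) ∂((stdGaussian V).prod (stdGaussian V)) =
      ∫ p, f p ∂((stdGaussian V).prod (stdGaussian V)) := by
  have h := measurePreserving_rot (V := V) θ
  conv_rhs => rw [← h.map_eq]
  rw [integral_map h.measurable.aemeasurable (by rwa [h.map_eq])]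

end GaussianBasics

section GaussianPoincare

variable {V : Type*} [NormedAddCommGroup V] [InnerProductSpace ℝ V] [FiniteDimensional ℝ V]
  [MeasurableSpace V] [BorelSpace V]

lemma memLp_two_of_lipschitz {F : V → ℝ} {K : ℝ≥0} (hF : LipschitzWith K F) :
    MemLp F 2 (stdGaussian V) := by
  have h : MemLp (fun x : V => |F 0| + K * ‖x‖) 2 (stdGaussian V) := by
    have h2 : MemLp (fun x : V => (K : ℝ) * ‖x‖) 2 (stdGaussian V) := by
      have h3 : MemLp (fun x : V => ‖x‖) 2 (stdGaussian V) :=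
        (IsGaussian.memLp_two_id (μ := stdGaussian V)).norm
      exact h3.const_mul _
    exact (memLp_const |F 0|).add h2
  refine h.mono hF.continuous.aestronglyMeasurable (Eventually.of_forall fun x => ?_)
  have h1 := hF.dist_le_mul x 0
  rw [Real.dist_eq, dist_zero_right] at h1
  have h2 : |F x| ≤ |F 0| + K * ‖x‖ := by
    have := abs_sub_abs_le_abs_sub (F x) (F 0)
    linarith
  rw [Real.norm_eq_abs, Real.norm_eq_abs]
  exact h2.trans (le_abs_self _)

lemma rot_step_bound {F : V → ℝ} {K : ℝ≥0} (hF : LipschitzWith K F) (h : ℝ) (p : V × V) :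
    (F p.1 - F (rot h p).1) ^ 2 ≤ (K : ℝ) ^ 2 * h ^ 2 * (2 * ‖p.1‖ ^ 2 + 2 * ‖p.2‖ ^ 2) := by
  have h1 := hF.dist_le_mul p.1 (rot h p).1
  rw [Real.dist_eq, dist_eq_norm] at h1
  have h2 : ‖p.1 - (rot h p).1‖ ≤ |h| * (‖p.1‖ + ‖p.2‖) := by
    have : p.1 - (rot h p).1 = (1 - Real.cos h) • p.1 - Real.sin h • p.2 := by
      simp only [rot]; module
    rw [this]
    refine (norm_sub_le _ _).trans ?_
    rw [norm_smul, norm_smul, Real.norm_eq_abs, Real.norm_eq_abs]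
    have hs : |Real.sin h| ≤ |h| := Real.abs_sin_le_abs
    have hc : |1 - Real.cos h| ≤ |h| := by
      have a1 := Real.one_sub_sq_div_two_le_cos (x := h)
      have a2 := Real.cos_le_one h
      have a3 := Real.neg_one_le_cos h
      rw [abs_of_nonneg (by linarith)]
      by_cases hh : |h| ≤ 2
      · have : h ^ 2 = |h| * |h| := by rw [← sq, sq_abs]
        nlinarith [abs_nonneg h]
      · push Not at hh; linarith
    nlinarith [norm_nonneg p.1, norm_nonneg p.2]
  have h3 : |F p.1 - F (rot h p).1| ≤ K * (|h| * (‖p.1‖ + ‖p.2‖)) :=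
    h1.trans (mul_le_mul_of_nonneg_left h2 K.2)
  have h4 : (F p.1 - F (rot h p).1) ^ 2 ≤ (K * (|h| * (‖p.1‖ + ‖p.2‖))) ^ 2 := by
    rw [← sq_abs]; exact pow_le_pow_left₀ (abs_nonneg _) h3 2
  refine h4.trans ?_
  have : (K * (|h| * (‖p.1‖ + ‖p.2‖))) ^ 2 = (K:ℝ) ^ 2 * h ^ 2 * (‖p.1‖ + ‖p.2‖) ^ 2 := by
    rw [mul_pow, mul_pow, sq_abs]; ring
  rw [this]
  refine mul_le_mul_of_nonneg_left ?_ (by positivity)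
  nlinarith [sq_nonneg (‖p.1‖ - ‖p.2‖)]

lemma rot_add (a b : ℝ) (p : V × V) : rot a (rot b p) = rot (a + b) p := by
  simp only [rot, Real.cos_add, Real.sin_add]
  ext <;> simp only [smul_add, smul_smul] <;> module

lemma integrable_norm_sq_prod :
    Integrable (fun p : V × V => 2 * ‖p.1‖ ^ 2 + 2 * ‖p.2‖ ^ 2)
      ((stdGaussian V).prod (stdGaussian V)) := by
  refine Integrable.add ?_ ?_
  · exact ((integrable_norm_sq_stdGaussian (V := V)).comp_fst (stdGaussian V)).const_mul 2
  · exact ((integrable_norm_sq_stdGaussian (V := V)).comp_snd (stdGaussian V)).const_mul 2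

lemma integral_sq_sub_le_steps {F : V → ℝ} {K : ℝ≥0} (hF : LipschitzWith K F) (n : ℕ)
    (hn : 0 < n) :
    ∫ p, (F p.1 - F p.2) ^ 2 ∂((stdGaussian V).prod (stdGaussian V)) ≤
      ∫ p, (n : ℝ) ^ 2 * (F p.1 - F (rot (Real.pi / 2 / n) p).1) ^ 2
        ∂((stdGaussian V).prod (stdGaussian V)) := by
  set μ := (stdGaussian V).prod (stdGaussian V)
  set h := Real.pi / 2 / n with hh
  have hFm := hF.continuous
  have hrc : ∀ θ : ℝ, Continuous (rot (V := V) θ) := fun θ => by unfold rot; fun_prop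
  have hint : Integrable (fun p : V × V => (F p.1 - F (rot h p).1) ^ 2) μ := by
    refine (integrable_norm_sq_prod.const_mul ((K:ℝ) ^ 2 * h ^ 2)).mono'
      (by have := hrc h; fun_prop) (Eventually.of_forall fun p => ?_)
    rw [Real.norm_eq_abs, abs_of_nonneg (sq_nonneg _)]
    exact rot_step_bound hF h p
  have hstep : ∀ k : ℕ, (∫ p, (F (rot (k * h) p).1 - F (rot ((k + 1 : ℕ) * h) p).1) ^ 2 ∂μ
      = ∫ p, (F p.1 - F (rot h p).1) ^ 2 ∂μ) := by
    intro k
    rw [← integral_rot (k * h) (fun p => (F p.1 - F (rot h p).1) ^ 2)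
      hint.aestronglyMeasurable]
    refine integral_congr_ae (Eventually.of_forall fun p => ?_)
    simp only [rot_add]
    congr 4; push_cast; ring_nf
  have hint' : ∀ k : ℕ, Integrable
      (fun p => (F (rot (k * h) p).1 - F (rot ((k + 1 : ℕ) * h) p).1) ^ 2) μ := by
    intro k
    have := (measurePreserving_rot (V := V) (k * h)).integrable_comp_of_integrable hint
    refine this.congr (Eventually.of_forall fun p => ?_)
    simp only [Function.comp, rot_add]
    congr 4; push_cast; ring_nf
  have hpt : ∀ p : V × V, (F p.1 - F p.2) ^ 2 ≤ n * ∑ k ∈ Finset.range n,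
      (F (rot (k * h) p).1 - F (rot ((k + 1 : ℕ) * h) p).1) ^ 2 := by
    intro p
    have h0 : F p.1 - F p.2 = ∑ k ∈ Finset.range n,
        (F (rot (k * h) p).1 - F (rot ((k + 1 : ℕ) * h) p).1) := by
      rw [Finset.sum_range_sub' (fun k : ℕ => F (rot (k * h) p).1)]
      have : (n : ℝ) * h = Real.pi / 2 := by rw [hh]; field_simp
      simp [rot, this]
    rw [h0]
    have := sq_sum_le_card_mul_sum_sq (s := Finset.range n)
      (f := fun k : ℕ => (F (rot (k * h) p).1 - F (rot ((k + 1 : ℕ) * h) p).1))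
    simpa using this
  calc ∫ p, (F p.1 - F p.2) ^ 2 ∂μ ≤ ∫ p, n * ∑ k ∈ Finset.range n,
      (F (rot (k * h) p).1 - F (rot ((k + 1 : ℕ) * h) p).1) ^ 2 ∂μ := by
        refine integral_mono_of_nonneg (Eventually.of_forall fun p => sq_nonneg _)
          ((integrable_finsetSum _ fun k _ => hint' k).const_mul _)
          (Eventually.of_forall hpt)
    _ = _ := by
        rw [integral_const_mul, integral_const_mul, integral_finsetSum _ fun k _ => hint' k]
        simp_rw [hstep]
        simp; ring

lemma integral_sq_sub_le {F : V → ℝ} {K : ℝ≥0} (hF : LipschitzWith K F) :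
    ∫ p, (F p.1 - F p.2) ^ 2 ∂((stdGaussian V).prod (stdGaussian V)) ≤
      (Real.pi / 2) ^ 2 * (K : ℝ) ^ 2 := by
  set μ := (stdGaussian V).prod (stdGaussian V)
  have hdiff : ∀ᵐ x ∂(stdGaussian V), DifferentiableAt ℝ F x :=
    stdGaussian_ae_of_volume hF.ae_differentiableAt
  have hdiff' : ∀ᵐ p ∂μ, DifferentiableAt ℝ F p.1 :=
    Measure.quasiMeasurePreserving_fst.ae hdiff
  have hFm := hF.continuous
  have hrc : ∀ θ : ℝ, Continuous (rot (V := V) θ) := fun θ => by unfold rot; fun_prop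
  have hlim : Tendsto (fun n : ℕ => ∫ p, ((n + 1 : ℕ) : ℝ) ^ 2 *
      (F p.1 - F (rot (Real.pi / 2 / (n + 1 : ℕ)) p).1) ^ 2 ∂μ) atTop
      (nhds (∫ p, (Real.pi / 2) ^ 2 * (fderiv ℝ F p.1 p.2) ^ 2 ∂μ)) := by
    refine tendsto_integral_of_dominated_convergence
      (fun p => (K : ℝ) ^ 2 * (Real.pi / 2) ^ 2 * (2 * ‖p.1‖ ^ 2 + 2 * ‖p.2‖ ^ 2)) ?_
      (integrable_norm_sq_prod.const_mul _) ?_ ?_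
    · intro n
      have := hrc (Real.pi / 2 / (n + 1 : ℕ))
      fun_prop
    · intro n
      refine Eventually.of_forall fun p => ?_
      rw [Real.norm_eq_abs, abs_of_nonneg (by positivity)]
      have := rot_step_bound hF (Real.pi / 2 / (n + 1 : ℕ)) p
      have hpos : (0 : ℝ) < ((n + 1 : ℕ) : ℝ) := by positivity
      calc ((n + 1 : ℕ) : ℝ) ^ 2 * (F p.1 - F (rot (Real.pi / 2 / (n + 1 : ℕ)) p).1) ^ 2
          ≤ ((n + 1 : ℕ) : ℝ) ^ 2 * ((K : ℝ) ^ 2 * (Real.pi / 2 / (n + 1 : ℕ)) ^ 2 *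
            (2 * ‖p.1‖ ^ 2 + 2 * ‖p.2‖ ^ 2)) := by gcongr
        _ = _ := by field_simp
    · filter_upwards [hdiff'] with p hp
      have hd : HasDerivAt (fun θ : ℝ => F (rot θ p).1) (fderiv ℝ F p.1 p.2) 0 := by
        have h1 : HasDerivAt (fun θ : ℝ => (rot θ p).1) p.2 0 := by
          simp only [rot]
          have := ((Real.hasDerivAt_cos 0).smul_const p.1).fun_add
            ((Real.hasDerivAt_sin 0).smul_const p.2)
          simpa using this
        have h2 : HasFDerivAt F (fderiv ℝ F p.1) (rot 0 p).1 := by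
          simpa [rot] using hp.hasFDerivAt
        exact h2.comp_hasDerivAt 0 h1
      have hs := hd.tendsto_slope_zero
      have hseq : Tendsto (fun n : ℕ => Real.pi / 2 / ((n + 1 : ℕ) : ℝ)) atTop
          (nhdsWithin 0 {0}ᶜ) := by
        refine tendsto_nhdsWithin_iff.2 ⟨?_, Eventually.of_forall fun n => ?_⟩
        · exact (tendsto_const_div_atTop_nhds_zero_nat (Real.pi / 2)).comp (tendsto_add_atTop_nat 1)
        · have : (0 : ℝ) < Real.pi / 2 / ((n + 1 : ℕ) : ℝ) := by positivity
          exact this.ne'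
      have h3 := ((hs.comp hseq).pow 2).const_mul ((Real.pi / 2) ^ 2)
      refine h3.congr fun n => ?_
      simp only [Function.comp, zero_add, smul_eq_mul]
      have : (rot 0 p).1 = p.1 := by simp [rot]
      rw [this]
      have hpi := Real.pi_pos
      field_simp
      ring
  have hle : ∫ p, (F p.1 - F p.2) ^ 2 ∂μ ≤
      ∫ p, (Real.pi / 2) ^ 2 * (fderiv ℝ F p.1 p.2) ^ 2 ∂μ :=
    ge_of_tendsto' hlim fun n => integral_sq_sub_le_steps hF (n + 1) n.succ_pos
  refine hle.trans ?_
  rw [integral_const_mul]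
  refine mul_le_mul_of_nonneg_left ?_ (by positivity)
  have hb : ∀ x y : V, (fderiv ℝ F x y) ^ 2 ≤ (K : ℝ) ^ 2 * ‖y‖ ^ 2 := by
    intro x y
    have h1 := (fderiv ℝ F x).le_opNorm y
    have h2 : ‖fderiv ℝ F x‖ ≤ K := norm_fderiv_le_of_lipschitz ℝ hF
    rw [← sq_abs, ← mul_pow]
    refine pow_le_pow_left₀ (abs_nonneg _) (h1.trans ?_) 2
    gcongr
  have hmeas : Measurable (fun p : V × V => fderiv ℝ F p.1 p.2) := by
    have h1 := measurable_fderiv ℝ F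
    exact (isBoundedBilinearMap_apply (𝕜 := ℝ) (E := V) (F := ℝ)).continuous.measurable.comp
      ((h1.comp measurable_fst).prodMk measurable_snd)
  rw [integral_prod]
  · calc ∫ x, ∫ y, (fderiv ℝ F x y) ^ 2 ∂(stdGaussian V) ∂(stdGaussian V)
        ≤ ∫ x, (K : ℝ) ^ 2 ∂(stdGaussian V) := by
          refine integral_mono_of_nonneg (Eventually.of_forall fun x =>
            integral_nonneg fun y => sq_nonneg _) (integrable_const _)
            (Eventually.of_forall fun x => ?_)
          have h1 := variance_dual_stdGaussian (E := V) (fderiv ℝ F x)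
          rw [variance_eq_sub (IsGaussian.memLp_dual (stdGaussian V) (fderiv ℝ F x) 2 (by simp)),
            integral_strongDual_stdGaussian] at h1
          have h2 : ‖fderiv ℝ F x‖ ≤ K := norm_fderiv_le_of_lipschitz ℝ hF
          have h3 : ∫ y, (fderiv ℝ F x y) ^ 2 ∂(stdGaussian V) = ‖fderiv ℝ F x‖ ^ 2 := by
            simpa using h1
          simp only [h3]
          exact pow_le_pow_left₀ (norm_nonneg _) h2 2
      _ = (K : ℝ) ^ 2 := by simp
  · refine (((integrable_norm_sq_stdGaussian (V := V)).comp_snd (stdGaussian V)).const_mul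
      ((K : ℝ) ^ 2)).mono' (hmeas.pow_const 2).aestronglyMeasurable
      (Eventually.of_forall fun p => ?_)
    rw [Real.norm_eq_abs, abs_of_nonneg (sq_nonneg _)]
    exact hb p.1 p.2

/-- Gaussian Poincaré inequality for Lipschitz functions, with a non-optimal constant. -/
lemma variance_le_of_lipschitz {F : V → ℝ} {K : ℝ≥0} (hF : LipschitzWith K F) :
    Var[F; stdGaussian V] ≤ 2 * (K : ℝ) ^ 2 := by
  have h := integral_sq_sub_le hF
  have hm := memLp_two_of_lipschitz hF
  have hi := hm.integrable (by norm_num)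
  have h1 : ∫ p, (F p.1 - F p.2) ^ 2 ∂((stdGaussian V).prod (stdGaussian V)) =
      2 * Var[F; stdGaussian V] := by
    have e : ∀ p : V × V, (F p.1 - F p.2) ^ 2 = F p.1 ^ 2 + F p.2 ^ 2 - 2 * (F p.1 * F p.2) :=
      fun p => by ring
    simp_rw [e]
    have i1 := hm.integrable_sq.comp_fst (stdGaussian V)
    have i2 := hm.integrable_sq.comp_snd (stdGaussian V)
    have i3 := hi.mul_prod hi
    have i12 : Integrable (fun p : V × V => F p.1 ^ 2 + F p.2 ^ 2)
      ((stdGaussian V).prod (stdGaussian V)) := i1.add i2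
    rw [integral_sub i12 (i3.const_mul 2), integral_add i1 i2, integral_const_mul,
      integral_prod_mul, integral_fun_fst (fun x => F x ^ 2), integral_fun_snd (fun x => F x ^ 2),
      variance_eq_sub hm]
    simp; ring
  rw [h1] at h
  have hpi : Real.pi ≤ 4 := Real.pi_le_four
  have hpi0 := Real.pi_pos
  have : (Real.pi / 2) ^ 2 ≤ 4 := by nlinarith
  nlinarith [sq_nonneg (K : ℝ)]

end GaussianPoincare

section GaussianComparison

variable {V : Type*} [NormedAddCommGroup V] [InnerProductSpace ℝ V] [FiniteDimensional ℝ V]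
  [MeasurableSpace V] [BorelSpace V]

lemma integrable_inner_stdGaussian (v : V) :
    Integrable (fun x => inner ℝ v x) (stdGaussian V) :=
  (IsGaussian.memLp_dual (stdGaussian V) (innerSL ℝ v) 1 (by simp)).integrable le_rfl

lemma integral_inner_mul_inner (v w : V) :
    ∫ x, inner ℝ v x * inner ℝ w x ∂(stdGaussian V) = inner ℝ v w := by
  have hi : ∀ v : V, Integrable (fun x => (inner ℝ v x) ^ 2) (stdGaussian V) := fun v =>
    (IsGaussian.memLp_dual (stdGaussian V) (innerSL ℝ v) 2 (by simp)).integrable_sq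
  have e : ∀ x : V, inner ℝ v x * inner ℝ w x =
      (1 / 4 : ℝ) * ((inner ℝ (v + w) x) ^ 2 - (inner ℝ (v - w) x) ^ 2) := by
    intro x
    rw [inner_add_left, inner_sub_left]; ring
  simp_rw [e]
  rw [integral_const_mul, integral_sub (hi _) (hi _), integral_inner_sq_stdGaussian,
    integral_inner_sq_stdGaussian, norm_add_sq_real, norm_sub_sq_real]
  ring

/-- Gaussian integration by parts. -/
lemma gaussian_integration_by_parts {F : V → ℝ} {F' : V → V →L[ℝ] ℝ}
    (hF : ∀ x, HasFDerivAt F (F' x) x) (hF'c : Continuous F') {B B' : ℝ}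
    (hB : ∀ x, |F x| ≤ B) (hB' : ∀ x, ‖F' x‖ ≤ B') (v : V) :
    ∫ x, F x * inner ℝ v x ∂(stdGaussian V) = ∫ x, F' x v ∂(stdGaussian V) := by
  set μ := (stdGaussian V).prod (stdGaussian V) with hμ
  have hFc : Continuous F := continuous_iff_continuousAt.2 fun x => (hF x).continuousAt
  have hB0 : 0 ≤ B := (abs_nonneg _).trans (hB 0)
  have hB0' : 0 ≤ B' := (norm_nonneg _).trans (hB' 0)
  have hrc : ∀ θ : ℝ, Continuous (rot (V := V) θ) := fun θ => by unfold rot; fun_prop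
  have hn1 : ∀ θ : ℝ, ∀ p : V × V, ‖(rot θ p).1‖ ≤ ‖p.1‖ + ‖p.2‖ := by
    intro θ p
    refine (norm_add_le _ _).trans ?_
    rw [norm_smul, norm_smul, Real.norm_eq_abs, Real.norm_eq_abs]
    nlinarith [Real.abs_cos_le_one θ, Real.abs_sin_le_one θ, norm_nonneg p.1, norm_nonneg p.2]
  have hn2 : ∀ θ : ℝ, ∀ p : V × V, ‖(rot θ p).2‖ ≤ ‖p.1‖ + ‖p.2‖ := by
    intro θ p
    refine (norm_add_le _ _).trans ?_
    rw [norm_smul, norm_smul, Real.norm_eq_abs, Real.norm_eq_abs, abs_neg]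
    nlinarith [Real.abs_cos_le_one θ, Real.abs_sin_le_one θ, norm_nonneg p.1, norm_nonneg p.2]
  have hI1 : Integrable (fun p : V × V => ‖p.1‖ + ‖p.2‖) μ :=
    ((integrable_norm_stdGaussian (V := V)).comp_fst (stdGaussian V)).add
      ((integrable_norm_stdGaussian (V := V)).comp_snd (stdGaussian V))
  have hI2 : Integrable (fun p : V × V => (‖p.1‖ + ‖p.2‖) ^ 2) μ := by
    refine integrable_norm_sq_prod.mono' (by fun_prop) (Eventually.of_forall fun p => ?_)
    rw [Real.norm_eq_abs, abs_of_nonneg (by positivity)]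
    nlinarith [sq_nonneg (‖p.1‖ - ‖p.2‖)]
  have hder : HasDerivAt (fun θ : ℝ => ∫ p, F (rot θ p).1 * inner ℝ v (rot θ p).2 ∂μ)
      (∫ p, (F' (rot 0 p).1 (rot 0 p).2 * inner ℝ v (rot 0 p).2 -
        F (rot 0 p).1 * inner ℝ v (rot 0 p).1) ∂μ) 0 := by
    refine (hasDerivAt_integral_of_dominated_loc_of_deriv_le (s := Set.univ)
      (F := fun θ p => F (rot θ p).1 * inner ℝ v (rot θ p).2)
      (F' := fun θ p => F' (rot θ p).1 (rot θ p).2 * inner ℝ v (rot θ p).2 -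
        F (rot θ p).1 * inner ℝ v (rot θ p).1)
      (bound := fun p => B' * ‖v‖ * (‖p.1‖ + ‖p.2‖) ^ 2 + B * ‖v‖ * (‖p.1‖ + ‖p.2‖))
      univ_mem ?_ ?_ ?_ ?_ ?_ ?_).2
    · refine Eventually.of_forall fun θ => ?_
      have := hrc θ
      fun_prop
    · refine (hI1.const_mul (B * ‖v‖)).mono' (by have := hrc 0; fun_prop)
        (Eventually.of_forall fun p => ?_)
      rw [norm_mul, Real.norm_eq_abs, Real.norm_eq_abs, mul_assoc]
      refine mul_le_mul (hB _) ((abs_real_inner_le_norm _ _).trans ?_) (abs_nonneg _) hB0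
      exact mul_le_mul_of_nonneg_left (hn2 _ _) (norm_nonneg _)
    · have := hrc 0
      have h2 : Continuous fun p : V × V => F' (rot 0 p).1 (rot 0 p).2 :=
        (hF'c.comp (continuous_fst.comp this)).clm_apply (continuous_snd.comp this)
      exact Continuous.aestronglyMeasurable (by fun_prop)
    · refine Eventually.of_forall fun p θ _ => ?_
      refine (norm_sub_le _ _).trans (add_le_add ?_ ?_)
      · rw [norm_mul]
        have a1 : ‖F' (rot θ p).1 (rot θ p).2‖ ≤ B' * (‖p.1‖ + ‖p.2‖) :=
          ((F' _).le_opNorm _).trans (mul_le_mul (hB' _) (hn2 _ _) (norm_nonneg _) hB0')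
        have a2 : ‖inner ℝ v (rot θ p).2‖ ≤ ‖v‖ * (‖p.1‖ + ‖p.2‖) :=
          (abs_real_inner_le_norm _ _).trans
            (mul_le_mul_of_nonneg_left (hn2 _ _) (norm_nonneg _))
        refine (mul_le_mul a1 a2 (norm_nonneg _) (by positivity)).trans (le_of_eq (by ring))
      · rw [norm_mul, Real.norm_eq_abs, Real.norm_eq_abs, mul_assoc]
        refine mul_le_mul (hB _) ((abs_real_inner_le_norm _ _).trans ?_) (abs_nonneg _) hB0
        exact mul_le_mul_of_nonneg_left (hn1 _ _) (norm_nonneg _)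
    · exact (hI2.const_mul _).add (hI1.const_mul _)
    · refine Eventually.of_forall fun p θ _ => ?_
      have h1 : HasDerivAt (fun θ : ℝ => (rot θ p).1) (rot θ p).2 θ := by
        simp only [rot]
        exact ((Real.hasDerivAt_cos θ).smul_const p.1).fun_add
            ((Real.hasDerivAt_sin θ).smul_const p.2)
      have h2 : HasDerivAt (fun θ : ℝ => (rot θ p).2) (-(rot θ p).1) θ := by
        simp only [rot]
        have := ((Real.hasDerivAt_sin θ).fun_neg.smul_const p.1).fun_add
            ((Real.hasDerivAt_cos θ).smul_const p.2)
        convert this using 1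
        module
      have h3 := (hF (rot θ p).1).comp_hasDerivAt θ h1
      have h4 : HasDerivAt (fun θ : ℝ => inner ℝ v (rot θ p).2) (inner ℝ v (-(rot θ p).1)) θ := by
        simpa using (hasDerivAt_const θ v).inner ℝ h2
      refine (h3.fun_mul h4).congr_deriv ?_
      simp only [inner_neg_right, Function.comp]
      ring
  have hconst : (fun θ : ℝ => ∫ p, F (rot θ p).1 * inner ℝ v (rot θ p).2 ∂μ) =
      fun _ => ∫ p, F p.1 * inner ℝ v p.2 ∂μ := by
    funext θ
    exact integral_rot θ (fun p => F p.1 * inner ℝ v p.2) (by fun_prop)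
  rw [hconst] at hder
  have h0 := hder.unique (hasDerivAt_const _ _)
  have hr0 : ∀ p : V × V, rot 0 p = p := fun p => by simp [rot]
  simp_rw [hr0] at h0
  have hFm : Measurable (fun p : V × V => F' p.1 p.2) :=
    ((hF'c.comp continuous_fst).clm_apply continuous_snd).measurable
  have i1 : Integrable (fun p : V × V => F' p.1 p.2 * inner ℝ v p.2) μ := by
    refine (hI2.const_mul (B' * ‖v‖)).mono' (by fun_prop) (Eventually.of_forall fun p => ?_)
    rw [norm_mul]
    have a1 : ‖F' p.1 p.2‖ ≤ B' * (‖p.1‖ + ‖p.2‖) :=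
      ((F' _).le_opNorm _).trans (mul_le_mul (hB' _)
        (by linarith [norm_nonneg p.1]) (norm_nonneg _) hB0')
    have a2 : ‖inner ℝ v p.2‖ ≤ ‖v‖ * (‖p.1‖ + ‖p.2‖) :=
      (abs_real_inner_le_norm _ _).trans
        (mul_le_mul_of_nonneg_left (by linarith [norm_nonneg p.1]) (norm_nonneg _))
    refine (mul_le_mul a1 a2 (norm_nonneg _) (by positivity)).trans (le_of_eq (by ring))
  have i2' : Integrable (fun x : V => F x * inner ℝ v x) (stdGaussian V) := by
    refine (integrable_inner_stdGaussian v).bdd_mul (c := B) hFc.aestronglyMeasurable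
      (Eventually.of_forall fun x => ?_)
    exact hB x
  have i2 : Integrable (fun p : V × V => F p.1 * inner ℝ v p.1) μ := i2'.comp_fst _
  rw [integral_sub i1 i2, integral_fun_fst (fun x => F x * inner ℝ v x), integral_prod _ i1] at h0
  have h5 : ∀ x : V, ∫ y, F' x y * inner ℝ v y ∂(stdGaussian V) = F' x v := by
    intro x
    have : ∀ y, F' x y = inner ℝ ((InnerProductSpace.toDual ℝ V).symm (F' x)) y := fun y => by
      simp
    simp_rw [this]
    exact integral_inner_mul_inner _ _
  simp_rw [h5] at h0
  simp at h0
  linarith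

end GaussianComparison

section SudakovFernique

variable {V : Type*} [NormedAddCommGroup V] [InnerProductSpace ℝ V] [FiniteDimensional ℝ V]
  [MeasurableSpace V] [BorelSpace V]
variable {ι : Type*} [Fintype ι] [Nonempty ι]

/-- Log-sum-exp of the linear functionals `⟪u i, ·⟫`. -/
def lse (u : ι → V) (g : V) : ℝ := Real.log (∑ i, Real.exp (inner ℝ (u i) g))

/-- Gibbs weights of the linear functionals `⟪u i, ·⟫`. -/
def gibbs (u : ι → V) (i : ι) (g : V) : ℝ :=
  Real.exp (inner ℝ (u i) g) / ∑ j, Real.exp (inner ℝ (u j) g)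

lemma sum_exp_pos (u : ι → V) (g : V) : 0 < ∑ i, Real.exp (inner ℝ (u i) g) :=
  Finset.sum_pos (fun _ _ => Real.exp_pos _) Finset.univ_nonempty

lemma gibbs_nonneg (u : ι → V) (i : ι) (g : V) : 0 ≤ gibbs u i g :=
  div_nonneg (Real.exp_pos _).le (sum_exp_pos u g).le

lemma sum_gibbs (u : ι → V) (g : V) : ∑ i, gibbs u i g = 1 := by
  unfold gibbs
  rw [← Finset.sum_div, div_self (sum_exp_pos u g).ne']

lemma gibbs_le_one (u : ι → V) (i : ι) (g : V) : gibbs u i g ≤ 1 := by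
  rw [← sum_gibbs u g]
  exact Finset.single_le_sum (f := fun i => gibbs u i g) (fun j _ => gibbs_nonneg u j g)
    (Finset.mem_univ i)

lemma continuous_gibbs (u : ι → V) (i : ι) : Continuous (gibbs u i) := by
  unfold gibbs
  exact Continuous.div (by fun_prop) (by fun_prop) fun g => (sum_exp_pos u g).ne'

lemma hasFDerivAt_gibbs (u : ι → V) (i : ι) (g : V) :
    HasFDerivAt (gibbs u i)
      (gibbs u i g • (innerSL ℝ (u i) - ∑ j, gibbs u j g • innerSL ℝ (u j))) g := by
  have he : ∀ j, HasFDerivAt (fun g => Real.exp (inner ℝ (u j) g))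
      (Real.exp (inner ℝ (u j) g) • innerSL ℝ (u j)) g := fun j =>
    ((innerSL ℝ (u j)).hasFDerivAt (x := g)).exp
  have hs : HasFDerivAt (fun g => ∑ j, Real.exp (inner ℝ (u j) g))
      (∑ j, Real.exp (inner ℝ (u j) g) • innerSL ℝ (u j)) g :=
    HasFDerivAt.fun_sum fun j _ => he j
  have hl : HasFDerivAt (lse u) (∑ j, gibbs u j g • innerSL ℝ (u j)) g := by
    refine (hs.log (sum_exp_pos u g).ne').congr_fderiv ?_
    rw [Finset.smul_sum]
    refine Finset.sum_congr rfl fun j _ => ?_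
    rw [smul_smul, gibbs, div_eq_inv_mul]
  have hg : gibbs u i = fun g => Real.exp (innerSL ℝ (u i) g - lse u g) := by
    funext g
    rw [Real.exp_sub, lse, Real.exp_log (sum_exp_pos u g)]
    rfl
  have h := (((innerSL ℝ (u i)).hasFDerivAt (x := g)).fun_sub hl).exp
  rw [hg]
  exact h

lemma abs_lse_le (u : ι → V) (g : V) :
    |lse u g| ≤ Real.log (Fintype.card ι) + (∑ i, ‖u i‖) * ‖g‖ := by
  set S := (∑ i, ‖u i‖) * ‖g‖
  have hb : ∀ i, |inner ℝ (u i) g| ≤ S := fun i =>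
    (abs_real_inner_le_norm _ _).trans (mul_le_mul_of_nonneg_right
      (Finset.single_le_sum (f := fun i => ‖u i‖) (fun j _ => norm_nonneg _) (Finset.mem_univ i))
      (norm_nonneg _))
  have hc : (1 : ℝ) ≤ Fintype.card ι := by exact_mod_cast Fintype.card_pos
  have hlc : 0 ≤ Real.log (Fintype.card ι) := Real.log_nonneg hc
  have hlow : -S ≤ lse u g := by
    unfold lse
    rw [Real.le_log_iff_exp_le (sum_exp_pos u g)]
    obtain ⟨i⟩ := ‹Nonempty ι›
    refine le_trans (Real.exp_le_exp.2 (neg_le_of_abs_le (hb i))) ?_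
    exact Finset.single_le_sum (f := fun i => Real.exp (inner ℝ (u i) g))
      (fun j _ => (Real.exp_pos _).le) (Finset.mem_univ i)
  have hup : lse u g ≤ Real.log (Fintype.card ι) + S := by
    unfold lse
    rw [Real.log_le_iff_le_exp (sum_exp_pos u g), Real.exp_add, Real.exp_log (by linarith)]
    calc ∑ i, Real.exp (inner ℝ (u i) g) ≤ ∑ _i : ι, Real.exp S :=
          Finset.sum_le_sum fun i _ => Real.exp_le_exp.2 (le_of_abs_le (hb i))
      _ = _ := by simp
  rw [abs_le]
  constructor <;> linarith

lemma continuous_lse (u : ι → V) : Continuous (lse u) := by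
  unfold lse
  exact Continuous.log (by fun_prop) fun g => (sum_exp_pos u g).ne'

lemma integrable_lse (u : ι → V) : Integrable (lse u) (stdGaussian V) := by
  have : Integrable (fun g : V => Real.log (Fintype.card ι) + (∑ i, ‖u i‖) * ‖g‖)
      (stdGaussian V) :=
    (integrable_const _).add (integrable_norm_stdGaussian.const_mul _)
  exact this.mono' (continuous_lse u).aestronglyMeasurable
    (Eventually.of_forall fun g => abs_lse_le u g)

lemma integral_gibbs_mul_inner (u : ι → V) (i : ι) (a : V) :
    ∫ g, gibbs u i g * inner ℝ a g ∂(stdGaussian V) =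
      ∫ g, gibbs u i g * (inner ℝ (u i) a - ∑ j, gibbs u j g * inner ℝ (u j) a)
        ∂(stdGaussian V) := by
  have h := gaussian_integration_by_parts (V := V) (F := gibbs u i)
    (F' := fun g => gibbs u i g • (innerSL ℝ (u i) - ∑ j, gibbs u j g • innerSL ℝ (u j)))
    (hasFDerivAt_gibbs u i)
    (by
      have hc := continuous_gibbs u
      refine (hc i).smul (continuous_const.sub ?_)
      exact continuous_finsetSum _ fun j _ => (hc j).smul continuous_const)
    (B := 1) (B' := ‖u i‖ + ∑ j, ‖u j‖)
    (fun g => by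
      rw [abs_of_nonneg (gibbs_nonneg u i g)]; exact gibbs_le_one u i g)
    (fun g => by
      rw [norm_smul, Real.norm_eq_abs, abs_of_nonneg (gibbs_nonneg u i g)]
      refine (mul_le_of_le_one_left (norm_nonneg _) (gibbs_le_one u i g)).trans ?_
      refine (norm_sub_le _ _).trans (add_le_add (by simp) ?_)
      refine (norm_sum_le _ _).trans (Finset.sum_le_sum fun j _ => ?_)
      rw [norm_smul, Real.norm_eq_abs, abs_of_nonneg (gibbs_nonneg u j g)]
      exact (mul_le_of_le_one_left (norm_nonneg _) (gibbs_le_one u j g)).trans (by simp)) a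
  rw [h]
  simp

lemma integral_lse_mono (v w : ι → V) (horth : ∀ i j, inner ℝ (v i) (w j) = (0 : ℝ))
    (h : ∀ i j, ‖v i - v j‖ ^ 2 ≤ ‖w i - w j‖ ^ 2) :
    ∫ g, lse v g ∂(stdGaussian V) ≤ ∫ g, lse w g ∂(stdGaussian V) := by
  set u : ℝ → ι → V := fun θ i => Real.cos θ • v i + Real.sin θ • w i with hu
  set u' : ℝ → ι → V := fun θ i => -Real.sin θ • v i + Real.cos θ • w i with hu'
  have hun : ∀ θ i, ‖u' θ i‖ ≤ ‖v i‖ + ‖w i‖ := by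
    intro θ i
    refine (norm_add_le _ _).trans ?_
    rw [norm_smul, norm_smul, Real.norm_eq_abs, Real.norm_eq_abs, abs_neg]
    nlinarith [Real.abs_cos_le_one θ, Real.abs_sin_le_one θ, norm_nonneg (v i), norm_nonneg (w i)]
  have hder : ∀ θ, HasDerivAt (fun θ : ℝ => ∫ g, lse (u θ) g ∂(stdGaussian V))
      (∫ g, ∑ i, gibbs (u θ) i g * inner ℝ (u' θ i) g ∂(stdGaussian V)) θ := by
    intro θ
    refine (hasDerivAt_integral_of_dominated_loc_of_deriv_le (s := Set.univ)
      (F := fun θ g => lse (u θ) g)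
      (F' := fun θ g => ∑ i, gibbs (u θ) i g * inner ℝ (u' θ i) g)
      (bound := fun g => (∑ i, (‖v i‖ + ‖w i‖)) * ‖g‖)
      univ_mem ?_ ?_ ?_ ?_ ?_ ?_).2
    · exact Eventually.of_forall fun θ => (continuous_lse _).aestronglyMeasurable
    · exact integrable_lse _
    · have := continuous_gibbs (u θ)
      exact Continuous.aestronglyMeasurable (by fun_prop)
    · refine Eventually.of_forall fun g θ _ => ?_
      refine (norm_sum_le _ _).trans ?_
      rw [Finset.sum_mul]
      refine Finset.sum_le_sum fun i _ => ?_
      rw [norm_mul, Real.norm_eq_abs, abs_of_nonneg (gibbs_nonneg (u θ) i g)]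
      refine (mul_le_of_le_one_left (norm_nonneg _) (gibbs_le_one _ _ _)).trans ?_
      exact (abs_real_inner_le_norm _ _).trans
        (mul_le_mul_of_nonneg_right (hun θ i) (norm_nonneg _))
    · exact integrable_norm_stdGaussian.const_mul _
    · refine Eventually.of_forall fun g θ _ => ?_
      have h1 : ∀ i, HasDerivAt (fun θ : ℝ => Real.exp (inner ℝ (u θ i) g))
          (Real.exp (inner ℝ (u θ i) g) * inner ℝ (u' θ i) g) θ := by
        intro i
        have a1 : HasDerivAt (fun θ : ℝ => u θ i) (u' θ i) θ :=
          ((Real.hasDerivAt_cos θ).smul_const (v i)).fun_add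
            ((Real.hasDerivAt_sin θ).smul_const (w i))
        have a2 : HasDerivAt (fun θ : ℝ => inner ℝ (u θ i) g) (inner ℝ (u' θ i) g) θ := by
          simpa using a1.inner ℝ (hasDerivAt_const θ g)
        exact a2.exp
      have h2 : HasDerivAt (fun θ : ℝ => ∑ i, Real.exp (inner ℝ (u θ i) g))
          (∑ i, Real.exp (inner ℝ (u θ i) g) * inner ℝ (u' θ i) g) θ :=
        HasDerivAt.fun_sum fun i _ => h1 i
      refine (h2.log (sum_exp_pos (u θ) g).ne').congr_deriv ?_
      rw [Finset.sum_div]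
      refine Finset.sum_congr rfl fun i _ => ?_
      unfold gibbs; ring
  have hin : ∀ θ i j, inner ℝ (u θ j) (u' θ i) = Real.sin θ * Real.cos θ *
      (inner ℝ (w j) (w i) - inner ℝ (v j) (v i)) := by
    intro θ i j
    simp only [hu, hu', inner_add_left, inner_add_right, real_inner_smul_left,
      real_inner_smul_right, horth]
    rw [real_inner_comm (v i) (w j), horth]
    ring
  have hnn : ∀ θ ∈ Set.Ioo 0 (Real.pi / 2),
      0 ≤ ∫ g, ∑ i, gibbs (u θ) i g * inner ℝ (u' θ i) g ∂(stdGaussian V) := by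
    intro θ hθ
    have hsc : 0 ≤ Real.sin θ * Real.cos θ := by
      refine mul_nonneg (Real.sin_nonneg_of_nonneg_of_le_pi hθ.1.le ?_)
        (Real.cos_nonneg_of_neg_pi_div_two_le_of_le ?_ hθ.2.le) <;>
      linarith [hθ.1, hθ.2, Real.pi_pos]
    rw [integral_finsetSum]
    · simp_rw [integral_gibbs_mul_inner]
      rw [← integral_finsetSum]
      · refine integral_nonneg fun g => ?_
        simp only [hin]
        set p := fun i => gibbs (u θ) i g with hp
        have hp1 : ∑ i, p i = 1 := sum_gibbs _ _
        have hp0 : ∀ i, 0 ≤ p i := fun i => gibbs_nonneg _ _ _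
        set D : ι → ι → ℝ := fun i j => inner ℝ (w j) (w i) - inner ℝ (v j) (v i) with hD
        have hDsym : ∀ i j, D i j = D j i := fun i j => by
          simp only [hD]; rw [real_inner_comm, real_inner_comm (v i)]
        have hDpos : ∀ i j, 0 ≤ D i i + D j j - 2 * D i j := by
          intro i j
          have := h i j
          rw [norm_sub_sq_real, norm_sub_sq_real] at this
          simp only [hD, real_inner_self_eq_norm_sq]
          rw [real_inner_comm (w i), real_inner_comm (v i)]
          linarith
        have key : ∑ i, p i * (Real.sin θ * Real.cos θ * D i i -
            ∑ j, p j * (Real.sin θ * Real.cos θ * D i j)) =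
            Real.sin θ * Real.cos θ * (1 / 2 * ∑ i, ∑ j, p i * p j *
              (D i i + D j j - 2 * D i j)) := by
          have e1 : ∑ i, ∑ j, p i * p j * D i i = ∑ i, p i * D i i := by
            refine Finset.sum_congr rfl fun i _ => ?_
            calc ∑ j, p i * p j * D i i = (p i * D i i) * ∑ j, p j := by
                  rw [Finset.mul_sum]; exact Finset.sum_congr rfl fun j _ => by ring
              _ = _ := by rw [hp1, mul_one]
          have e2 : ∑ i, ∑ j, p i * p j * D j j = ∑ i, p i * D i i := by
            rw [Finset.sum_comm, ← e1]
            exact Finset.sum_congr rfl fun i _ => Finset.sum_congr rfl fun j _ => by ring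
          have e3 : ∑ i, ∑ j, p i * p j * (D i i + D j j - 2 * D i j) =
              2 * ∑ i, p i * D i i - 2 * ∑ i, ∑ j, p i * p j * D i j := by
            calc _ = ∑ i, ∑ j, p i * p j * D i i + ∑ i, ∑ j, p i * p j * D j j
                  - 2 * ∑ i, ∑ j, p i * p j * D i j := by
                  simp only [Finset.mul_sum, ← Finset.sum_add_distrib, ← Finset.sum_sub_distrib]
                  exact Finset.sum_congr rfl fun i _ => Finset.sum_congr rfl fun j _ => by ring
              _ = _ := by rw [e1, e2]; ring
          rw [e3]
          simp only [mul_sub, Finset.sum_sub_distrib, Finset.mul_sum]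
          congr 1
          · exact Finset.sum_congr rfl fun i _ => by ring
          · exact Finset.sum_congr rfl fun i _ => Finset.sum_congr rfl fun j _ => by ring
        rw [Pi.zero_apply]
        refine le_of_le_of_eq ?_ key.symm
        refine mul_nonneg hsc (mul_nonneg (by norm_num) ?_)
        exact Finset.sum_nonneg fun i _ => Finset.sum_nonneg fun j _ =>
          mul_nonneg (mul_nonneg (hp0 i) (hp0 j)) (hDpos i j)
      · intro i _
        have hc := continuous_gibbs (u θ)
        have hbd : ∀ j g, ‖gibbs (u θ) j g‖ ≤ 1 := fun j g => by
          rw [Real.norm_eq_abs, abs_of_nonneg (gibbs_nonneg _ _ _)]; exact gibbs_le_one _ _ _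
        have hI : ∀ j, Integrable (gibbs (u θ) j) (stdGaussian V) := fun j =>
          Integrable.of_bound (hc j).aestronglyMeasurable 1 (Eventually.of_forall (hbd j))
        refine Integrable.bdd_mul (c := 1) ?_ (hc i).aestronglyMeasurable
          (Eventually.of_forall (hbd i))
        exact (integrable_const _).sub (integrable_finsetSum _ fun j _ => (hI j).mul_const _)
    · intro i _
      refine (integrable_inner_stdGaussian (u' θ i)).bdd_mul (c := 1)
        (continuous_gibbs (u θ) i).aestronglyMeasurable (Eventually.of_forall fun g => ?_)
      rw [Real.norm_eq_abs, abs_of_nonneg (gibbs_nonneg _ _ _)]; exact gibbs_le_one _ _ _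
  have hmono : MonotoneOn (fun θ : ℝ => ∫ g, lse (u θ) g ∂(stdGaussian V))
      (Set.Icc 0 (Real.pi / 2)) := by
    refine monotoneOn_of_deriv_nonneg (convex_Icc _ _)
      (fun θ _ => (hder θ).continuousAt.continuousWithinAt)
      (fun θ _ => (hder θ).differentiableAt.differentiableWithinAt) fun θ hθ => ?_
    rw [interior_Icc] at hθ
    rw [(hder θ).deriv]
    exact hnn θ hθ
  have hpi := Real.pi_pos
  have := hmono (Set.left_mem_Icc.2 (by positivity)) (Set.right_mem_Icc.2 (by positivity))
    (by positivity)
  simpa [hu] using this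

end SudakovFernique

section GaussianMaps

variable {U V W : Type*} [NormedAddCommGroup U] [InnerProductSpace ℝ U] [FiniteDimensional ℝ U]
  [MeasurableSpace U] [BorelSpace U]
  [NormedAddCommGroup V] [InnerProductSpace ℝ V] [FiniteDimensional ℝ V]
  [MeasurableSpace V] [BorelSpace V]
  [NormedAddCommGroup W] [InnerProductSpace ℝ W] [FiniteDimensional ℝ W]
  [MeasurableSpace W] [BorelSpace W]

lemma charFun_map_stdGaussian {T : U → V} (hT : Measurable T) {S : V → U}
    (h : ∀ x t, inner ℝ (T x) t = inner ℝ x (S t)) (t : V) :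
    charFun ((stdGaussian U).map T) t = charFun (stdGaussian U) (S t) := by
  rw [charFun_apply, charFun_apply, integral_map hT.aemeasurable]
  · simp_rw [h]
  · exact Continuous.aestronglyMeasurable (by fun_prop)

/-- Images of Gaussians under linear maps are determined by the norms of the adjoints. -/
lemma map_stdGaussian_eq_map {T : U → W} (hT : Measurable T) {S : W → U}
    (h : ∀ x t, inner ℝ (T x) t = inner ℝ x (S t))
    {T' : V → W} (hT' : Measurable T') {S' : W → V}
    (h' : ∀ x t, inner ℝ (T' x) t = inner ℝ x (S' t)) (hn : ∀ t, ‖S t‖ = ‖S' t‖) :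
    (stdGaussian U).map T = (stdGaussian V).map T' := by
  have := Measure.isProbabilityMeasure_map (μ := stdGaussian U) hT.aemeasurable
  have := Measure.isProbabilityMeasure_map (μ := stdGaussian V) hT'.aemeasurable
  refine Measure.ext_of_charFun (funext fun t => ?_)
  rw [charFun_map_stdGaussian hT h, charFun_map_stdGaussian hT' h', charFun_stdGaussian,
    charFun_stdGaussian, hn]

lemma map_stdGaussian_eq {T : U → V} (hT : Measurable T) {S : V → U}
    (h : ∀ x t, inner ℝ (T x) t = inner ℝ x (S t)) (hn : ∀ t, ‖S t‖ = ‖t‖) :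
    (stdGaussian U).map T = stdGaussian V := by
  rw [map_stdGaussian_eq_map hT h measurable_id (S' := id) (fun _ _ => rfl) hn, Measure.map_id]

lemma map_toLp_pi_stdGaussian {I : Type*} [Fintype I] :
    (Measure.pi fun _ : I => stdGaussian V).map (WithLp.toLp 2) =
      stdGaussian (PiLp 2 fun _ : I => V) := by
  have := Measure.isProbabilityMeasure_map (μ := Measure.pi fun _ : I => stdGaussian V)
    (f := WithLp.toLp 2) (by fun_prop)
  refine Measure.ext_of_charFun (funext fun t => ?_)
  rw [charFun_pi, charFun_stdGaussian]
  simp_rw [charFun_stdGaussian]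
  rw [← Complex.exp_sum]
  congr 1
  rw [← Complex.ofReal_pow, PiLp.norm_sq_eq_of_L2]
  push_cast
  rw [← Finset.sum_div, ← Finset.sum_neg_distrib]

lemma pi_stdGaussian_eq_map {I : Type*} [Fintype I] :
    (Measure.pi fun _ : I => stdGaussian V) =
      (stdGaussian (PiLp 2 fun _ : I => V)).map (WithLp.ofLp) := by
  rw [← map_toLp_pi_stdGaussian, Measure.map_map (by fun_prop) (by fun_prop)]
  exact Measure.map_id.symm

lemma map_toLp_prod_stdGaussian :
    ((stdGaussian V).prod (stdGaussian W)).map (WithLp.toLp 2) =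
      stdGaussian (WithLp 2 (V × W)) := by
  have := Measure.isProbabilityMeasure_map (μ := (stdGaussian V).prod (stdGaussian W))
    (f := WithLp.toLp 2) (by fun_prop)
  refine Measure.ext_of_charFun (funext fun t => ?_)
  rw [charFun_prod, charFun_stdGaussian, charFun_stdGaussian, charFun_stdGaussian,
    ← Complex.exp_add]
  congr 1
  rw [← Complex.ofReal_pow, ← Complex.ofReal_pow, ← Complex.ofReal_pow,
    WithLp.prod_norm_sq_eq_of_L2]
  push_cast
  simp only [WithLp.fst, WithLp.snd]
  ring

lemma prod_stdGaussian_eq_map :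
    (stdGaussian V).prod (stdGaussian W) =
      (stdGaussian (WithLp 2 (V × W))).map WithLp.ofLp := by
  rw [← map_toLp_prod_stdGaussian, Measure.map_map (by fun_prop) (by fun_prop)]
  exact Measure.map_id.symm

end GaussianMaps

section Comparison

variable {V W : Type*} 
  [NormedAddCommGroup V] [InnerProductSpace ℝ V] [FiniteDimensional ℝ V]
  [MeasurableSpace V] [BorelSpace V]
  [NormedAddCommGroup W] [InnerProductSpace ℝ W] [FiniteDimensional ℝ W]
  [MeasurableSpace W] [BorelSpace W]
  {ι : Type*} [Fintype ι] [Nonempty ι]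

/-- Maximum of finitely many linear functionals. -/
def maxInner (v : ι → V) (g : V) : ℝ :=
  Finset.univ.sup' Finset.univ_nonempty fun i => inner ℝ (v i) g

lemma inner_le_maxInner (v : ι → V) (g : V) (i : ι) : inner ℝ (v i) g ≤ maxInner v g :=
  Finset.le_sup' (fun i => inner ℝ (v i) g) (Finset.mem_univ i)

lemma maxInner_le {v : ι → V} {g : V} {B : ℝ} (h : ∀ i, inner ℝ (v i) g ≤ B) :
    maxInner v g ≤ B := Finset.sup'_le _ _ fun i _ => h i

lemma lipschitzWith_maxInner (v : ι → V) {K : ℝ≥0} (h : ∀ i, ‖v i‖ ≤ K) :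
    LipschitzWith K (maxInner v) := by
  refine LipschitzWith.of_le_add_mul K fun x y => maxInner_le fun i => ?_
  have h1 := inner_le_maxInner v y i
  have h2 : inner ℝ (v i) x - inner ℝ (v i) y ≤ K * dist x y := by
    rw [← inner_sub_right, dist_eq_norm]
    exact (real_inner_le_norm _ _).trans (mul_le_mul_of_nonneg_right (h i) (norm_nonneg _))
  linarith

lemma integrable_maxInner (v : ι → V) : Integrable (maxInner v) (stdGaussian V) := by
  have h := lipschitzWith_maxInner v (K := ∑ i, ‖v i‖₊) fun i => by
    exact_mod_cast Finset.single_le_sum (f := fun i => ‖v i‖₊) (fun _ _ => zero_le)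
      (Finset.mem_univ i)
  exact (memLp_two_of_lipschitz h).integrable (by norm_num)

lemma maxInner_le_lse (v : ι → V) (β : ℝ) (g : V) :
    β * maxInner v g ≤ lse (fun i => β • v i) g := by
  obtain ⟨i, -, hi⟩ := Finset.exists_mem_eq_sup' Finset.univ_nonempty fun i => inner ℝ (v i) g
  rw [maxInner, hi, lse, Real.le_log_iff_exp_le (sum_exp_pos _ _)]
  have := Finset.single_le_sum (f := fun i => Real.exp (inner ℝ (β • v i) g))
      (fun j _ => (Real.exp_pos _).le) (Finset.mem_univ i)
  rwa [real_inner_smul_left] at this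

lemma lse_le_maxInner (v : ι → V) {β : ℝ} (hβ : 0 < β) (g : V) :
    lse (fun i => β • v i) g ≤ β * maxInner v g + Real.log (Fintype.card ι) := by
  have hc : (0 : ℝ) < Fintype.card ι := by exact_mod_cast Fintype.card_pos
  rw [lse, Real.log_le_iff_le_exp (sum_exp_pos _ _), Real.exp_add, Real.exp_log hc]
  calc ∑ i, Real.exp (inner ℝ (β • v i) g) ≤ ∑ _i : ι, Real.exp (β * maxInner v g) := by
        refine Finset.sum_le_sum fun i _ => Real.exp_le_exp.2 ?_
        rw [real_inner_smul_left]
        exact mul_le_mul_of_nonneg_left (inner_le_maxInner v g i) hβ.le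
    _ = _ := by simp [mul_comm]

lemma integral_maxInner_mono_of_orthogonal (v w : ι → V)
    (horth : ∀ i j, inner ℝ (v i) (w j) = (0 : ℝ)) (h : ∀ i j, ‖v i - v j‖ ≤ ‖w i - w j‖) :
    ∫ g, maxInner v g ∂(stdGaussian V) ≤ ∫ g, maxInner w g ∂(stdGaussian V) := by
  have key : ∀ β : ℝ, 0 < β → ∫ g, maxInner v g ∂(stdGaussian V) ≤
      ∫ g, maxInner w g ∂(stdGaussian V) + Real.log (Fintype.card ι) / β := by
    intro β hβ
    have h1 := integral_lse_mono (fun i => β • v i) (fun i => β • w i)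
      (fun i j => by rw [real_inner_smul_left, real_inner_smul_right, horth]; simp)
      (fun i j => by
        rw [← smul_sub, ← smul_sub, norm_smul, norm_smul]
        have := h i j
        gcongr)
    have h2 : β * ∫ g, maxInner v g ∂(stdGaussian V) ≤
        ∫ g, lse (fun i => β • v i) g ∂(stdGaussian V) := by
      rw [← integral_const_mul]
      exact integral_mono ((integrable_maxInner v).const_mul β) (integrable_lse _)
        fun g => maxInner_le_lse v β g
    have h3 : ∫ g, lse (fun i => β • w i) g ∂(stdGaussian V) ≤
        β * ∫ g, maxInner w g ∂(stdGaussian V) + Real.log (Fintype.card ι) := by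
      have : ∫ g, (β * maxInner w g + Real.log (Fintype.card ι)) ∂(stdGaussian V) =
          β * ∫ g, maxInner w g ∂(stdGaussian V) + Real.log (Fintype.card ι) := by
        rw [integral_add ((integrable_maxInner w).const_mul β) (integrable_const _),
          integral_const_mul]
        simp
      rw [← this]
      exact integral_mono (integrable_lse _)
        (((integrable_maxInner w).const_mul β).add (integrable_const _))
        fun g => lse_le_maxInner w hβ g
    have h4 := h2.trans (h1.trans h3)
    rw [← sub_nonneg] at h4 ⊢
    have : (∫ g, maxInner w g ∂(stdGaussian V) + Real.log (Fintype.card ι) / β) -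
      ∫ g, maxInner v g ∂(stdGaussian V) = (β * ∫ g, maxInner w g ∂(stdGaussian V) +
        Real.log (Fintype.card ι) - β * ∫ g, maxInner v g ∂(stdGaussian V)) / β := by
      field_simp
    rw [this]
    positivity
  have hlim : Tendsto (fun β : ℝ => ∫ g, maxInner w g ∂(stdGaussian V) +
      Real.log (Fintype.card ι) / β) atTop (nhds (∫ g, maxInner w g ∂(stdGaussian V) + 0)) :=
    tendsto_const_nhds.add (tendsto_const_nhds.div_atTop tendsto_id)
  rw [add_zero] at hlim
  exact ge_of_tendsto hlim ((eventually_gt_atTop 0).mono key)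

/-- The Sudakov–Fernique comparison inequality. -/
lemma integral_maxInner_mono (v : ι → V) (w : ι → W) (h : ∀ i j, ‖v i - v j‖ ≤ ‖w i - w j‖) :
    ∫ g, maxInner v g ∂(stdGaussian V) ≤ ∫ g, maxInner w g ∂(stdGaussian W) := by
  set v' : ι → WithLp 2 (V × W) := fun i => WithLp.toLp 2 (v i, 0) with hv'
  set w' : ι → WithLp 2 (V × W) := fun i => WithLp.toLp 2 (0, w i) with hw'
  have hn1 : ∀ t : V, ‖WithLp.toLp 2 (t, (0 : W))‖ = ‖t‖ := fun t => by
    simp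
  have hn2 : ∀ t : W, ‖WithLp.toLp 2 ((0 : V), t)‖ = ‖t‖ := fun t => by
    simp
  have m1 : (stdGaussian (WithLp 2 (V × W))).map (fun x => x.fst) = stdGaussian V :=
    map_stdGaussian_eq (by fun_prop) (S := fun t => WithLp.toLp 2 (t, 0))
      (fun x t => by simp [WithLp.prod_inner_apply]) hn1
  have m2 : (stdGaussian (WithLp 2 (V × W))).map (fun x => x.snd) = stdGaussian W :=
    map_stdGaussian_eq (by fun_prop) (S := fun t => WithLp.toLp 2 (0, t))
      (fun x t => by simp [WithLp.prod_inner_apply]) hn2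
  have h1 : ∫ g, maxInner v g ∂(stdGaussian V) =
      ∫ g, maxInner v' g ∂(stdGaussian (WithLp 2 (V × W))) := by
    rw [← m1, integral_map (by fun_prop) (by
      rw [m1]; exact (integrable_maxInner v).aestronglyMeasurable)]
    simp [maxInner, hv', WithLp.prod_inner_apply]
  have h2 : ∫ g, maxInner w g ∂(stdGaussian W) =
      ∫ g, maxInner w' g ∂(stdGaussian (WithLp 2 (V × W))) := by
    rw [← m2, integral_map (by fun_prop) (by
      rw [m2]; exact (integrable_maxInner w).aestronglyMeasurable)]
    simp [maxInner, hw', WithLp.prod_inner_apply]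
  rw [h1, h2]
  refine integral_maxInner_mono_of_orthogonal v' w' (fun i j => by
    simp [hv', hw', WithLp.prod_inner_apply]) fun i j => ?_
  have e1 : v' i - v' j = WithLp.toLp 2 (v i - v j, 0) := by
    rw [hv']; simp [← WithLp.toLp_sub]
  have e2 : w' i - w' j = WithLp.toLp 2 (0, w i - w j) := by
    rw [hw']; simp [← WithLp.toLp_sub]
  rw [e1, e2, hn1, hn2]
  exact h i j

end Comparison

section SupBound

variable {V W : Type*}
  [NormedAddCommGroup V] [InnerProductSpace ℝ V] [FiniteDimensional ℝ V]
  [MeasurableSpace V] [BorelSpace V]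
  [NormedAddCommGroup W] [InnerProductSpace ℝ W] [FiniteDimensional ℝ W]
  [MeasurableSpace W] [BorelSpace W]

lemma measure_abs_sub_ge_le_of_lipschitz {F : V → ℝ} {K : ℝ≥0} (hF : LipschitzWith K F)
    {t : ℝ} (ht : 0 < t) :
    stdGaussian V {g | t ≤ |F g - ∫ x, F x ∂(stdGaussian V)|} ≤
      ENNReal.ofReal (2 * (K : ℝ) ^ 2 / t ^ 2) := by
  refine (meas_ge_le_variance_div_sq (memLp_two_of_lipschitz hF) ht).trans ?_
  refine ENNReal.ofReal_le_ofReal ?_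
  have := variance_le_of_lipschitz hF
  gcongr

lemma measure_gt_le_of_lipschitz {F : V → ℝ} {K : ℝ≥0} (hF : LipschitzWith K F)
    {B t : ℝ} (hB : ∫ x, F x ∂(stdGaussian V) ≤ B) (ht : 0 < t) :
    stdGaussian V {g | B + t < F g} ≤ ENNReal.ofReal (2 * (K : ℝ) ^ 2 / t ^ 2) := by
  refine (measure_mono fun g hg => ?_).trans (measure_abs_sub_ge_le_of_lipschitz hF ht)
  have hg : B + t < F g := hg
  exact (by linarith : t ≤ F g - ∫ x, F x ∂(stdGaussian V)).trans (le_abs_self _)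

/-- A deviation bound for the supremum of a Gaussian process dominated by a simpler one. -/
lemma measure_exists_inner_gt_le {X : Type*} [TopologicalSpace X]
    [TopologicalSpace.SeparableSpace X] {v : X → V} (hv : Continuous v) {w : X → W}
    (h : ∀ x y, ‖v x - v y‖ ≤ ‖w x - w y‖) {K : ℝ≥0} (hK : ∀ x, ‖v x‖ ≤ K)
    {Ψ : W → ℝ} (hΨ : Integrable Ψ (stdGaussian W)) (hw : ∀ x g, inner ℝ (w x) g ≤ Ψ g)
    {B t : ℝ} (hB : ∫ g, Ψ g ∂(stdGaussian W) ≤ B) (ht : 0 < t) :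
    stdGaussian V {g | ∃ x, B + t < inner ℝ (v x) g} ≤
      ENNReal.ofReal (2 * (K : ℝ) ^ 2 / t ^ 2) := by
  rcases isEmpty_or_nonempty X with hX | hX
  · simp
  set D := TopologicalSpace.denseSeq X
  set F : ℕ → V → ℝ := fun n => maxInner (fun i : Fin (n + 1) => v (D i)) with hF
  set E : ℕ → Set V := fun n => {g | B + t < F n g} with hE
  have hsub : {g | ∃ x, B + t < inner ℝ (v x) g} ⊆ ⋃ n, E n := by
    rintro g ⟨x, hx⟩
    have ho : IsOpen {x | B + t < inner ℝ (v x) g} :=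
      isOpen_lt continuous_const (by fun_prop)
    obtain ⟨y, hy, n, rfl⟩ := (TopologicalSpace.denseRange_denseSeq X).inter_open_nonempty _ ho
      ⟨x, hx⟩
    have hy : B + t < inner ℝ (v (D n)) g := hy
    have := inner_le_maxInner (fun i : Fin (n + 1) => v (D i)) g (Fin.last n)
    exact Set.mem_iUnion.2 ⟨n, show B + t < F n g from hy.trans_le this⟩
  have hmono : Monotone E := by
    refine monotone_nat_of_le_succ fun n g hg => lt_of_lt_of_le hg (maxInner_le fun i => ?_)
    exact inner_le_maxInner (fun i : Fin (n + 1 + 1) => v (D i)) g i.castSucc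
  refine (measure_mono hsub).trans ?_
  rw [hmono.measure_iUnion]
  refine iSup_le fun n => measure_gt_le_of_lipschitz
    (lipschitzWith_maxInner _ fun i => hK _) ?_ ht
  refine le_trans (integral_maxInner_mono (fun i : Fin (n + 1) => v (D i))
    (fun i : Fin (n + 1) => w (D i)) fun i j => h _ _) (le_trans ?_ hB)
  exact integral_mono (integrable_maxInner _) hΨ fun g => maxInner_le fun i => hw _ _

end SupBound

section Ramsey

lemma exists_endHomogeneous {C : Type} [Finite C] (m : ℕ) :
    ∃ N : ℕ, ∀ (χ : ℕ → ℕ → C) (s : Finset ℕ), N ≤ s.card →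
      ∃ (a : Fin m → ℕ) (c : Fin m → C), StrictMono a ∧ (∀ i, a i ∈ s) ∧
        ∀ i j, i < j → χ (a i) (a j) = c i := by
  classical
  have := Fintype.ofFinite C
  induction m with
  | zero => exact ⟨0, fun χ s _ => ⟨Fin.elim0, Fin.elim0, fun i => i.elim0, fun i => i.elim0,
      fun i => i.elim0⟩⟩
  | succ m ih =>
    obtain ⟨N, hN⟩ := ih
    refine ⟨Fintype.card C * N + 1, fun χ s hs => ?_⟩
    have hne : s.Nonempty := Finset.card_pos.1 (by omega)
    set x := s.min' hne with hx
    have hcard : Fintype.card C * N ≤ (s.erase x).card := by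
      rw [Finset.card_erase_of_mem (s.min'_mem hne)]; omega
    have hC : (Finset.univ : Finset C).Nonempty := ⟨χ 0 0, Finset.mem_univ _⟩
    obtain ⟨c0, -, hc0⟩ := Finset.exists_le_card_fiber_of_mul_le_card_of_maps_to
      (s := s.erase x) (t := (Finset.univ : Finset C)) (f := fun y => χ x y) (n := N)
      (fun _ _ => Finset.mem_univ _) hC (by simpa using hcard)
    obtain ⟨a, c, ha, has, hac⟩ := hN χ _ hc0
    have hmem : ∀ i, a i ∈ s.erase x ∧ χ x (a i) = c0 := fun i => Finset.mem_filter.1 (has i)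
    have hlt : ∀ i, x < a i := fun i =>
      lt_of_le_of_ne (s.min'_le _ (Finset.mem_of_mem_erase (hmem i).1))
        (Finset.ne_of_mem_erase (hmem i).1).symm
    refine ⟨Fin.cons x a, Fin.cons c0 c, ?_, ?_, ?_⟩
    · intro i j hij
      induction i using Fin.cases with
      | zero =>
        induction j using Fin.cases with
        | zero => exact absurd hij (lt_irrefl _)
        | succ j => simpa using hlt j
      | succ i =>
        induction j using Fin.cases with
        | zero => exact absurd hij (Fin.not_lt_zero _)
        | succ j => simpa using ha (Fin.succ_lt_succ_iff.1 hij)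
    · intro i
      induction i using Fin.cases with
      | zero => simpa using s.min'_mem hne
      | succ i => simpa using Finset.mem_of_mem_erase (hmem i).1
    · intro i j hij
      induction i using Fin.cases with
      | zero =>
        induction j using Fin.cases with
        | zero => exact absurd hij (lt_irrefl _)
        | succ j => simpa using (hmem j).2
      | succ i =>
        induction j using Fin.cases with
        | zero => exact absurd hij (Fin.not_lt_zero _)
        | succ j => simpa using hac i j (Fin.succ_lt_succ_iff.1 hij)

/-- The finite Ramsey theorem for pairs. -/
lemma exists_ramsey {C : Type} [Finite C] (K : ℕ) :
    ∃ N : ℕ, ∀ χ : ℕ → ℕ → C, ∃ (a : Fin K → ℕ) (c : C), StrictMono a ∧ (∀ i, a i < N) ∧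
      ∀ i j, i < j → χ (a i) (a j) = c := by
  classical
  have := Fintype.ofFinite C
  obtain ⟨N, hN⟩ := exists_endHomogeneous (C := C) (Fintype.card C * K)
  refine ⟨N, fun χ => ?_⟩
  obtain ⟨a, c, ha, has, hac⟩ := hN χ (Finset.range N) (by simp)
  have hC : (Finset.univ : Finset C).Nonempty := ⟨χ 0 0, Finset.mem_univ _⟩
  obtain ⟨c0, -, hc0⟩ := Finset.exists_le_card_fiber_of_mul_le_card_of_maps_to
      (s := (Finset.univ : Finset (Fin (Fintype.card C * K)))) (t := (Finset.univ : Finset C))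
      (f := c) (n := K) (fun _ _ => Finset.mem_univ _) hC (by simp)
  obtain ⟨t, hts, htc⟩ := Finset.exists_subset_card_eq hc0
  have hmem : ∀ i, c (t.orderEmbOfFin htc i) = c0 := fun i =>
    (Finset.mem_filter.1 (hts (t.orderEmbOfFin_mem htc i))).2
  refine ⟨fun i => a (t.orderEmbOfFin htc i), c0, fun i j hij => ha (by simpa using hij),
    fun i => by simpa using has (t.orderEmbOfFin htc i), fun i j hij => ?_⟩
  rw [hac _ _ (by simpa using hij), hmem]

lemma exists_ramsey_fin {C : Type} [Finite C] [Nonempty C] (K : ℕ) :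
    ∃ N : ℕ, ∀ χ : Fin N → Fin N → C, ∃ a : Fin K → Fin N, StrictMono a ∧
      (∃ c, ∀ i j, i < j → χ (a i) (a j) = c) ∧ ∃ c, ∀ i, χ (a i) (a i) = c := by
  obtain ⟨N, hN⟩ := exists_ramsey (C := C × C) (K + 1)
  refine ⟨N, fun χ => ?_⟩
  rcases Nat.eq_zero_or_pos N with rfl | hpos
  · exfalso
    obtain ⟨c⟩ := ‹Nonempty C›
    obtain ⟨a, -, -, h, -⟩ := hN fun _ _ => (c, c)
    exact absurd (h 0) (by omega)
  set p : ℕ → Fin N := fun n => ⟨n % N, Nat.mod_lt _ hpos⟩ with hp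
  obtain ⟨a, c, ha, haN, hac⟩ := hN fun i j => (χ (p i) (p j), χ (p i) (p i))
  have hpa : ∀ i, p (a i) = ⟨a i, haN i⟩ := fun i => by
    ext; simp [hp, Nat.mod_eq_of_lt (haN i)]
  refine ⟨fun i => ⟨a i.castSucc, haN _⟩, fun i j hij => ha (by simpa using hij),
    ⟨c.1, fun i j hij => ?_⟩, ⟨c.2, fun i => ?_⟩⟩
  · have := hac i.castSucc j.castSucc (by simpa using hij)
    rw [hpa, hpa] at this
    rw [← this]
  · have := hac i.castSucc (Fin.last K) (Fin.castSucc_lt_last i)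
    rw [hpa, hpa] at this
    rw [← this]

/-- A product Ramsey theorem for pairs of words. -/
lemma exists_product_ramsey (D : ℕ) : ∀ {C : Type} [Finite C] [Nonempty C] (K : ℕ),
    ∃ K' : ℕ, ∀ χ : (Fin D → Fin K') → (Fin D → Fin K') → C,
      ∃ a : Fin D → Fin K → Fin K', (∀ d, StrictMono (a d)) ∧
        ∀ A : Fin D → Prop, ∃ c, ∀ w w' : Fin D → Fin K, (∀ d, A d → w d = w' d) →
          (∀ d, ¬ A d → w d < w' d) → χ (fun d => a d (w d)) (fun d => a d (w' d)) = c := by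
  induction D with
  | zero =>
    intro C _ _ K
    refine ⟨0, fun χ => ⟨Fin.elim0, fun d => d.elim0, fun A => ⟨χ Fin.elim0 Fin.elim0,
      fun w w' _ _ => ?_⟩⟩⟩
    congr 1 <;> exact Subsingleton.elim _ _
  | succ D ih =>
    intro C _ _ K
    obtain ⟨K₁, h₁⟩ := ih (C := C × C) K
    obtain ⟨K₂, h₂⟩ := exists_ramsey_fin (C := (Fin D → Fin K₁) → (Fin D → Fin K₁) → C) K
    refine ⟨max K₁ K₂, fun χ => ?_⟩
    set e₁ : Fin K₁ → Fin (max K₁ K₂) := Fin.castLE (le_max_left _ _)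
    set e₂ : Fin K₂ → Fin (max K₁ K₂) := Fin.castLE (le_max_right _ _)
    obtain ⟨a₂, ha₂, ⟨c, hc⟩, c', hc'⟩ := h₂ fun i j u u' =>
      χ (Fin.cons (e₂ i) fun d => e₁ (u d)) (Fin.cons (e₂ j) fun d => e₁ (u' d))
    obtain ⟨a₁, ha₁, h⟩ := h₁ fun u u' => (c u u', c' u u')
    refine ⟨Fin.cons (fun i => e₂ (a₂ i)) fun d i => e₁ (a₁ d i), fun d => ?_, fun A => ?_⟩
    · induction d using Fin.cases with
      | zero => exact fun i j hij => by simpa [e₂] using ha₂ hij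
      | succ d => exact fun i j hij => by simpa [e₁] using ha₁ d hij
    · obtain ⟨q, hq⟩ := h fun d => A d.succ
      have hcons : ∀ w : Fin (D + 1) → Fin K,
          (fun d => (Fin.cons (fun i => e₂ (a₂ i)) fun d i => e₁ (a₁ d i) :
            Fin (D + 1) → Fin K → Fin (max K₁ K₂)) d (w d)) =
          Fin.cons (e₂ (a₂ (w 0))) fun d => e₁ (a₁ d (w d.succ)) := by
        intro w
        funext d
        induction d using Fin.cases with
        | zero => simp
        | succ d => simp
      by_cases h0 : A 0
      · refine ⟨q.2, fun w w' hw hw' => ?_⟩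
        rw [hcons, hcons, ← hw 0 h0]
        have h3 := congrFun (congrFun (hc' (w 0)) fun d => a₁ d (w d.succ))
          fun d => a₁ d (w' d.succ)
        have h4 := hq (fun d => w d.succ) (fun d => w' d.succ) (fun d => hw d.succ)
          (fun d => hw' d.succ)
        rw [← h4]
        exact h3
      · refine ⟨q.1, fun w w' hw hw' => ?_⟩
        rw [hcons, hcons]
        have h3 := congrFun (congrFun (hc (w 0) (w' 0) (hw' 0 h0)) fun d => a₁ d (w d.succ))
          fun d => a₁ d (w' d.succ)
        have h4 := hq (fun d => w d.succ) (fun d => w' d.succ) (fun d => hw d.succ)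
          (fun d => hw' d.succ)
        rw [← h4]
        exact h3

end Ramsey

section Pools

lemma pow_lintegral_le {α : Type*} [MeasurableSpace α] (μ : Measure α) [IsProbabilityMeasure μ]
    {f : α → ℝ≥0∞} (hf : Measurable f) (n : ℕ) :
    (∫⁻ x, f x ∂μ) ^ n ≤ ∫⁻ x, f x ^ n ∂μ := by
  rcases Nat.eq_zero_or_pos n with rfl | hn
  · simp
  have h := eLpNorm_le_eLpNorm_of_exponent_le (μ := μ) (f := f) (p := 1) (q := n)
    (by exact_mod_cast hn) hf.aestronglyMeasurable
  rw [eLpNorm_one_eq_lintegral_enorm,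
    eLpNorm_eq_lintegral_rpow_enorm_toReal (by exact_mod_cast hn.ne') (by simp)] at h
  simp only [enorm_eq_self, ENNReal.toReal_natCast, ENNReal.rpow_natCast, one_div] at h
  calc (∫⁻ x, f x ∂μ) ^ n ≤ ((∫⁻ x, f x ^ n ∂μ) ^ (n : ℝ)⁻¹) ^ n := by gcongr
    _ = _ := by
      rw [← ENNReal.rpow_natCast, ← ENNReal.rpow_mul, inv_mul_cancel₀ (by exact_mod_cast hn.ne'),
        ENNReal.rpow_one]

/-- If a word of independent letters is good with probability `p`, then in independent pools of
letters all words are simultaneously good with probability at least a power of `p`. -/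
lemma pow_le_measure_forall_words {V : Type*} [MeasurableSpace V] (μ : Measure V)
    [IsProbabilityMeasure μ] (K : ℕ) (D : ℕ) (good : Set (Fin D → V)) (hgood : MeasurableSet good) :
    ((Measure.pi fun _ : Fin D => μ) good) ^ (K ^ D) ≤
      (Measure.pi fun _ : Fin D => Measure.pi fun _ : Fin K => μ)
        {Z | ∀ w : Fin D → Fin K, (fun d => Z d (w d)) ∈ good} := by
  induction D with
  | zero =>
    by_cases h : (Fin.elim0 : Fin 0 → V) ∈ good
    · have h1 : {Z : Fin 0 → Fin K → V | ∀ w : Fin 0 → Fin K, (fun d => Z d (w d)) ∈ good} =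
          Set.univ := Set.eq_univ_of_forall fun Z w => by
        convert h
      rw [h1, measure_univ]
      exact pow_le_one' prob_le_one _
    · have h1 : good = ∅ := by
        ext x
        simp only [Set.mem_empty_iff_false, iff_false]
        convert h
      simp [h1]
  | succ D ih =>
    have hsec : ∀ v : V, MeasurableSet {x : Fin D → V | (Fin.cons v x : Fin (D + 1) → V) ∈ good} :=
      fun v => by
        refine hgood.preimage (measurable_pi_iff.2 fun d => ?_)
        induction d using Fin.cases with
        | zero => simp
        | succ d => simpa using measurable_pi_apply d
    set ν : Measure (Fin K → V) := Measure.pi fun _ => μ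
    set T : (Fin D → Fin K → V) → Set V := fun Z =>
      {v | ∀ w : Fin D → Fin K, (Fin.cons v fun d => Z d (w d) : Fin (D + 1) → V) ∈ good} with hT
    have hTm : MeasurableSet {p : V × (Fin D → Fin K → V) | p.1 ∈ T p.2} := by
      have : {p : V × (Fin D → Fin K → V) | p.1 ∈ T p.2} = ⋂ w : Fin D → Fin K,
          {p | (Fin.cons p.1 fun d => p.2 d (w d) : Fin (D + 1) → V) ∈ good} := by
        ext p; simp [hT]
      rw [this]
      refine MeasurableSet.iInter fun w => hgood.preimage (measurable_pi_iff.2 fun d => ?_)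
      induction d using Fin.cases with
      | zero => simpa using measurable_fst
      | succ d => simp only [Fin.cons_succ]; fun_prop
    have hTZ : ∀ Z, MeasurableSet (T Z) := fun Z =>
      hTm.preimage (measurable_id.prodMk measurable_const)
    have hTμ : Measurable fun Z => μ (T Z) := measurable_measure_prodMk_right hTm
    have e := measurePreserving_piFinSuccAbove (fun _ : Fin (D + 1) => ν) 0
    have hEm : MeasurableSet {p : (Fin K → V) × (Fin D → Fin K → V) | ∀ i, p.1 i ∈ T p.2} := by
      have : {p : (Fin K → V) × (Fin D → Fin K → V) | ∀ i, p.1 i ∈ T p.2} =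
          ⋂ i, {p | p.1 i ∈ T p.2} := by ext; simp
      rw [this]
      refine MeasurableSet.iInter fun i => hTm.preimage
        (f := fun p : (Fin K → V) × (Fin D → Fin K → V) => (p.1 i, p.2)) (by fun_prop)
    have hE : {Z : Fin (D + 1) → Fin K → V | ∀ w : Fin (D + 1) → Fin K,
        (fun d => Z d (w d)) ∈ good} =
        (MeasurableEquiv.piFinSuccAbove (fun _ => Fin K → V) 0) ⁻¹'
          {p | ∀ i, p.1 i ∈ T p.2} := by
      ext Z
      simp only [Set.mem_ofPred_eq, Set.mem_preimage, MeasurableEquiv.piFinSuccAbove_apply, hT]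
      constructor
      · intro h i w
        convert h (Fin.cons i w) using 1
        funext d
        induction d using Fin.cases with
        | zero => simp [Fin.insertNthEquiv]
        | succ d => simp [Fin.insertNthEquiv, Fin.tail]
      · intro h w
        convert h (w 0) (fun d => w d.succ) using 1
        funext d
        induction d using Fin.cases with
        | zero => simp [Fin.insertNthEquiv]
        | succ d => simp [Fin.insertNthEquiv, Fin.tail]
    rw [hE, e.measure_preimage hEm.nullMeasurableSet, Measure.prod_apply_symm hEm]
    have h1 : ∀ Z : Fin D → Fin K → V, ν ((fun x => (x, Z)) ⁻¹'
        {p : (Fin K → V) × (Fin D → Fin K → V) | ∀ i, p.1 i ∈ T p.2}) = μ (T Z) ^ K := by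
      intro Z
      have : ((fun x => (x, Z)) ⁻¹'
        {p : (Fin K → V) × (Fin D → Fin K → V) | ∀ i, p.1 i ∈ T p.2}) =
          Set.univ.pi fun _ => T Z := by ext; simp
      rw [this, Measure.pi_pi]
      simp
    have e' := measurePreserving_piFinSuccAbove (fun _ : Fin (D + 1) => μ) 0
    have hgE : good = (MeasurableEquiv.piFinSuccAbove (fun _ => V) 0) ⁻¹'
        {p : V × (Fin D → V) | (Fin.cons p.1 p.2 : Fin (D + 1) → V) ∈ good} := by
      ext x
      simp only [Set.mem_preimage, Set.mem_ofPred_eq, MeasurableEquiv.piFinSuccAbove_apply]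
      suffices h : (Fin.cons ((Fin.insertNthEquiv (fun _ => V) 0).symm x).1
        ((Fin.insertNthEquiv (fun _ => V) 0).symm x).2 : Fin (D + 1) → V) = x by rw [h]
      funext d
      induction d using Fin.cases with
      | zero => simp [Fin.insertNthEquiv]
      | succ d => simp [Fin.insertNthEquiv, Fin.tail]
    have hgm : MeasurableSet {p : V × (Fin D → V) | (Fin.cons p.1 p.2 : Fin (D + 1) → V) ∈ good} := by
      refine hgood.preimage (measurable_pi_iff.2 fun d => ?_)
      induction d using Fin.cases with
      | zero => simpa using measurable_fst
      | succ d => simp only [Fin.cons_succ]; fun_prop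
    have h2 : (Measure.pi fun _ : Fin (D + 1) => μ) good =
        ∫⁻ v, (Measure.pi fun _ : Fin D => μ)
          {x : Fin D → V | (Fin.cons v x : Fin (D + 1) → V) ∈ good} ∂μ := by
      conv_lhs => rw [hgE]
      rw [e'.measure_preimage hgm.nullMeasurableSet, Measure.prod_apply hgm]
      rfl
    have hpm : Measurable fun v => (Measure.pi fun _ : Fin D => μ)
          {x : Fin D → V | (Fin.cons v x : Fin (D + 1) → V) ∈ good} :=
      measurable_measure_prodMk_left hgm
    simp_rw [h1]
    calc ((Measure.pi fun _ : Fin (D + 1) => μ) good) ^ K ^ (D + 1)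
        = (((Measure.pi fun _ : Fin (D + 1) => μ) good) ^ K ^ D) ^ K := by
          rw [← pow_mul, pow_succ]
      _ ≤ (∫⁻ v, ((Measure.pi fun _ : Fin D => μ)
          {x : Fin D → V | (Fin.cons v x : Fin (D + 1) → V) ∈ good}) ^ K ^ D ∂μ) ^ K := by
          rw [h2]
          gcongr
          exact pow_lintegral_le μ hpm _
      _ ≤ (∫⁻ v, (Measure.pi fun _ : Fin D => ν) ((fun Z => (v, Z)) ⁻¹'
            {p : V × (Fin D → Fin K → V) | p.1 ∈ T p.2}) ∂μ) ^ K := by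
          gcongr with v
          exact ih _ (hsec v)
      _ = (∫⁻ Z, μ (T Z) ∂(Measure.pi fun _ : Fin D => ν)) ^ K := by
          rw [← Measure.prod_apply hTm, Measure.prod_apply_symm hTm]
          rfl
      _ ≤ _ := pow_lintegral_le _ hTμ K

end Pools

section PairLaw

variable {V E : Type*} [NormedAddCommGroup V] [InnerProductSpace ℝ V] [FiniteDimensional ℝ V]
  [MeasurableSpace V] [BorelSpace V]
  [NormedAddCommGroup E] [InnerProductSpace ℝ E] [FiniteDimensional ℝ E]
  [MeasurableSpace E] [BorelSpace E]

/-- The joint law of two linear combinations of independent standard Gaussian vectors. -/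
lemma map_pi_pair {I : Type*} [Fintype I] {α β : I → ℝ} {a c d : ℝ}
    (h₁ : ∑ e, α e ^ 2 = a ^ 2) (h₂ : ∑ e, α e * β e = a * c) (h₃ : ∑ e, β e ^ 2 = c ^ 2 + d ^ 2) :
    (Measure.pi fun _ : I => stdGaussian V).map
      (fun Z => (∑ e, α e • Z e, ∑ e, β e • Z e)) =
    ((stdGaussian V).prod (stdGaussian V)).map (fun p => (a • p.1, c • p.1 + d • p.2)) := by
  rw [pi_stdGaussian_eq_map, prod_stdGaussian_eq_map, Measure.map_map (by fun_prop) (by fun_prop),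
    Measure.map_map (by fun_prop) (by fun_prop)]
  have key : (stdGaussian (PiLp 2 fun _ : I => V)).map
        (fun Z => WithLp.toLp 2 (∑ e, α e • Z e, ∑ e, β e • Z e)) =
      (stdGaussian (WithLp 2 (V × V))).map
        (fun p => WithLp.toLp 2 (a • p.fst, c • p.fst + d • p.snd)) := by
    refine map_stdGaussian_eq_map (by fun_prop)
      (S := fun t => WithLp.toLp 2 fun e => α e • t.fst + β e • t.snd) ?_ (by fun_prop)
      (S' := fun t => WithLp.toLp 2 (a • t.fst + c • t.snd, d • t.snd)) ?_ ?_
    · intro x t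
      simp only [WithLp.prod_inner_apply, WithLp.fst, WithLp.snd, PiLp.inner_apply, inner_add_right, sum_inner,
        real_inner_smul_left, real_inner_smul_right, Finset.sum_add_distrib]
    · intro x t
      simp only [WithLp.prod_inner_apply, WithLp.fst, WithLp.snd, inner_add_right, inner_add_left,
        real_inner_smul_left, real_inner_smul_right]
      ring
    · intro t
      rw [← sq_eq_sq₀ (norm_nonneg _) (norm_nonneg _), PiLp.norm_sq_eq_of_L2,
        WithLp.prod_norm_sq_eq_of_L2]
      change _ = ‖a • t.fst + c • t.snd‖ ^ 2 + ‖d • t.snd‖ ^ 2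
      simp only [norm_add_sq_real, norm_smul, real_inner_smul_left, real_inner_smul_right,
        mul_pow, Real.norm_eq_abs, sq_abs, Finset.sum_add_distrib]
      have e2 : ∑ e, 2 * (β e * (α e * inner ℝ t.fst t.snd)) =
          2 * (∑ e, α e * β e) * inner ℝ t.fst t.snd := by
        rw [Finset.mul_sum, Finset.sum_mul]
        exact Finset.sum_congr rfl fun e _ => by ring
      rw [← Finset.sum_mul, ← Finset.sum_mul, e2, h₁, h₂, h₃]
      ring
  have := congrArg (Measure.map WithLp.ofLp) key
  rw [Measure.map_map (by fun_prop) (by fun_prop), Measure.map_map (by fun_prop) (by fun_prop)]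
    at this
  exact this

lemma integral_pi_pair {I : Type*} [Fintype I] {α β : I → ℝ} {a c d : ℝ}
    (h₁ : ∑ e, α e ^ 2 = a ^ 2) (h₂ : ∑ e, α e * β e = a * c) (h₃ : ∑ e, β e ^ 2 = c ^ 2 + d ^ 2)
    {F : V × V → ℝ} (hF : Continuous F) :
    ∫ Z, F (∑ e, α e • Z e, ∑ e, β e • Z e) ∂(Measure.pi fun _ : I => stdGaussian V) =
      ∫ p, F (a • p.1, c • p.1 + d • p.2) ∂((stdGaussian V).prod (stdGaussian V)) := by
  have h := map_pi_pair (V := V) h₁ h₂ h₃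
  have := congrArg (fun μ => ∫ p, F p ∂μ) h
  rwa [integral_map (by fun_prop) hF.aestronglyMeasurable,
    integral_map (by fun_prop) hF.aestronglyMeasurable] at this

/-- Law of one linear combination. -/
lemma map_pi_sum {I : Type*} [Fintype I] {α : I → ℝ} {a : ℝ} (h₁ : ∑ e, α e ^ 2 = a ^ 2) :
    (Measure.pi fun _ : I => stdGaussian V).map (fun Z => ∑ e, α e • Z e) =
      (stdGaussian V).map (fun p => a • p) := by
  have h := map_pi_pair (V := V) h₁ (β := 0) (c := 0) (d := 0) (by simp) (by simp)
  have := congrArg (Measure.map Prod.fst) h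
  rw [Measure.map_map (by fun_prop) (by fun_prop), Measure.map_map (by fun_prop) (by fun_prop)]
    at this
  have h2 : (stdGaussian V).map (fun p => a • p) =
      (((stdGaussian V).prod (stdGaussian V)).map Prod.fst).map (fun p => a • p) := by
    rw [Measure.map_fst_prod]; simp
  rw [h2, Measure.map_map (by fun_prop) (by fun_prop)]
  exact this

end PairLaw

section Smoothing

variable {V E : Type*} [NormedAddCommGroup V] [InnerProductSpace ℝ V] [FiniteDimensional ℝ V]
  [MeasurableSpace V] [BorelSpace V]
  [NormedAddCommGroup E] [InnerProductSpace ℝ E] [FiniteDimensional ℝ E]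
  [MeasurableSpace E] [BorelSpace E]

/-- Gaussian smoothing of `f` at scale `σ`. -/
def smooth (f : V → E) (σ : ℝ) (b : V) : E := ∫ ω, f (b + σ • ω) ∂(stdGaussian V)

variable {f : V → E} {L : ℝ≥0}

lemma integrable_of_bounded {α : Type*} [MeasurableSpace α] [TopologicalSpace α] [BorelSpace α]
    [SecondCountableTopology α]
    {μ : Measure α} [IsFiniteMeasure μ] {F : Type*} [NormedAddCommGroup F] {g : α → F}
    (hg : Continuous g) {B : ℝ} (hB : ∀ x, ‖g x‖ ≤ B) : Integrable g μ :=
  Integrable.of_bound hg.aestronglyMeasurable B (Eventually.of_forall hB)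

lemma norm_integral_le_one {α : Type*} [MeasurableSpace α] {μ : Measure α} [IsProbabilityMeasure μ]
    {g : α → E} (hB : ∀ x, ‖g x‖ ≤ 1) : ‖∫ x, g x ∂μ‖ ≤ 1 := by
  simpa using norm_integral_le_of_norm_le_const (μ := μ) (C := 1) (Eventually.of_forall hB)

lemma norm_smooth_le (hb : ∀ x, ‖f x‖ ≤ 1) (σ : ℝ) (b : V) : ‖smooth f σ b‖ ≤ 1 :=
  norm_integral_le_one fun _ => hb _

lemma lipschitzWith_smooth (hf : LipschitzWith L f) (hb : ∀ x, ‖f x‖ ≤ 1) (σ : ℝ) :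
    LipschitzWith L (smooth f σ) := by
  have hi : ∀ b, Integrable (fun ω => f (b + σ • ω)) (stdGaussian V) := fun b =>
    integrable_of_bounded (hf.continuous.comp (by fun_prop)) fun _ => hb _
  refine LipschitzWith.of_dist_le_mul fun b b' => ?_
  rw [dist_eq_norm, smooth, smooth, ← integral_sub (hi b) (hi b')]
  have := norm_integral_le_of_norm_le_const (μ := stdGaussian V)
    (f := fun ω => f (b + σ • ω) - f (b' + σ • ω)) (C := L * dist b b')
    (Eventually.of_forall fun ω => by
      rw [← dist_eq_norm]
      simpa using hf.dist_le_mul (b + σ • ω) (b' + σ • ω))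
  simpa using this

/-- A Bessel-type bound on the influence of a single Gaussian letter on a smoothed function. -/
lemma integral_influence_le (hf : LipschitzWith L f) (hb : ∀ x, ‖f x‖ ≤ 1) {m : ℕ} (hm : 1 ≤ m)
    (σ : ℝ) (C : V) :
    ∫ ζ, ‖smooth f (σ * √m) (C + σ • ζ) -
      ∫ ζ', smooth f (σ * √m) (C + σ • ζ') ∂(stdGaussian V)‖ ^ 2 ∂(stdGaussian V) ≤
      1 / (m + 1) := by
  set Y : V → E := fun ζ => smooth f (σ * √m) (C + σ • ζ) with hY
  have hYc : Continuous Y := (lipschitzWith_smooth hf hb _).continuous.comp (by fun_prop)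
  have hYb : ∀ ζ, ‖Y ζ‖ ≤ 1 := fun ζ => norm_smooth_le hb _ _
  set M := ∫ ζ, Y ζ ∂(stdGaussian V)
  have hMb : ‖M‖ ≤ 1 := norm_integral_le_one hYb
  set X : V → E := fun ζ => Y ζ - M with hX
  have hXc : Continuous X := hYc.sub continuous_const
  have hXb : ∀ ζ, ‖X ζ‖ ≤ 2 := fun ζ => (norm_sub_le _ _).trans (by linarith [hYb ζ])
  have hX0 : ∫ ζ, X ζ ∂(stdGaussian V) = 0 := by
    rw [integral_sub (integrable_of_bounded hYc hYb) (integrable_const _)]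
    simp [M]
  set v := ∫ ζ, ‖X ζ‖ ^ 2 ∂(stdGaussian V) with hv
  change v ≤ _
  have hv0 : 0 ≤ v := integral_nonneg fun _ => by positivity
  set π := Measure.pi fun _ : Fin (m + 1) => (stdGaussian V)
  have hm0 : (0 : ℝ) < m := by exact_mod_cast hm
  have hfc := hf.continuous
  set Sf : (Fin (m + 1) → V) → E := fun Z => f (C + σ • ∑ k, Z k) with hSf
  have hSc : Continuous Sf := hfc.comp (by fun_prop)
  have inner_bd : ∀ {a b : E} {A B : ℝ}, ‖a‖ ≤ A → ‖b‖ ≤ B → ‖inner ℝ a b‖ ≤ A * B :=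
    fun {a b A B} ha hb => (norm_inner_le_norm a b).trans
      (mul_le_mul ha hb (norm_nonneg _) ((norm_nonneg _).trans ha))
  have hdiag : ∀ k, ∫ Z, inner ℝ (Sf Z) (X (Z k)) ∂π = v := by
    intro k
    have h := integral_pi_pair (V := V) (I := Fin (m + 1)) (α := fun e => if e = k then 1 else 0)
      (β := fun e => if e = k then 0 else 1) (a := 1) (c := 0) (d := √m) (by simp)
      (by
        rw [mul_zero]
        exact Finset.sum_eq_zero fun e _ => by by_cases h : e = k <;> simp [h]) (by
        simp only [ite_pow, ne_eq, OfNat.ofNat_ne_zero, not_false_eq_true, zero_pow, one_pow]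
        rw [Real.sq_sqrt hm0.le, Finset.sum_ite]
        simp [Finset.filter_ne'])
      (F := fun p => inner ℝ (f (C + σ • (p.1 + p.2))) (X p.1)) (by fun_prop)
    have e1 : ∀ Z : Fin (m + 1) → V, ∑ e, (if e = k then (1 : ℝ) else 0) • Z e = Z k := by
      intro Z; simp
    have e2 : ∀ Z : Fin (m + 1) → V, Z k + ∑ e, (if e = k then (0 : ℝ) else 1) • Z e = ∑ e, Z e := by
      intro Z
      conv_lhs => rw [← e1 Z]
      rw [← Finset.sum_add_distrib]
      refine Finset.sum_congr rfl fun e _ => ?_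
      by_cases h : e = k <;> simp [h]
    simp only [e1, e2, one_smul, zero_smul, zero_add] at h
    rw [hSf]
    rw [h, integral_prod]
    · rw [hv]
      have e3 : ∀ ζ, ∫ ω, inner ℝ (f (C + σ • (ζ + √m • ω))) (X ζ) ∂(stdGaussian V) = inner ℝ (Y ζ) (X ζ) := by
        intro ζ
        simp_rw [real_inner_comm (X ζ)]
        rw [integral_inner (f := fun ω => f (C + σ • (ζ + √m • ω)))
          (integrable_of_bounded (hfc.comp (by fun_prop)) fun _ => hb _)]
        simp only [hY, smooth, smul_add, smul_smul, add_assoc]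
      simp only [e3]
      have e4 : ∀ ζ, inner ℝ (Y ζ) (X ζ) = ‖X ζ‖ ^ 2 + inner ℝ M (X ζ) := by
        intro ζ
        rw [← real_inner_self_eq_norm_sq, ← inner_add_left]
        simp [hX]
      simp only [e4]
      rw [integral_add, integral_inner (integrable_of_bounded hXc hXb), hX0]
      · simp
      · exact integrable_of_bounded (by fun_prop) (B := 4) fun ζ => by
          rw [Real.norm_eq_abs, abs_of_nonneg (by positivity)]
          nlinarith [hXb ζ, norm_nonneg (X ζ)]
      · exact integrable_of_bounded (by fun_prop) fun ζ => inner_bd hMb (hXb ζ)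
    · exact integrable_of_bounded (by fun_prop) fun p => inner_bd (hb _) (hXb _)
  have hoff : ∀ j k : Fin (m + 1), ∫ Z, inner ℝ (X (Z j)) (X (Z k)) ∂π = if j = k then v else 0 := by
    intro j k
    have e1 : ∀ (k : Fin (m + 1)) (Z : Fin (m + 1) → V),
        ∑ e, (if e = k then (1 : ℝ) else 0) • Z e = Z k := by
      intro k Z; simp
    by_cases hjk : j = k
    · subst hjk
      have h := integral_pi_pair (V := V) (I := Fin (m + 1)) (α := fun e => if e = j then 1 else 0)
        (β := fun e => if e = j then 1 else 0) (a := 1) (c := 1) (d := 0) (by simp)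
        (by simp) (by simp) (F := fun p => inner ℝ (X p.1) (X p.2)) (by fun_prop)
      simp only [e1, one_smul, zero_smul, add_zero] at h
      rw [if_pos rfl, h, hv]
      simp only [real_inner_self_eq_norm_sq]
      rw [integral_fun_fst (μ := (stdGaussian V)) (ν := (stdGaussian V)) (fun ζ => ‖X ζ‖ ^ 2)]
      simp
    · have h := integral_pi_pair (V := V) (I := Fin (m + 1)) (α := fun e => if e = j then 1 else 0)
        (β := fun e => if e = k then 1 else 0) (a := 1) (c := 0) (d := 1) (by simp)
        (by simp [Ne.symm hjk]) (by simp) (F := fun p => inner ℝ (X p.1) (X p.2)) (by fun_prop)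
      simp only [e1, one_smul, zero_smul, zero_add] at h
      rw [if_neg hjk, h, integral_prod]
      · have : ∀ ζ, ∫ ω, inner ℝ (X ζ) (X ω) ∂(stdGaussian V) = 0 := fun ζ => by
          rw [integral_inner (integrable_of_bounded hXc hXb), hX0, inner_zero_right]
        simp [this]
      · exact integrable_of_bounded (by fun_prop) fun p => inner_bd (hXb _) (hXb _)
  have hexp : ∀ Z : Fin (m + 1) → V,
      inner ℝ (Sf Z) (∑ k, X (Z k)) = ∑ k, inner ℝ (Sf Z) (X (Z k)) := fun Z => inner_sum _ _ _
  have hsum : ∫ Z, inner ℝ (Sf Z) (∑ k, X (Z k)) ∂π = (m + 1) * v := by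
    simp only [hexp]
    refine (integral_finsetSum (f := fun k (Z : Fin (m + 1) → V) => inner ℝ (Sf Z) (X (Z k))) _
      fun k _ => integrable_of_bounded (by fun_prop) fun Z => inner_bd (hb _) (hXb _)).trans ?_
    rw [Finset.sum_congr rfl fun k _ => hdiag k]
    simp
  have hsq : ∫ Z, ‖∑ k, X (Z k)‖ ^ 2 ∂π = (m + 1) * v := by
    simp_rw [← real_inner_self_eq_norm_sq, inner_sum, sum_inner]
    rw [integral_finsetSum _ fun k _ => integrable_finsetSum _ fun j _ =>
      integrable_of_bounded (by fun_prop) fun Z => inner_bd (hXb _) (hXb _)]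
    have : ∀ k, ∫ Z, ∑ j, inner ℝ (X (Z j)) (X (Z k)) ∂π = v := by
      intro k
      rw [integral_finsetSum _ fun j _ =>
        integrable_of_bounded (by fun_prop) fun Z => inner_bd (hXb _) (hXb _)]
      simp [hoff]
    simp [this]
  have hI : Integrable (fun Z : Fin (m + 1) → V => ‖∑ k, X (Z k)‖ ^ 2) π := by
    refine integrable_of_bounded (by fun_prop) (B := ((m + 1) * 2 : ℝ) ^ 2) fun Z => ?_
    rw [Real.norm_eq_abs, abs_of_nonneg (by positivity)]
    have : ‖∑ k, X (Z k)‖ ≤ (m + 1) * 2 := (norm_sum_le _ _).trans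
      ((Finset.sum_le_sum fun k _ => hXb (Z k)).trans (by simp))
    gcongr
  have hcs : ∫ Z, inner ℝ (Sf Z) (∑ k, X (Z k)) ∂π ≤
      ∫ Z, (1 / 2 + ‖∑ k, X (Z k)‖ ^ 2 / 2) ∂π := by
    refine integral_mono ?_ ((integrable_const _).add (hI.div_const 2)) fun Z => ?_
    · simp only [hexp]
      exact integrable_finsetSum _ fun k _ => integrable_of_bounded (by fun_prop)
        fun Z => inner_bd (hb _) (hXb _)
    · have h1 := real_inner_le_norm (Sf Z) (∑ k, X (Z k))
      have h2 : ‖Sf Z‖ ≤ 1 := hb _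
      nlinarith [norm_nonneg (∑ k, X (Z k)), sq_nonneg (‖∑ k, X (Z k)‖ - 1)]
  rw [integral_add (integrable_const _) (hI.div_const 2), integral_div 2 (fun Z : Fin (m + 1) → V => ‖∑ k, X (Z k)‖ ^ 2), hsq, hsum] at hcs
  simp only [integral_const, probReal_univ, one_smul] at hcs
  rw [le_div_iff₀ (by positivity)]
  linarith

end Smoothing

section Words

variable {V E : Type*} [NormedAddCommGroup V] [InnerProductSpace ℝ V] [FiniteDimensional ℝ V]
  [MeasurableSpace V] [BorelSpace V]
  [NormedAddCommGroup E] [InnerProductSpace ℝ E] [FiniteDimensional ℝ E]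
  [MeasurableSpace E] [BorelSpace E]

lemma map_prod_add {a b : ℝ} (h : a ^ 2 + b ^ 2 = 1) :
    ((stdGaussian V).prod (stdGaussian V)).map (fun p => a • p.1 + b • p.2) = stdGaussian V := by
  rw [prod_stdGaussian_eq_map, Measure.map_map (by fun_prop) (by fun_prop)]
  refine map_stdGaussian_eq (by fun_prop) (S := fun t => WithLp.toLp 2 (a • t, b • t))
    (fun x t => ?_) fun t => ?_
  · simp only [Function.comp, WithLp.prod_inner_apply, inner_add_left, real_inner_smul_left,
      real_inner_smul_right]
  · rw [← sq_eq_sq₀ (norm_nonneg _) (norm_nonneg _), WithLp.prod_norm_sq_eq_of_L2]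
    change ‖a • t‖ ^ 2 + ‖b • t‖ ^ 2 = _
    rw [norm_smul, norm_smul, mul_pow, mul_pow, Real.norm_eq_abs, Real.norm_eq_abs, sq_abs,
      sq_abs, ← add_mul, h, one_mul]

/-- The influence of the `i`-th letter of a word on the smoothed output. -/
def influence (f : V → E) (σ τ : ℝ) {D : ℕ} (i : Fin D) (z : Fin D → V) : ℝ :=
  ‖smooth f τ (σ • ∑ d, z d) -
    smooth (smooth f τ) σ (σ • ∑ d, (if d = i then (0 : ℝ) else 1) • z d)‖ ^ 2

/-- Words whose smoothed neighbourhood meets `S₀` often and with few influential letters. -/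
def goodWords (f : V → E) (σ τ : ℝ) (D : ℕ) (S₀ : Set V) (p η J : ℝ) : Set (Fin D → V) :=
  {z | p ≤ (stdGaussian V).real {ω | σ • ∑ d, z d + τ • ω ∈ S₀} ∧
    ((Finset.univ.filter fun i => η < influence f σ τ i z).card : ℝ) ≤ J}

variable {f : V → E} {L : ℝ≥0}

lemma continuous_influence (hf : LipschitzWith L f) (hb : ∀ x, ‖f x‖ ≤ 1) (σ τ : ℝ) {D : ℕ}
    (i : Fin D) : Continuous (influence f σ τ i) := by
  have h1 := (lipschitzWith_smooth hf hb τ)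
  have h2 := (lipschitzWith_smooth h1 (norm_smooth_le hb τ) σ).continuous
  have h1 := h1.continuous
  unfold influence
  fun_prop

lemma influence_le (hb : ∀ x, ‖f x‖ ≤ 1) (σ τ : ℝ) {D : ℕ}
    (i : Fin D) (z : Fin D → V) : influence f σ τ i z ≤ 4 := by
  unfold influence
  have := (norm_sub_le (smooth f τ (σ • ∑ d, z d))
    (smooth (smooth f τ) σ (σ • ∑ d, (if d = i then (0 : ℝ) else 1) • z d)))
  have h1 := norm_smooth_le hb τ (σ • ∑ d, z d)
  have h2 := norm_smooth_le (norm_smooth_le hb τ) σ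
    (σ • ∑ d, (if d = i then (0 : ℝ) else 1) • z d)
  nlinarith [norm_nonneg (smooth f τ (σ • ∑ d, z d) -
    smooth (smooth f τ) σ (σ • ∑ d, (if d = i then (0 : ℝ) else 1) • z d))]

lemma influence_nonneg (σ τ : ℝ) {D : ℕ} (i : Fin D) (z : Fin D → V) :
    0 ≤ influence f σ τ i z := by
  unfold influence; positivity

lemma integrable_influence (hf : LipschitzWith L f) (hb : ∀ x, ‖f x‖ ≤ 1) (σ τ : ℝ) {D : ℕ}
    (i : Fin D) : Integrable (influence f σ τ i) (Measure.pi fun _ : Fin D => stdGaussian V) :=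
  integrable_of_bounded (continuous_influence hf hb σ τ i) (B := 4) fun z => by
    rw [Real.norm_eq_abs, abs_of_nonneg (influence_nonneg σ τ i z)]
    exact influence_le hb σ τ i z

lemma integral_influence_word_le (hf : LipschitzWith L f) (hb : ∀ x, ‖f x‖ ≤ 1) {m : ℕ}
    (hm : 1 ≤ m) (σ : ℝ) {D : ℕ} (i : Fin D) :
    ∫ z, influence f σ (σ * √m) i z ∂(Measure.pi fun _ : Fin D => stdGaussian V) ≤
      1 / (m + 1) := by
  have hl := (lipschitzWith_smooth hf hb (σ * √m))
  have hl2 := (lipschitzWith_smooth hl (norm_smooth_le hb _) σ).continuous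
  have hl1 := hl.continuous
  have hD : 1 ≤ D := i.pos
  have h := integral_pi_pair (V := V) (I := Fin D) (α := fun e => if e = i then 1 else 0)
      (β := fun e => if e = i then 0 else 1) (a := 1) (c := 0) (d := √(D - 1 : ℕ)) (by simp)
      (by
        rw [mul_zero]
        exact Finset.sum_eq_zero fun e _ => by by_cases h : e = i <;> simp [h]) (by
        simp only [ite_pow, ne_eq, OfNat.ofNat_ne_zero, not_false_eq_true, zero_pow, one_pow]
        rw [Real.sq_sqrt (by positivity), Finset.sum_ite]
        simp [Finset.filter_ne'])
      (F := fun p => ‖smooth f (σ * √m) (σ • (p.1 + p.2)) -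
        smooth (smooth f (σ * √m)) σ (σ • p.2)‖ ^ 2) (by fun_prop)
  have e1 : ∀ Z : Fin D → V, ∑ e, (if e = i then (1 : ℝ) else 0) • Z e = Z i := by
    intro Z; simp
  have e2 : ∀ Z : Fin D → V, Z i + ∑ e, (if e = i then (0 : ℝ) else 1) • Z e = ∑ e, Z e := by
    intro Z
    conv_lhs => rw [← e1 Z]
    rw [← Finset.sum_add_distrib]
    refine Finset.sum_congr rfl fun e _ => ?_
    by_cases h : e = i <;> simp [h]
  simp only [e1, e2, one_smul, zero_smul, zero_add] at h
  unfold influence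
  rw [h, integral_prod_symm]
  · have hle : ∀ y : V, ∫ x, ‖smooth f (σ * √m) (σ • (x + √(D - 1 : ℕ) • y)) -
        smooth (smooth f (σ * √m)) σ (σ • √(D - 1 : ℕ) • y)‖ ^ 2 ∂(stdGaussian V) ≤
        1 / (m + 1) := by
      intro y
      have := integral_influence_le hf hb hm σ (σ • √(D - 1 : ℕ) • y)
      refine le_of_eq_of_le (integral_congr_ae (Eventually.of_forall fun x => ?_)) this
      beta_reduce
      rw [smul_add, add_comm (σ • x)]
      rfl
    refine (integral_mono_of_nonneg (Eventually.of_forall fun y => integral_nonneg fun x => by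
      positivity) (integrable_const _) (Eventually.of_forall hle)).trans ?_
    simp
  · refine integrable_of_bounded (by fun_prop) (B := 4) fun p => ?_
    rw [Real.norm_eq_abs, abs_of_nonneg (by positivity)]
    have := norm_sub_le (smooth f (σ * √m) (σ • (p.1 + √(D - 1 : ℕ) • p.2)))
      (smooth (smooth f (σ * √m)) σ (σ • √(D - 1 : ℕ) • p.2))
    have h1 := norm_smooth_le hb (σ * √m) (σ • (p.1 + √(D - 1 : ℕ) • p.2))
    have h2 := norm_smooth_le (norm_smooth_le hb (σ * √m)) σ (σ • √(D - 1 : ℕ) • p.2)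
    nlinarith [norm_nonneg (smooth f (σ * √m) (σ • (p.1 + √(D - 1 : ℕ) • p.2)) -
      smooth (smooth f (σ * √m)) σ (σ • √(D - 1 : ℕ) • p.2))]

lemma measurable_hit (σ τ : ℝ) (D : ℕ) {S₀ : Set V} (hS : MeasurableSet S₀) :
    Measurable fun z : Fin D → V => (stdGaussian V).real {ω | σ • ∑ d, z d + τ • ω ∈ S₀} := by
  have hm : MeasurableSet {p : (Fin D → V) × V | σ • ∑ d, p.1 d + τ • p.2 ∈ S₀} :=
    hS.preimage (f := fun p : (Fin D → V) × V => σ • ∑ d, p.1 d + τ • p.2) (by fun_prop)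
  exact (measurable_measure_prodMk_left (ν := stdGaussian V) hm).ennreal_toReal

lemma measurableSet_goodWords (hf : LipschitzWith L f) (hb : ∀ x, ‖f x‖ ≤ 1) (σ τ : ℝ) (D : ℕ)
    {S₀ : Set V} (hS : MeasurableSet S₀) (p η J : ℝ) :
    MeasurableSet (goodWords f σ τ D S₀ p η J) := by
  have h0 := measurableSet_le measurable_const (measurable_hit σ τ D hS) (f := fun _ => p)
  suffices h : Measurable fun z : Fin D → V =>
      ((Finset.univ.filter fun i => η < influence f σ τ i z).card : ℝ) by
    have h2 := measurableSet_le h (measurable_const (a := J))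
    have h3 := h0.inter h2
    exact h3
  have : (fun z : Fin D → V => ((Finset.univ.filter fun i => η < influence f σ τ i z).card : ℝ)) =
      fun z => ∑ i, Set.indicator {z | η < influence f σ τ i z} (fun _ => (1 : ℝ)) z := by
    funext z
    rw [Finset.card_filter]
    push_cast
    exact Finset.sum_congr rfl fun i _ => by simp [Set.indicator_apply]
  rw [this]
  exact Finset.measurable_sum _ fun i _ => measurable_const.indicator
    (measurableSet_lt measurable_const (continuous_influence hf hb σ τ i).measurable)

lemma integral_hit (σ τ : ℝ) (D : ℕ) (h : D * σ ^ 2 + τ ^ 2 = 1) {S₀ : Set V}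
    (hS : MeasurableSet S₀) :
    ∫ z, (stdGaussian V).real {ω | σ • ∑ d, z d + τ • ω ∈ S₀}
      ∂(Measure.pi fun _ : Fin D => stdGaussian V) = (stdGaussian V).real S₀ := by
  set a := √(D * σ ^ 2)
  have ha : a ^ 2 = D * σ ^ 2 := Real.sq_sqrt (by positivity)
  have hlaw := map_pi_sum (V := V) (I := Fin D) (α := fun _ => σ) (a := a) (by simp [ha])
  set φ : V → ℝ := fun x => (stdGaussian V).real {ω | x + τ • ω ∈ S₀} with hφ
  have hφm : Measurable φ := by
    have hm : MeasurableSet {p : V × V | p.1 + τ • p.2 ∈ S₀} :=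
      hS.preimage (f := fun p : V × V => p.1 + τ • p.2) (by fun_prop)
    exact (measurable_measure_prodMk_left (ν := stdGaussian V) hm).ennreal_toReal
  have h1 : ∫ z, φ (∑ d : Fin D, σ • z d) ∂(Measure.pi fun _ : Fin D => stdGaussian V) =
      ∫ x, φ (a • x) ∂(stdGaussian V) := by
    have := congrArg (fun μ => ∫ x, φ x ∂μ) hlaw
    have hc : Continuous fun Z : Fin D → V => ∑ e, σ • Z e := by fun_prop
    rwa [integral_map hc.aemeasurable hφm.aestronglyMeasurable,
      integral_map (by fun_prop) hφm.aestronglyMeasurable] at this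
  simp only [← Finset.smul_sum] at h1
  rw [h1]
  have hm2 : MeasurableSet {p : V × V | a • p.1 + τ • p.2 ∈ S₀} :=
    hS.preimage (f := fun p : V × V => a • p.1 + τ • p.2) (by fun_prop)
  have h2 : (stdGaussian V).real S₀ =
      ((stdGaussian V).prod (stdGaussian V)).real {p | a • p.1 + τ • p.2 ∈ S₀} := by
    conv_lhs => rw [← map_prod_add (V := V) (a := a) (b := τ) (by rw [ha, h])]
    rw [map_measureReal_apply (by fun_prop) hS]
    rfl
  rw [h2, measureReal_def, Measure.prod_apply hm2, ← integral_toReal]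
  · rfl
  · exact (measurable_measure_prodMk_left hm2).aemeasurable
  · exact Eventually.of_forall fun x => measure_lt_top _ _

lemma le_measure_goodWords (hf : LipschitzWith L f) (hb : ∀ x, ‖f x‖ ≤ 1) {m : ℕ} (hm : 1 ≤ m)
    (σ : ℝ) (D : ℕ) {s : ℝ} (hs : 0 < s) (hσ : D * σ ^ 2 + (σ * √m) ^ 2 = 1) (hD : D ≤ s * (m + 1)) {S₀ : Set V}
    (hS : MeasurableSet S₀) {p η : ℝ} (hp : 0 < p) (hpS : p ≤ (stdGaussian V).real S₀)
    (hη : 0 < η) :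
    p / 4 ≤ (Measure.pi fun _ : Fin D => stdGaussian V).real
      (goodWords f σ (σ * √m) D S₀ (p / 2) η (4 * s / (η * p))) := by
  set π := Measure.pi fun _ : Fin D => stdGaussian V
  set φ := fun z : Fin D → V => (stdGaussian V).real {ω | σ • ∑ d, z d + (σ * √m) • ω ∈ S₀} with hφ
  have hφm : Measurable φ := measurable_hit σ _ D hS
  have hφ1 : ∀ z, φ z ≤ 1 := fun z => measureReal_le_one
  have hφi : Integrable φ π := Integrable.of_bound hφm.aestronglyMeasurable 1
    (Eventually.of_forall fun z => by
      rw [Real.norm_eq_abs, abs_of_nonneg measureReal_nonneg]; exact hφ1 z)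
  set A := {z | p / 2 ≤ φ z} with hA
  have hAm : MeasurableSet A := measurableSet_le measurable_const hφm
  have hAp : p / 2 ≤ π.real A := by
    have h1 : ∫ z, φ z ∂π = (stdGaussian V).real S₀ := integral_hit σ _ D hσ hS
    have h2 : ∫ z, φ z ∂π ≤ ∫ z, (A.indicator (fun _ => (1 : ℝ)) z + p / 2) ∂π := by
      refine integral_mono hφi (((integrable_const _).indicator hAm).add (integrable_const _))
        fun z => ?_
      by_cases hz : z ∈ A
      · simp only [Set.indicator_of_mem hz]; linarith [hφ1 z]
      · simp only [Set.indicator_of_notMem hz]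
        have : φ z < p / 2 := not_le.1 hz
        linarith
    rw [integral_add ((integrable_const _).indicator hAm) (integrable_const _),
      integral_indicator hAm] at h2
    simp at h2
    linarith
  set J := 4 * s / (η * p) with hJ
  have hJ0 : 0 < J := by positivity
  set T := fun z => ∑ i, influence f σ (σ * √m) i z with hT
  have hTi : Integrable T π := integrable_finsetSum _ fun i _ => integrable_influence hf hb _ _ i
  have hTint : ∫ z, T z ∂π ≤ s := by
    rw [hT, integral_finsetSum _ fun i _ => integrable_influence hf hb _ _ i]
    refine (Finset.sum_le_sum fun i _ => integral_influence_word_le hf hb hm σ i).trans ?_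
    simp only [Finset.sum_const, Finset.card_univ, Fintype.card_fin, nsmul_eq_mul]
    rw [mul_one_div, div_le_iff₀ (by positivity)]
    exact hD
  set B := {z | η * J ≤ T z} with hB
  have hBp : π.real B ≤ p / 4 := by
    have h := mul_meas_ge_le_integral_of_nonneg (μ := π) (f := T) (Eventually.of_forall fun z =>
      Finset.sum_nonneg fun i _ => influence_nonneg _ _ _ _) hTi (η * J)
    have h2 : η * J * π.real B ≤ s := h.trans hTint
    have h3 : η * J = 4 * s / p := by rw [hJ]; field_simp
    rw [h3] at h2
    rw [div_mul_eq_mul_div, div_le_iff₀ hp] at h2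
    nlinarith
  have hsub : A ⊆ goodWords f σ (σ * √m) D S₀ (p / 2) η J ∪ B := by
    intro z hz
    by_cases hzB : z ∈ B
    · exact Or.inr hzB
    · refine Or.inl ⟨hz, ?_⟩
      by_contra hcon
      push Not at hcon
      apply hzB
      have h1 : η * ((Finset.univ.filter fun i => η < influence f σ (σ * √m) i z).card : ℝ) ≤ T z := by
        rw [mul_comm, ← nsmul_eq_mul]
        refine (Finset.card_nsmul_le_sum _ (fun i => influence f σ (σ * √m) i z) η fun i hi =>
          (Finset.mem_filter.1 hi).2.le).trans ?_
        exact Finset.sum_le_sum_of_subset_of_nonneg (Finset.filter_subset _ _)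
          fun i _ _ => influence_nonneg _ _ _ _
      exact (mul_le_mul_of_nonneg_left hcon.le hη.le).trans h1
  have := (measureReal_mono hsub (measure_ne_top _ _)).trans (measureReal_union_le (μ := π) _ _)
  linarith

end Words

section Tree

variable {H K : ℕ}

/-- Two leaves of the `K`-ary tree of height `H` have the same ancestor at height `k`. -/
def Agree (k : ℕ) (u v : Fin H → Fin K) : Prop := ∀ i : Fin H, (i : ℕ) < k → u i = v i

instance (k : ℕ) (u v : Fin H → Fin K) : Decidable (Agree k u v) := by
  unfold Agree; infer_instance

lemma agree_refl (k : ℕ) (u : Fin H → Fin K) : Agree k u u := fun _ _ => rfl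

lemma agree_zero (u v : Fin H → Fin K) : Agree 0 u v := fun _ h => absurd h (Nat.not_lt_zero _)

lemma Agree.symm {k : ℕ} {u v : Fin H → Fin K} (h : Agree k u v) : Agree k v u :=
  fun i hi => (h i hi).symm

lemma agree_comm {k : ℕ} {u v : Fin H → Fin K} : Agree k u v ↔ Agree k v u :=
  ⟨Agree.symm, Agree.symm⟩

lemma Agree.trans {k : ℕ} {u v w : Fin H → Fin K} (h : Agree k u v) (h' : Agree k v w) :
    Agree k u w := fun i hi => (h i hi).trans (h' i hi)

lemma Agree.mono {k l : ℕ} (hkl : k ≤ l) {u v : Fin H → Fin K} (h : Agree l u v) : Agree k u v :=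
  fun i hi => h i (hi.trans_le hkl)

lemma agree_top {u v : Fin H → Fin K} : Agree H u v ↔ u = v :=
  ⟨fun h => funext fun i => h i i.2, fun h => h ▸ agree_refl _ _⟩

/-- The height of the last common ancestor. -/
def cp (u v : Fin H → Fin K) : ℕ := Nat.findGreatest (fun k => Agree k u v) H

lemma cp_le (u v : Fin H → Fin K) : cp u v ≤ H := Nat.findGreatest_le H

lemma agree_cp (u v : Fin H → Fin K) : Agree (cp u v) u v :=
  Nat.findGreatest_spec (P := fun k => Agree k u v) (Nat.zero_le H) (agree_zero u v)

lemma le_cp_iff {k : ℕ} (hk : k ≤ H) {u v : Fin H → Fin K} : k ≤ cp u v ↔ Agree k u v :=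
  ⟨fun h => (agree_cp u v).mono h, fun h => Nat.le_findGreatest hk h⟩

lemma cp_self (u : Fin H → Fin K) : cp u u = H :=
  (cp_le u u).antisymm ((le_cp_iff le_rfl).2 (agree_refl _ _))

lemma cp_comm (u v : Fin H → Fin K) : cp u v = cp v u := by
  unfold cp; simp only [agree_comm (u := u) (v := v)]

lemma eq_of_cp_eq {u v : Fin H → Fin K} (h : cp u v = H) : u = v :=
  agree_top.1 ((le_cp_iff le_rfl).1 h.ge)

lemma agree_update_iff {k : ℕ} (hk : k < H) (u v : Fin H → Fin K) (a : Fin K) :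
    Agree (k + 1) (Function.update u ⟨k, hk⟩ a) v ↔ Agree k u v ∧ v ⟨k, hk⟩ = a := by
  constructor
  · intro h
    refine ⟨fun i hi => ?_, ?_⟩
    · have := h i (by omega)
      rwa [Function.update_of_ne (by rintro rfl; simp at hi)] at this
    · have := h ⟨k, hk⟩ (by simp)
      rw [Function.update_self] at this
      exact this.symm
  · rintro ⟨h, rfl⟩ i hi
    by_cases hik : i = ⟨k, hk⟩
    · subst hik; simp
    · rw [Function.update_of_ne hik]
      exact h i (lt_of_le_of_ne (by omega) fun h' => hik (Fin.ext h'))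

lemma sum_agree_succ {M : Type*} [AddCommMonoid M] {k : ℕ} (hk : k < H) (u : Fin H → Fin K)
    (F : (Fin H → Fin K) → M) :
    ∑ v with Agree k u v, F v =
      ∑ a, ∑ v with Agree (k + 1) (Function.update u ⟨k, hk⟩ a) v, F v := by
  rw [← Finset.sum_fiberwise _ (fun v : Fin H → Fin K => v ⟨k, hk⟩)]
  refine Finset.sum_congr rfl fun a _ => ?_
  rw [Finset.filter_filter]
  simp only [agree_update_iff]

lemma card_agree {k : ℕ} (hk : k ≤ H) (u : Fin H → Fin K) :
    (Finset.univ.filter (Agree k u)).card = K ^ (H - k) := by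
  induction h : H - k generalizing k u with
  | zero =>
    have : k = H := by omega
    subst this
    simp [agree_top, Finset.filter_eq]
  | succ n ih =>
    have hk' : k < H := by omega
    rw [Finset.card_eq_sum_ones, sum_agree_succ hk']
    simp only [← Finset.card_eq_sum_ones]
    rw [Finset.sum_congr rfl fun a _ => ih (k := k + 1) (by omega) _ (by omega)]
    simp [pow_succ, mul_comm]

/-- The average over the leaves agreeing with `u` up to height `k`. -/
def treeAvg (k : ℕ) (a : ℕ → ℝ) (u : Fin H → Fin K) : ℝ :=
  (∑ v with Agree k u v, a (cp u v)) / K ^ (H - k)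

lemma treeAvg_top (a : ℕ → ℝ) (u : Fin H → Fin K) : treeAvg H a u = a H := by
  simp [treeAvg, agree_top, Finset.filter_eq, cp_self]

variable [NeZero K]

lemma le_treeAvg {k : ℕ} (hk : k ≤ H) {a : ℕ → ℝ} (ha : ∀ i j, i ≤ j → j ≤ H → a i ≤ a j)
    (u : Fin H → Fin K) : a k ≤ treeAvg k a u := by
  have hK : (0 : ℝ) < K := by exact_mod_cast NeZero.pos K
  rw [treeAvg, le_div_iff₀ (by positivity)]
  have := Finset.card_nsmul_le_sum (Finset.univ.filter (Agree k u)) (fun v => a (cp u v)) (a k)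
    fun v hv => ha _ _ ((le_cp_iff hk).2 (Finset.mem_filter.1 hv).2) (cp_le _ _)
  rw [card_agree hk, nsmul_eq_mul] at this
  push_cast at this
  linarith

lemma treeAvg_le {k : ℕ} (hk : k < H) {a : ℕ → ℝ} (ha : ∀ i j, i ≤ j → j ≤ H → a i ≤ a j)
    (h0 : 0 ≤ a 0) (u : Fin H → Fin K) : treeAvg k a u ≤ a k + a H / K := by
  have hK : (0 : ℝ) < K := by exact_mod_cast NeZero.pos K
  have hk0 : 0 ≤ a k := h0.trans (ha _ _ (Nat.zero_le _) hk.le)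
  rw [treeAvg, div_le_iff₀ (by positivity)]
  have h1 : ∑ v with Agree k u v, a (cp u v) ≤
      ∑ v with Agree k u v, (a k + if Agree (k + 1) u v then a H else 0) := by
    refine Finset.sum_le_sum fun v hv => ?_
    split_ifs with h
    · linarith [ha _ _ (cp_le u v) le_rfl]
    · have h2 : ¬ k + 1 ≤ cp u v := fun h' => h ((le_cp_iff hk).1 h')
      rw [add_zero]
      exact ha _ _ (by omega) hk.le
  refine h1.trans (le_of_eq ?_)
  rw [Finset.sum_add_distrib, Finset.sum_const, card_agree hk.le, ← Finset.sum_filter,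
    Finset.filter_filter]
  have h3 : Finset.univ.filter (fun v => Agree k u v ∧ Agree (k + 1) u v) =
      Finset.univ.filter (Agree (k + 1) u) := by
    ext v
    simp only [Finset.mem_filter, Finset.mem_univ, true_and, and_iff_right_iff_imp]
    exact fun h => h.mono (Nat.le_succ k)
  rw [h3, Finset.sum_const, card_agree hk]
  obtain ⟨n, hn⟩ : ∃ n, H - k = n + 1 := ⟨H - k - 1, by omega⟩
  have hn' : H - (k + 1) = n := by omega
  rw [hn, hn']
  simp only [nsmul_eq_mul]
  push_cast
  field_simp
  ring

variable {E : Type*} [NormedAddCommGroup E] [InnerProductSpace ℝ E]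

/-- The inner product of the conditional averages at height `k` of two fields on the leaves. -/
def treeForm (k : ℕ) (x z : (Fin H → Fin K) → E) : ℝ :=
  (∑ u, ∑ v with Agree k u v, inner ℝ (x u) (z v)) / K ^ (H - k)

lemma treeForm_top (x z : (Fin H → Fin K) → E) : treeForm H x z = ∑ u, inner ℝ (x u) (z u) := by
  simp [treeForm, agree_top, Finset.filter_eq]

lemma treeForm_eq_of_inner {k : ℕ} {x : (Fin H → Fin K) → E} {q : ℕ → ℝ}
    (hx : ∀ u v, inner ℝ (x u) (x v) = q (cp u v)) :
    treeForm k x x = ∑ u : Fin H → Fin K, treeAvg k q u := by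
  simp only [treeForm, treeAvg, hx, Finset.sum_div]

lemma sum_norm_sq_block {k : ℕ} (hk : k ≤ H) (y : (Fin H → Fin K) → E) :
    ∑ u, ‖∑ v with Agree k u v, y v‖ ^ 2 =
      K ^ (H - k) * ∑ u, ∑ v with Agree k u v, inner ℝ (y u) (y v) := by
  have h1 : ∀ u, ‖∑ v with Agree k u v, y v‖ ^ 2 =
      ∑ v with Agree k u v, inner ℝ (y v) (∑ w with Agree k v w, y w) := by
    intro u
    rw [← real_inner_self_eq_norm_sq, sum_inner]
    refine Finset.sum_congr rfl fun v hv => ?_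
    have huv : Agree k u v := (Finset.mem_filter.1 hv).2
    congr 2
    ext w
    simp only [Finset.mem_filter, Finset.mem_univ, true_and]
    exact ⟨huv.symm.trans, huv.trans⟩
  simp only [h1, ← inner_sum]
  have h2 : ∀ u : Fin H → Fin K, ∑ v with Agree k u v, inner ℝ (y v) (∑ w with Agree k v w, y w) =
      ∑ v, if Agree k v u then inner ℝ (y v) (∑ w with Agree k v w, y w) else 0 := by
    intro u
    rw [Finset.sum_filter]
    simp only [agree_comm]
  simp only [h2]
  rw [Finset.sum_comm, Finset.mul_sum]
  refine Finset.sum_congr rfl fun v _ => ?_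
  rw [← Finset.sum_filter, Finset.sum_const, card_agree hk, nsmul_eq_mul]
  push_cast
  rfl

lemma treeForm_le_succ {k : ℕ} (hk : k < H) (y : (Fin H → Fin K) → E) :
    treeForm k y y ≤ treeForm (k + 1) y y := by
  have hK : (0 : ℝ) < K := by exact_mod_cast NeZero.pos K
  have h1 := sum_norm_sq_block hk.le y
  have h2 := sum_norm_sq_block (k := k + 1) hk y
  have h3 : ∑ u, ‖∑ v with Agree k u v, y v‖ ^ 2 ≤
      K ^ 2 * ∑ u, ‖∑ v with Agree (k + 1) u v, y v‖ ^ 2 := by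
    have h4 : ∀ u, ‖∑ v with Agree k u v, y v‖ ^ 2 ≤
        K * ∑ a, ‖∑ v with Agree (k + 1) (Function.update u ⟨k, hk⟩ a) v, y v‖ ^ 2 := by
      intro u
      rw [sum_agree_succ hk]
      refine (pow_le_pow_left₀ (norm_nonneg _) (norm_sum_le _ _) 2).trans ?_
      refine (sq_sum_le_card_mul_sum_sq).trans ?_
      simp
    refine (Finset.sum_le_sum fun u _ => h4 u).trans (le_of_eq ?_)
    rw [← Finset.mul_sum, pow_two, mul_assoc]
    congr 1
    -- resampling one coordinate is `K`-to-one
    have h5 : ∀ F : (Fin H → Fin K) → ℝ,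
        ∑ u, ∑ a, F (Function.update u ⟨k, hk⟩ a) = K * ∑ u, F u := by
      intro F
      have h6 : ∀ u : Fin H → Fin K, ∑ a, F (Function.update u ⟨k, hk⟩ a) =
          ∑ v, if (∀ i, i ≠ ⟨k, hk⟩ → u i = v i) then F v else 0 := by
        intro u
        rw [← Finset.sum_filter]
        refine Finset.sum_bij (fun a _ => Function.update u ⟨k, hk⟩ a) ?_ ?_ ?_ ?_
        · intro a _
          simp only [Finset.mem_filter, Finset.mem_univ, true_and]
          intro i hi
          rw [Function.update_of_ne hi]
        · intro a _ b _ h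
          simpa using congrFun h ⟨k, hk⟩
        · intro v hv
          refine ⟨v ⟨k, hk⟩, Finset.mem_univ _, funext fun i => ?_⟩
          by_cases hi : i = ⟨k, hk⟩
          · subst hi; simp
          · rw [Function.update_of_ne hi]
            exact (Finset.mem_filter.1 hv).2 i hi
        · intro a _; rfl
      simp only [h6]
      rw [Finset.sum_comm, Finset.mul_sum]
      refine Finset.sum_congr rfl fun v _ => ?_
      rw [← Finset.sum_filter, Finset.sum_const, nsmul_eq_mul]
      congr 1
      have h7 : (Finset.univ.filter fun u : Fin H → Fin K => ∀ i, i ≠ ⟨k, hk⟩ → u i = v i) =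
          Finset.univ.image (Function.update v ⟨k, hk⟩) := by
        ext u
        simp only [Finset.mem_filter, Finset.mem_univ, true_and, Finset.mem_image]
        constructor
        · intro h
          refine ⟨u ⟨k, hk⟩, funext fun i => ?_⟩
          by_cases hi : i = ⟨k, hk⟩
          · subst hi; simp
          · rw [Function.update_of_ne hi, h i hi]
        · rintro ⟨a, rfl⟩ i hi
          rw [Function.update_of_ne hi]
      rw [h7, Finset.card_image_of_injective _ (Function.update_injective _ _)]
      simp
    exact h5 fun u => ‖∑ v with Agree (k + 1) u v, y v‖ ^ 2
  rw [h1, h2] at h3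
  obtain ⟨n, hn⟩ : ∃ n, H - k = n + 1 := ⟨H - k - 1, by omega⟩
  have hn' : H - (k + 1) = n := by omega
  rw [treeForm, treeForm]
  rw [hn, hn'] at h3 ⊢
  rw [div_le_div_iff₀ (by positivity) (by positivity)]
  refine le_of_mul_le_mul_left ?_ hK
  calc _ = (K : ℝ) ^ (n + 1) * ∑ u, ∑ v with Agree k u v, inner ℝ (y u) (y v) := by ring
    _ ≤ _ := h3
    _ = _ := by ring

lemma treeForm_nonneg (y : (Fin H → Fin K) → E) : 0 ≤ treeForm 0 y y := by
  have hK : (0 : ℝ) < K := by exact_mod_cast NeZero.pos K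
  have h := sum_norm_sq_block (Nat.zero_le H) y
  have h2 : 0 ≤ (K : ℝ) ^ (H - 0) * ∑ u, ∑ v with Agree 0 u v, inner ℝ (y u) (y v) :=
    h ▸ Finset.sum_nonneg fun u _ => by positivity
  exact div_nonneg (nonneg_of_mul_nonneg_right h2 (by positivity)) (by positivity)

lemma treeForm_smul_sub (k : ℕ) (x z : (Fin H → Fin K) → E) (a b : ℝ) :
    treeForm k (fun u => a • x u - b • z u) (fun u => a • x u - b • z u) =
      a ^ 2 * treeForm k x x - 2 * (a * b) * treeForm k x z + b ^ 2 * treeForm k z z := by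
  have hs : ∑ u, ∑ v with Agree k u v, inner ℝ (z u) (x v) =
      ∑ u, ∑ v with Agree k u v, inner ℝ (x u) (z v) := by
    simp only [Finset.sum_filter]
    rw [Finset.sum_comm]
    refine Finset.sum_congr rfl fun u _ => Finset.sum_congr rfl fun v _ => ?_
    simp only [agree_comm (u := v) (v := u), real_inner_comm]
  have h : ∑ u, ∑ v with Agree k u v, inner ℝ (a • x u - b • z u) (a • x v - b • z v) =
      a ^ 2 * ∑ u, ∑ v with Agree k u v, inner ℝ (x u) (x v)
        - a * b * ∑ u, ∑ v with Agree k u v, inner ℝ (x u) (z v)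
        - a * b * ∑ u, ∑ v with Agree k u v, inner ℝ (z u) (x v)
        + b ^ 2 * ∑ u, ∑ v with Agree k u v, inner ℝ (z u) (z v) := by
    simp only [Finset.mul_sum, ← Finset.sum_sub_distrib, ← Finset.sum_add_distrib]
    refine Finset.sum_congr rfl fun u _ => Finset.sum_congr rfl fun v _ => ?_
    simp only [inner_sub_left, inner_sub_right, real_inner_smul_left, real_inner_smul_right]
    ring
  simp only [treeForm, h, hs]
  ring

/-- The sum `s 0 * a 0 + ∑ s (k + 1) * (a (k + 1) - a k)`. -/
def abelSum (H : ℕ) (s a : ℕ → ℝ) : ℝ :=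
  s 0 * a 0 + ∑ k ∈ Finset.range H, s (k + 1) * (a (k + 1) - a k)

lemma abelSum_eq (H : ℕ) (s a : ℕ → ℝ) :
    abelSum H s a = s H * a H - ∑ k ∈ Finset.range H, (s (k + 1) - s k) * a k := by
  induction H with
  | zero => simp [abelSum]
  | succ n ih =>
    rw [abelSum, Finset.sum_range_succ, ← add_assoc, ← abelSum, ih, Finset.sum_range_succ]
    ring

lemma sum_inner_le (x z : (Fin H → Fin K) → E) (s : ℕ → ℝ) (hs : ∀ k, 0 < s k) :
    2 * ∑ u, inner ℝ (x u) (z u) ≤ abelSum H s (fun k => treeForm k x x) +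
      abelSum H (fun k => (s k)⁻¹) (fun k => treeForm k z z) := by
  have key : ∀ (k : ℕ), ∀ B : ((Fin H → Fin K) → E) → ((Fin H → Fin K) → E) → ℝ,
      (∀ a b, B (fun u => a • x u - b • z u) (fun u => a • x u - b • z u) =
        a ^ 2 * B x x - 2 * (a * b) * B x z + b ^ 2 * B z z) → (∀ y, 0 ≤ B y y) →
      2 * B x z ≤ s k * B x x + (s k)⁻¹ * B z z := by
    intro k B hB hp
    have h := hp (fun u => √(s k) • x u - (√(s k))⁻¹ • z u)
    rw [hB, Real.sq_sqrt (hs k).le, inv_pow, Real.sq_sqrt (hs k).le,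
      mul_inv_cancel₀ (Real.sqrt_ne_zero'.2 (hs k))] at h
    linarith
  have h0 := key 0 (treeForm 0) (treeForm_smul_sub 0 x z) treeForm_nonneg
  have hk : ∀ k ∈ Finset.range H, 2 * (treeForm (k + 1) x z - treeForm k x z) ≤
      s (k + 1) * (treeForm (k + 1) x x - treeForm k x x) +
        (s (k + 1))⁻¹ * (treeForm (k + 1) z z - treeForm k z z) := by
    intro k hk
    refine key (k + 1) (fun x z => treeForm (k + 1) x z - treeForm k x z) (fun a b => ?_)
      fun y => sub_nonneg.2 (treeForm_le_succ (Finset.mem_range.1 hk) y)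
    simp only [treeForm_smul_sub]
    ring
  have hsum := Finset.sum_le_sum hk
  rw [← Finset.mul_sum, Finset.sum_range_sub (fun k => treeForm k x z), Finset.sum_add_distrib]
    at hsum
  rw [← treeForm_top, abelSum, abelSum]
  linarith

end Tree

section Numeric

lemma abelSum_le_of_le {H : ℕ} {s a b : ℕ → ℝ} (hs : ∀ k < H, s k ≤ s (k + 1))
    (hab : ∀ k < H, b k ≤ a k) (hH : a H = b H) : abelSum H s a ≤ abelSum H s b := by
  rw [abelSum_eq, abelSum_eq, hH]
  refine sub_le_sub_left (Finset.sum_le_sum fun k hk => ?_) _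
  rw [Finset.mem_range] at hk
  exact mul_le_mul_of_nonneg_left (hab k hk) (sub_nonneg.2 (hs k hk))

lemma abelSum_le_of_antitone {H : ℕ} {s a b : ℕ → ℝ} (hs : ∀ k < H, s (k + 1) ≤ s k)
    (hsH : 0 ≤ s H) (hab : ∀ k ≤ H, a k ≤ b k) : abelSum H s a ≤ abelSum H s b := by
  rw [abelSum_eq, abelSum_eq]
  refine sub_le_sub (mul_le_mul_of_nonneg_left (hab H le_rfl) hsH)
    (Finset.sum_le_sum fun k hk => ?_)
  rw [Finset.mem_range] at hk
  exact mul_le_mul_of_nonpos_left (hab k hk.le) (sub_nonpos.2 (hs k hk))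

lemma abelSum_add {H : ℕ} {s a b : ℕ → ℝ} :
    abelSum H s (fun k => a k + b k) = abelSum H s a + abelSum H s b := by
  simp only [abelSum]
  have : ∀ k, s (k + 1) * (a (k + 1) + b (k + 1) - (a k + b k)) =
    s (k + 1) * (a (k + 1) - a k) + s (k + 1) * (b (k + 1) - b k) := fun k => by ring
  simp only [this, Finset.sum_add_distrib]
  ring

lemma abelSum_const {H : ℕ} {s : ℕ → ℝ} (c : ℝ) : abelSum H s (fun _ => c) = s 0 * c := by
  simp [abelSum]

variable {D : ℝ → ℝ}

/-- Right Riemann sums of a monotone function. -/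
lemma abelSum_riemann_le (hD : Continuous D) (hmono : ∀ x y, 0 ≤ x → x ≤ y → D x ≤ D y)
    (hD0 : ∀ x, 0 ≤ D x) {ϑ η : ℝ} {H : ℕ} {q : ℕ → ℝ}
    (hη : 0 ≤ η) (hq : ∀ k < H, q k ≤ q (k + 1)) (hq0 : 0 ≤ q 0)
    (hqη : ∀ k < H, q (k + 1) - q k ≤ η) {s : ℕ → ℝ} (hs0 : s 0 = ϑ)
    (hs : ∀ k, s (k + 1) = D (q (k + 1)) + ϑ) :
    abelSum H s q ≤ ϑ * q H + (∫ x in (0 : ℝ)..q H, D x) + η * D (q H) := by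
  have hqn : ∀ k ≤ H, 0 ≤ q k := by
    intro k
    induction k with
    | zero => intro _; exact hq0
    | succ n ih => intro h; exact (ih (by omega)).trans (hq n (by omega))
  have hint : ∀ a b, IntervalIntegrable D volume a b := fun a b => hD.intervalIntegrable a b
  have hstep : ∀ k ∈ Finset.range H, s (k + 1) * (q (k + 1) - q k) ≤
      (ϑ * q (k + 1) + (∫ x in (0 : ℝ)..q (k + 1), D x) + η * D (q (k + 1))) -
      (ϑ * q k + (∫ x in (0 : ℝ)..q k, D x) + η * D (q k)) := by
    intro k hk
    rw [Finset.mem_range] at hk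
    have h0 := hqn k hk.le
    have h1 := hq k hk
    have h2 : D (q k) * (q (k + 1) - q k) ≤ ∫ x in (q k)..q (k + 1), D x := by
      have := intervalIntegral.integral_mono_on (f := fun _ => D (q k)) h1
        intervalIntegrable_const (hint _ _) fun x hx => hmono _ _ h0 hx.1
      rw [intervalIntegral.integral_const, smul_eq_mul] at this
      linarith
    have h3 : (∫ x in (0 : ℝ)..q (k + 1), D x) - (∫ x in (0 : ℝ)..q k, D x) =
        ∫ x in (q k)..q (k + 1), D x :=
      intervalIntegral.integral_interval_sub_left (hint _ _) (hint _ _)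
    have h4 := hmono _ _ h0 h1
    rw [hs]
    nlinarith [mul_nonneg (sub_nonneg.2 h4) (sub_nonneg.2 (hqη k hk))]
  have hsum := Finset.sum_le_sum hstep
  rw [Finset.sum_range_sub (fun k => ϑ * q k + (∫ x in (0 : ℝ)..q k, D x) + η * D (q k))] at hsum
  have h5 : 0 ≤ ∫ x in (0 : ℝ)..q 0, D x :=
    intervalIntegral.integral_nonneg hq0 fun x _ => hD0 x
  have h6 := mul_nonneg hη (hD0 (q 0))
  rw [abelSum, hs0]
  linarith

lemma abelSum_inv_le (hD : Continuous D) (hmono : ∀ x y, 0 ≤ x → x ≤ y → D x ≤ D y)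
    (hD0 : ∀ x, 0 ≤ D x) {X : ℝ → ℝ} (hX : ∀ x y, 0 ≤ x → x ≤ y →
      X y - X x = ∫ u in x..y, D u ^ 2) (hX0 : X 0 = 0) {ϑ : ℝ} (hϑ : 0 < ϑ) {H : ℕ} {q : ℕ → ℝ}
    (hq : ∀ k < H, q k ≤ q (k + 1)) (hq0 : 0 ≤ q 0) {s : ℕ → ℝ} (hs0 : s 0 = ϑ)
    (hs : ∀ k, s (k + 1) = D (q (k + 1)) + ϑ) {t₀ : ℝ} (ht₀ : 0 ≤ t₀) {ψ : ℕ → ℝ}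
    (hψ0 : ψ 0 = t₀ * X (q 0)) (hψ : ∀ k, 0 < k → ψ k = X (q k)) :
    abelSum H (fun k => (s k)⁻¹) ψ ≤ t₀ * X (q 0) / ϑ + ∫ x in (0 : ℝ)..q H, D x := by
  have hqn : ∀ k ≤ H, 0 ≤ q k := by
    intro k
    induction k with
    | zero => intro _; exact hq0
    | succ n ih => intro h; exact (ih (by omega)).trans (hq n (by omega))
  have hint : ∀ a b, IntervalIntegrable D volume a b := fun a b => hD.intervalIntegrable a b
  have hXD : ∀ x y, 0 ≤ x → x ≤ y → X y - X x ≤ (D y + ϑ) *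
      ((∫ u in (0 : ℝ)..y, D u) - ∫ u in (0 : ℝ)..x, D u) := by
    intro x y hx hxy
    rw [hX x y hx hxy, intervalIntegral.integral_interval_sub_left (hint _ _) (hint _ _)]
    have h1 : ∫ u in x..y, D u ^ 2 ≤ D y * ∫ u in x..y, D u := by
      rw [← intervalIntegral.integral_const_mul]
      refine intervalIntegral.integral_mono_on hxy (hD.pow 2 |>.intervalIntegrable _ _)
        ((hint _ _).const_mul _) fun u hu => ?_
      rw [pow_two]
      exact mul_le_mul_of_nonneg_right (hmono _ _ (hx.trans hu.1) hu.2) (hD0 u)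
    have h2 : 0 ≤ ∫ u in x..y, D u := intervalIntegral.integral_nonneg hxy fun x _ => hD0 x
    nlinarith
  have hX0q : 0 ≤ X (q 0) := by
    have := hX 0 (q 0) le_rfl hq0
    rw [hX0, sub_zero] at this
    rw [this]
    exact intervalIntegral.integral_nonneg hq0 fun x _ => by positivity
  set J : ℕ → ℝ := fun k => if k = 0 then 0 else ∫ x in (0 : ℝ)..q k, D x with hJ
  have hstep : ∀ k ∈ Finset.range H, (s (k + 1))⁻¹ * (ψ (k + 1) - ψ k) ≤ J (k + 1) - J k := by
    intro k hk
    rw [Finset.mem_range] at hk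
    have hpos : 0 < s (k + 1) := by rw [hs]; linarith [hD0 (q (k + 1))]
    rw [inv_mul_le_iff₀ hpos, hs, hψ (k + 1) (Nat.succ_pos k)]
    rcases Nat.eq_zero_or_pos k with rfl | hk0
    · have h := hXD 0 (q (0 + 1)) le_rfl (hqn _ hk)
      simp only [hJ, hψ0, hX0, intervalIntegral.integral_same, sub_zero, if_true,
        Nat.succ_ne_zero, if_false] at h ⊢
      have := mul_nonneg ht₀ hX0q
      linarith
    · have h := hXD (q k) (q (k + 1)) (hqn _ hk.le) (hq k hk)
      simp only [hJ, hψ k hk0, hk0.ne', Nat.succ_ne_zero, if_false]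
      exact h
  have hsum := Finset.sum_le_sum hstep
  rw [Finset.sum_range_sub] at hsum
  have hJH : J H ≤ ∫ x in (0 : ℝ)..q H, D x := by
    simp only [hJ]
    split_ifs
    · exact intervalIntegral.integral_nonneg (hqn _ le_rfl) fun x _ => hD0 x
    · exact le_rfl
  have hJ0 : J 0 = 0 := by simp [hJ]
  rw [abelSum, hs0, hψ0]
  have : ϑ⁻¹ * (t₀ * X (q 0)) = t₀ * X (q 0) / ϑ := by rw [div_eq_inv_mul]
  linarith

end Numeric

section Xi

variable (P : ℕ) (c : ℕ → ℝ)

lemma continuous_xiD2 : Continuous (xiD2 P c) := by unfold xiD2; fun_prop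

lemma xiFun_nonneg {x : ℝ} (hx : 0 ≤ x) : 0 ≤ xiFun P c x :=
  Finset.sum_nonneg fun k _ => by positivity

lemma xiFun_mono {x y : ℝ} (hx : 0 ≤ x) (hxy : x ≤ y) : xiFun P c x ≤ xiFun P c y :=
  Finset.sum_le_sum fun k _ => by gcongr

lemma xiD1_mono {x y : ℝ} (hx : 0 ≤ x) (hxy : x ≤ y) : xiD1 P c x ≤ xiD1 P c y :=
  Finset.sum_le_sum fun k _ => by gcongr

lemma xiD1_nonneg {x : ℝ} (hx : 0 ≤ x) : 0 ≤ xiD1 P c x :=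
  Finset.sum_nonneg fun k _ => by positivity

lemma xiD2_mono {x y : ℝ} (hx : 0 ≤ x) (hxy : x ≤ y) : xiD2 P c x ≤ xiD2 P c y := by
  refine Finset.sum_le_sum fun k hk => ?_
  have : (2 : ℝ) ≤ k := by exact_mod_cast (Finset.mem_Icc.1 hk).1
  have h : 0 ≤ (k : ℝ) - 1 := by linarith
  gcongr

lemma xiD2_nonneg {x : ℝ} (hx : 0 ≤ x) : 0 ≤ xiD2 P c x := by
  refine Finset.sum_nonneg fun k hk => ?_
  have : (2 : ℝ) ≤ k := by exact_mod_cast (Finset.mem_Icc.1 hk).1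
  have h : 0 ≤ (k : ℝ) - 1 := by linarith
  positivity

lemma xiD1_zero : xiD1 P c 0 = 0 := by
  refine Finset.sum_eq_zero fun k hk => ?_
  have := (Finset.mem_Icc.1 hk).1
  rw [zero_pow (by omega), mul_zero]

lemma hasDerivAt_xiFun (x : ℝ) : HasDerivAt (xiFun P c) (xiD1 P c x) x := by
  unfold xiFun xiD1
  refine HasDerivAt.fun_sum fun k _ => ?_
  refine ((hasDerivAt_pow k x).const_mul (c k ^ 2)).congr_deriv ?_
  ring

lemma hasDerivAt_xiD1 (x : ℝ) : HasDerivAt (xiD1 P c) (xiD2 P c x) x := by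
  unfold xiD1 xiD2
  refine HasDerivAt.fun_sum fun k hk => ?_
  have := (Finset.mem_Icc.1 hk).1
  refine ((hasDerivAt_pow (k - 1) x).const_mul ((k : ℝ) * c k ^ 2)).congr_deriv ?_
  rw [Nat.cast_sub (by omega), show k - 1 - 1 = k - 2 by omega]
  push_cast
  ring

lemma xiD1_sub {x y : ℝ} (hx : 0 ≤ x) (hxy : x ≤ y) :
    xiD1 P c y - xiD1 P c x = ∫ u in x..y, √(xiD2 P c u) ^ 2 := by
  rw [← intervalIntegral.integral_eq_sub_of_hasDerivAt (fun u _ => hasDerivAt_xiD1 P c u)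
    ((continuous_xiD2 P c).intervalIntegrable _ _)]
  refine intervalIntegral.integral_congr fun u hu => ?_
  rw [Set.uIcc_of_le hxy] at hu
  exact (Real.sq_sqrt (xiD2_nonneg P c (hx.trans hu.1))).symm

/-- For an even mixture, `ξ` lies above its tangents. -/
lemma xiFun_tangent (heven : ∀ k, Odd k → c k = 0) (x y : ℝ) :
    xiFun P c x + xiD1 P c x * (y - x) ≤ xiFun P c y := by
  have hconv : ConvexOn ℝ Set.univ (xiFun P c) := by
    have : xiFun P c = fun x => ∑ k ∈ Finset.Icc 2 P, c k ^ 2 * x ^ k := rfl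
    rw [this]
    refine ⟨convex_univ, fun a _ b _ α β hα hβ hαβ => ?_⟩
    simp only [smul_eq_mul, Finset.mul_sum, ← Finset.sum_add_distrib]
    refine Finset.sum_le_sum fun k _ => ?_
    rcases Nat.even_or_odd k with hk | hk
    · have := (hk.convexOn_pow (𝕜 := ℝ)).2 (Set.mem_univ a) (Set.mem_univ b) hα hβ hαβ
      simp only [smul_eq_mul] at this
      nlinarith [sq_nonneg (c k), mul_le_mul_of_nonneg_left this (sq_nonneg (c k))]
    · rw [heven k hk]; simp
  rcases lt_trichotomy x y with h | h | h
  · have := hconv.le_slope_of_hasDerivAt (Set.mem_univ x) (Set.mem_univ y) h (hasDerivAt_xiFun P c x)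
    rw [slope_def_field, le_div_iff₀ (sub_pos.2 h)] at this
    linarith
  · subst h; simp
  · have := hconv.slope_le_of_hasDerivAt (Set.mem_univ y) (Set.mem_univ x) h (hasDerivAt_xiFun P c x)
    rw [slope_def_field, div_le_iff₀ (sub_pos.2 h)] at this
    linarith

/-- The deterministic bound behind the algorithmic threshold. -/
lemma abelSum_bound {ϑ η t₀ : ℝ} (hϑ : 0 < ϑ) (hη : 0 ≤ η) (hη1 : η ≤ 1) (ht₀ : 0 ≤ t₀)
    {H K : ℕ} (hK : 0 < K) {q t : ℕ → ℝ} (hq : ∀ k < H, q k ≤ q (k + 1)) (hq0 : 0 ≤ q 0)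
    (hqη : ∀ k < H, q (k + 1) - q k ≤ η) (hqH : q H ≤ 1 + η) (htH : ∀ k ≤ H, t k ≤ 1)
    (ht0 : t 0 ≤ t₀) {e f : ℕ → ℝ} (he : ∀ k < H, q k ≤ e k) (heH : e H = q H)
    (hf : ∀ k < H, f k ≤ t k * xiD1 P c (q k) + t H * xiD1 P c (q H) / K)
    (hfH : f H = t H * xiD1 P c (q H)) :
    abelSum H (fun k => (if k = 0 then 0 else √(xiD2 P c (q k))) + ϑ) e +
      abelSum H (fun k => ((if k = 0 then 0 else √(xiD2 P c (q k))) + ϑ)⁻¹) f ≤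
    2 * (∫ x in Set.Ioo (0 : ℝ) 1, √(xiD2 P c x)) + 3 * η * √(xiD2 P c 2) + 2 * ϑ +
      t₀ * xiD1 P c 2 / ϑ + xiD1 P c 2 / (K * ϑ) := by
  set D : ℝ → ℝ := fun x => √(xiD2 P c x) with hDdef
  set s : ℕ → ℝ := fun k => (if k = 0 then 0 else D (q k)) + ϑ with hs
  have hqn : ∀ k ≤ H, 0 ≤ q k := by
    intro k
    induction k with
    | zero => intro _; exact hq0
    | succ n ih => intro h; exact (ih (by omega)).trans (hq n (by omega))
  have hqle : ∀ k ≤ H, q k ≤ q H := by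
    intro k hk
    induction hk using Nat.decreasingInduction with
    | self => exact le_rfl
    | of_succ n hn ih => exact (hq n hn).trans ih
  have hD : Continuous D := (continuous_xiD2 P c).sqrt
  have hmono : ∀ x y, 0 ≤ x → x ≤ y → D x ≤ D y := fun x y hx hxy =>
    Real.sqrt_le_sqrt (xiD2_mono P c hx hxy)
  have hD0 : ∀ x, 0 ≤ D x := fun x => Real.sqrt_nonneg _
  have hs0 : s 0 = ϑ := by simp [hs]
  have hsk : ∀ k, s (k + 1) = D (q (k + 1)) + ϑ := fun k => by simp [hs]
  have hspos : ∀ k, 0 < s k := fun k => by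
    simp only [hs]; split_ifs
    · linarith
    · linarith [hD0 (q k)]
  have hsmono : ∀ k < H, s k ≤ s (k + 1) := by
    intro k hk
    rw [hsk]
    simp only [hs]
    split_ifs
    · linarith [hD0 (q (k + 1))]
    · linarith [hmono _ _ (hqn k hk.le) (hq k hk)]
  have hsanti : ∀ k < H, (s (k + 1))⁻¹ ≤ (s k)⁻¹ := fun k hk =>
    inv_anti₀ (hspos k) (hsmono k hk)
  have hqH2 : q H ≤ 2 := by linarith
  have hX2 : xiD1 P c (q H) ≤ xiD1 P c 2 := xiD1_mono P c (hqn H le_rfl) hqH2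
  have hX02 : xiD1 P c (q 0) ≤ xiD1 P c 2 :=
    xiD1_mono P c hq0 ((hqle 0 (Nat.zero_le H)).trans hqH2)
  have hD2 : D (q H) ≤ D 2 := hmono _ _ (hqn H le_rfl) hqH2
  have hXH := xiD1_nonneg P c (hqn H le_rfl)
  have hI : ∫ x in (0 : ℝ)..q H, D x ≤ (∫ x in Set.Ioo (0 : ℝ) 1, D x) + η * D 2 := by
    have hint : ∀ a b, IntervalIntegrable D volume a b := fun a b => hD.intervalIntegrable a b
    have h1 : ∫ x in (0 : ℝ)..q H, D x ≤ ∫ x in (0 : ℝ)..(1 + η), D x :=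
      intervalIntegral.integral_mono_interval le_rfl (hqn H le_rfl) hqH
        (Eventually.of_forall hD0) (hint _ _)
    have h2 := intervalIntegral.integral_add_adjacent_intervals (hint 0 1) (hint 1 (1 + η))
    have h3 : ∫ x in (1 : ℝ)..(1 + η), D x ≤ η * D 2 := by
      have := intervalIntegral.integral_mono_on (g := fun _ => D 2) (a := 1) (b := 1 + η)
        (by linarith) (hint _ _) intervalIntegrable_const
        fun x hx => hmono _ _ (by linarith [hx.1]) (by linarith [hx.2])
      rw [intervalIntegral.integral_const, smul_eq_mul] at this
      linarith
    have h4 : ∫ x in (0 : ℝ)..1, D x = ∫ x in Set.Ioo (0 : ℝ) 1, D x := by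
      rw [intervalIntegral.integral_of_le zero_le_one, integral_Ioc_eq_integral_Ioo]
    linarith
  have hA : abelSum H s e ≤ ϑ * q H + (∫ x in (0 : ℝ)..q H, D x) + η * D (q H) :=
    (abelSum_le_of_le hsmono he heH).trans
      (abelSum_riemann_le hD hmono hD0 hη hq hq0 hqη hs0 hsk)
  set ψ : ℕ → ℝ := fun k => if k = 0 then t₀ * xiD1 P c (q 0) else xiD1 P c (q k) with hψ
  have hB : abelSum H (fun k => (s k)⁻¹) f ≤ t₀ * xiD1 P c (q 0) / ϑ +
      (∫ x in (0 : ℝ)..q H, D x) + xiD1 P c 2 / (K * ϑ) := by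
    have h1 : abelSum H (fun k => (s k)⁻¹) f ≤
        abelSum H (fun k => (s k)⁻¹) (fun k => ψ k + xiD1 P c 2 / K) := by
      refine abelSum_le_of_antitone hsanti (inv_nonneg.2 (hspos H).le) fun k hk => ?_
      have hφ : t k * xiD1 P c (q k) ≤ ψ k := by
        have := xiD1_nonneg P c (hqn k hk)
        simp only [hψ]
        split_ifs with h
        · subst h; exact mul_le_mul_of_nonneg_right ht0 this
        · nlinarith [htH k hk]
      have h5 : t H * xiD1 P c (q H) ≤ xiD1 P c 2 := by nlinarith [htH H le_rfl]
      have h6 : 0 ≤ xiD1 P c 2 / K :=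
        div_nonneg (xiD1_nonneg P c zero_le_two) (Nat.cast_nonneg K)
      rcases hk.lt_or_eq with h | h
      · have h7 : t H * xiD1 P c (q H) / K ≤ xiD1 P c 2 / K := by gcongr
        linarith [hf k h]
      · subst h
        rw [hfH]; linarith
    refine h1.trans ?_
    rw [abelSum_add, abelSum_const, hs0]
    have h2 := abelSum_inv_le (H := H) (ψ := ψ) hD hmono hD0 (fun x y hx hxy => xiD1_sub P c hx hxy)
      (xiD1_zero P c) hϑ hq hq0 hs0 hsk ht₀ (by simp [hψ])
      (fun k hk => by simp [hψ, hk.ne'])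
    have h3 : ϑ⁻¹ * (xiD1 P c 2 / K) = xiD1 P c 2 / (K * ϑ) := by field_simp
    linarith
  have h7 : t₀ * xiD1 P c (q 0) / ϑ ≤ t₀ * xiD1 P c 2 / ϑ := by gcongr
  have h8 : ϑ * q H ≤ 2 * ϑ := by nlinarith
  have h9 : η * D (q H) ≤ η * D 2 := by gcongr
  linarith

end Xi

section Features

variable {N P : ℕ} {c : ℕ → ℝ}

/-- The feature map, for which the Hamiltonian is linear in the couplings. -/
def feat (P : ℕ) (c : ℕ → ℝ) {N : ℕ} (x : EuclideanSpace ℝ (Fin N)) :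
    EuclideanSpace ℝ (GIdx N P) :=
  WithLp.toLp 2 fun i => c i.1 * ∏ l, x (i.2 l)

lemma continuous_feat : Continuous (feat P c (N := N)) := by
  unfold feat
  refine (PiLp.continuous_toLp 2 _).comp (continuous_pi fun i => ?_)
  fun_prop

lemma inner_feat (x y : EuclideanSpace ℝ (Fin N)) :
    inner ℝ (feat P c x) (feat P c y) = xiFun P c (inner ℝ x y) := by
  have h1 : inner ℝ x y = ∑ i, x i * y i := by
    simp [PiLp.inner_apply, mul_comm]
  have h2 : inner ℝ (feat P c x) (feat P c y) =
      ∑ i : GIdx N P, (c i.1 * ∏ l, x (i.2 l)) * (c i.1 * ∏ l, y (i.2 l)) := by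
    simp [PiLp.inner_apply, feat, mul_comm]
  rw [h1, h2, Fintype.sum_sigma, xiFun, ← Finset.sum_coe_sort (Finset.Icc 2 P)]
  refine Finset.sum_congr rfl fun k _ => ?_
  have h3 : (∑ i, x i * y i) ^ (k : ℕ) = ∑ j : Fin (k : ℕ) → Fin N, ∏ l, (x (j l) * y (j l)) := by
    rw [Fintype.sum_pow (fun i => x i * y i)]
  rw [h3, Finset.mul_sum]
  refine Finset.sum_congr rfl fun j _ => ?_
  rw [Finset.prod_mul_distrib]
  ring

end Features

section TreeGaussian

variable {H K : ℕ} [NeZero K]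

lemma exists_tree_gram {φ : ℕ → ℝ} (h0 : 0 ≤ φ 0) (hφ : ∀ k < H, φ k ≤ φ (k + 1)) :
    ∃ M : (Fin H → Fin K) → (Fin (H + 1) × (Fin H → Fin K)) → ℝ,
      ∀ u v, ∑ e, M u e * M v e = φ (cp u v) := by
  have hK : (0 : ℝ) < K := by exact_mod_cast NeZero.pos K
  set Δ : ℕ → ℝ := fun k => if k = 0 then φ 0 else φ k - φ (k - 1) with hΔ
  have hΔ0 : ∀ k ≤ H, 0 ≤ Δ k := by
    intro k hk
    simp only [hΔ]
    split_ifs with h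
    · exact h0
    · have := hφ (k - 1) (by omega)
      rw [show k - 1 + 1 = k by omega] at this
      linarith
  have hsum : ∀ n, ∑ k ∈ Finset.range (n + 1), Δ k = φ n := by
    intro n
    induction n with
    | zero => simp [hΔ]
    | succ n ih => rw [Finset.sum_range_succ, ih]; simp [hΔ]
  refine ⟨fun u e => if Agree e.1 u e.2 then √(Δ e.1 / K ^ (H - e.1)) else 0, fun u v => ?_⟩
  rw [Fintype.sum_prod_type, ← hsum]
  have h1 : ∀ k : Fin (H + 1), ∑ w : Fin H → Fin K,
      ((if Agree k u w then √(Δ k / K ^ (H - (k : ℕ))) else 0) *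
        if Agree k v w then √(Δ k / K ^ (H - (k : ℕ))) else 0) =
      if (k : ℕ) ≤ cp u v then Δ k else 0 := by
    intro k
    have hk : (k : ℕ) ≤ H := by omega
    simp only [le_cp_iff hk]
    by_cases h : Agree k u v
    · have h2 : ∀ w, ((if Agree k u w then √(Δ k / K ^ (H - (k : ℕ))) else 0) *
        if Agree k v w then √(Δ k / K ^ (H - (k : ℕ))) else 0) =
        if Agree k u w then Δ k / K ^ (H - (k : ℕ)) else 0 := by
        intro w
        have h3 : Agree k v w ↔ Agree k u w := ⟨h.trans, h.symm.trans⟩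
        simp only [h3]
        split_ifs
        · exact Real.mul_self_sqrt (div_nonneg (hΔ0 k hk) (by positivity))
        · simp
      simp only [h2, h, if_true]
      rw [← Finset.sum_filter, Finset.sum_const, card_agree hk, nsmul_eq_mul]
      push_cast
      field_simp
    · rw [if_neg h]
      refine Finset.sum_eq_zero fun w _ => ?_
      by_cases h2 : Agree k u w
      · have h3 : ¬ Agree k v w := fun h4 => h (h2.trans h4.symm)
        simp [h3]
      · simp [h2]
  simp only [h1]
  rw [Fin.sum_univ_eq_sum_range (fun k => if k ≤ cp u v then Δ k else 0) (H + 1),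
    ← Finset.sum_filter]
  refine Finset.sum_congr ?_ fun _ _ => rfl
  ext k
  simp only [Finset.mem_filter, Finset.mem_range]
  have := cp_le u v
  omega

lemma integrable_inner_mul_inner {V : Type*} [NormedAddCommGroup V] [InnerProductSpace ℝ V]
    [FiniteDimensional ℝ V] [MeasurableSpace V] [BorelSpace V] (a b : V) :
    Integrable (fun z => inner ℝ a z * inner ℝ b z) (stdGaussian V) := by
  refine Integrable.mono' ((integrable_norm_sq_stdGaussian (V := V)).const_mul (‖a‖ * ‖b‖))
    (by fun_prop) (Eventually.of_forall fun z => ?_)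
  rw [norm_mul]
  refine (mul_le_mul (norm_inner_le_norm a z) (norm_inner_le_norm b z) (norm_nonneg _)
    (by positivity)).trans (le_of_eq (by ring))

variable {N : ℕ} {J : Type*} [Fintype J]

lemma integral_inner_combination (m m' : J → ℝ) :
    Integrable (fun z : PiLp 2 fun _ : J => EuclideanSpace ℝ (Fin N) =>
      inner ℝ (∑ e, m e • z e) (∑ e, m' e • z e))
      (stdGaussian (PiLp 2 fun _ : J => EuclideanSpace ℝ (Fin N))) ∧
    ∫ z : PiLp 2 fun _ : J => EuclideanSpace ℝ (Fin N), inner ℝ (∑ e, m e • z e)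
      (∑ e, m' e • z e) ∂(stdGaussian (PiLp 2 fun _ : J => EuclideanSpace ℝ (Fin N))) =
      N * ∑ e, m e * m' e := by
  set a : (J → ℝ) → Fin N → PiLp 2 fun _ : J => EuclideanSpace ℝ (Fin N) :=
    fun m i => WithLp.toLp 2 fun e => m e • EuclideanSpace.single i 1 with ha
  have h1 : ∀ (m : J → ℝ) i (z : PiLp 2 fun _ : J => EuclideanSpace ℝ (Fin N)),
      (∑ e, m e • z e) i = inner ℝ (a m i) z := by
    intro m i z
    simp [ha, PiLp.inner_apply (𝕜 := ℝ) (ι := J), real_inner_smul_left,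
      EuclideanSpace.inner_single_left]
  have h2 : ∀ z : PiLp 2 fun _ : J => EuclideanSpace ℝ (Fin N),
      inner ℝ (∑ e, m e • z e) (∑ e, m' e • z e) =
      ∑ i, inner ℝ (a m i) z * inner ℝ (a m' i) z := by
    intro z
    rw [PiLp.inner_apply]
    refine Finset.sum_congr rfl fun i _ => ?_
    rw [h1, h1]
    simp [mul_comm]
  simp only [h2]
  refine ⟨integrable_finsetSum _ fun i _ => integrable_inner_mul_inner _ _, ?_⟩
  rw [integral_finsetSum _ fun i _ => integrable_inner_mul_inner _ _]
  simp only [integral_inner_mul_inner]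
  have h3 : ∀ i, inner ℝ (a m i) (a m' i) = ∑ e, m e * m' e := by
    intro i
    simp [ha, PiLp.inner_apply (𝕜 := ℝ) (ι := J), real_inner_smul_left, real_inner_smul_right,
      mul_comm]
  simp [h3]

lemma integral_abelSum {α : Type*} [MeasurableSpace α] {μ : Measure α} (H : ℕ) (s : ℕ → ℝ)
    {F : ℕ → α → ℝ} (hF : ∀ k, Integrable (F k) μ) :
    Integrable (fun z => abelSum H s fun k => F k z) μ ∧
    ∫ z, abelSum H s (fun k => F k z) ∂μ = abelSum H s fun k => ∫ z, F k z ∂μ := by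
  unfold abelSum
  have h1 : ∀ k ∈ Finset.range H, Integrable (fun z => s (k + 1) * (F (k + 1) z - F k z)) μ :=
    fun k _ => ((hF (k + 1)).sub (hF k)).const_mul _
  refine ⟨((hF 0).const_mul _).add (integrable_finsetSum _ h1), ?_⟩
  rw [integral_add ((hF 0).const_mul _) (integrable_finsetSum _ h1), integral_const_mul,
    integral_finsetSum _ h1]
  congr 1
  refine Finset.sum_congr rfl fun k _ => ?_
  rw [integral_const_mul, integral_sub (hF _) (hF _)]

lemma abelSum_const_mul (H : ℕ) (s a : ℕ → ℝ) (r : ℝ) :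
    abelSum H s (fun k => r * a k) = r * abelSum H s a := by
  simp only [abelSum, mul_add, Finset.mul_sum]
  congr 1
  · ring
  · exact Finset.sum_congr rfl fun k _ => by ring

end TreeGaussian

section EnergyBound

variable {H K : ℕ} [NeZero K] {N P : ℕ} {c : ℕ → ℝ} {J : Type*} [Fintype J]

lemma inner_toLp_combination {V : Type*} [NormedAddCommGroup V] [InnerProductSpace ℝ V]
    {U : Type*} [Fintype U] (α : U → J → ℝ) (y : U → V) (Z : PiLp 2 fun _ : J => V) :
    inner ℝ (WithLp.toLp 2 fun e => ∑ u, α u e • y u : PiLp 2 fun _ : J => V) Z =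
      ∑ u, inner ℝ (y u) (∑ e, α u e • Z e) := by
  simp only [PiLp.inner_apply, sum_inner, inner_sum, real_inner_smul_left, real_inner_smul_right]
  rw [Finset.sum_comm]

lemma norm_sq_toLp_combination {V : Type*} [NormedAddCommGroup V] [InnerProductSpace ℝ V]
    {U : Type*} [Fintype U] (α : U → J → ℝ) (y : U → V) :
    ‖(WithLp.toLp 2 fun e => ∑ u, α u e • y u : PiLp 2 fun _ : J => V)‖ ^ 2 =
      ∑ u, ∑ v, (∑ e, α u e * α v e) * inner ℝ (y u) (y v) := by
  rw [← real_inner_self_eq_norm_sq, inner_toLp_combination]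
  refine Finset.sum_congr rfl fun u _ => ?_
  simp only [inner_sum, real_inner_smul_right, Finset.mul_sum, Finset.sum_mul]
  rw [Finset.sum_comm]
  refine Finset.sum_congr rfl fun v _ => Finset.sum_congr rfl fun e _ => ?_
  ring

/-- On configurations with an ultrametric overlap structure, the average energy in an ultrametric
family of disorders does not exceed the algorithmic threshold. -/
lemma measure_tree_energy_gt_le (heven : ∀ k, Odd k → c k = 0) (hN : 1 ≤ N)
    {ϑ η t₀ : ℝ} (hϑ : 0 < ϑ) (hη : 0 ≤ η) (hη1 : η ≤ 1) (ht₀ : 0 ≤ t₀)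
    {q t : ℕ → ℝ} (hq : ∀ k < H, q k ≤ q (k + 1)) (hq0 : 0 ≤ q 0)
    (hqη : ∀ k < H, q (k + 1) - q k ≤ η) (hqH : q H ≤ 1 + η)
    (ht : ∀ k < H, t k ≤ t (k + 1)) (htpos : 0 ≤ t 0) (htH : t H ≤ 1) (ht0 : t 0 ≤ t₀)
    (α : (Fin H → Fin K) → J → ℝ) (hα : ∀ u v, ∑ e, α u e * α v e = t (cp u v))
    {B δ : ℝ} (hδ : 0 < δ) (hB : (∫ x in Set.Ioo (0 : ℝ) 1, √(xiD2 P c x)) +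
      (3 * η * √(xiD2 P c 2) + 2 * ϑ + t₀ * xiD1 P c 2 / ϑ + xiD1 P c 2 / (K * ϑ)) / 2 ≤ B) :
    stdGaussian (PiLp 2 fun _ : J => EuclideanSpace ℝ (GIdx N P))
      {Z | ∃ x : (Fin H → Fin K) → EuclideanSpace ℝ (Fin N),
        (∀ u v, inner ℝ (x u) (x v) = q (cp u v)) ∧
        ((K : ℝ) ^ H * √N) * (B + δ) < ∑ u, inner ℝ (feat P c (x u)) (∑ e, α u e • Z e)} ≤
      ENNReal.ofReal (2 * (xiFun P c 2 / N) / δ ^ 2) := by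
  classical
  have hK : (0 : ℝ) < K := by exact_mod_cast NeZero.pos K
  have hN0 : (0 : ℝ) < N := by exact_mod_cast hN
  have hmon : ∀ a : ℕ → ℝ, (∀ k < H, a k ≤ a (k + 1)) → ∀ i j, i ≤ j → j ≤ H → a i ≤ a j := by
    intro a ha i j hij
    induction hij with
    | refl => intro _; exact le_rfl
    | step h ih => intro hj; exact (ih (by omega)).trans (ha _ (by omega))
  have hqm := hmon q hq
  have htm := hmon t ht
  have hqn : ∀ k ≤ H, 0 ≤ q k := fun k hk => hq0.trans (hqm 0 k (Nat.zero_le _) hk)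
  have htn : ∀ k ≤ H, 0 ≤ t k := fun k hk => htpos.trans (htm 0 k (Nat.zero_le _) hk)
  have hq2 : ∀ k ≤ H, q k ≤ 2 := fun k hk => (hqm k H hk le_rfl).trans (by linarith)
  set φ : ℕ → ℝ := fun k => t k * xiD1 P c (q k) with hφdef
  have hφ : ∀ k < H, φ k ≤ φ (k + 1) := fun k hk =>
    mul_le_mul (ht k hk) (xiD1_mono P c (hqn k hk.le) (hq k hk)) (xiD1_nonneg P c (hqn k hk.le))
      (htn _ hk)
  have hφ0 : 0 ≤ φ 0 := mul_nonneg htpos (xiD1_nonneg P c hq0)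
  obtain ⟨M, hM⟩ := exists_tree_gram (K := K) hφ0 hφ
  set r : ℝ := (K : ℝ) ^ H * √N with hr
  have hr0 : 0 < r := by positivity
  set X := {x : (Fin H → Fin K) → EuclideanSpace ℝ (Fin N) //
    ∀ u v, inner ℝ (x u) (x v) = q (cp u v)}
  set v : X → PiLp 2 fun _ : J => EuclideanSpace ℝ (GIdx N P) :=
    fun x => r⁻¹ • WithLp.toLp 2 fun e => ∑ u, α u e • feat P c (x.1 u) with hv
  set w : X → PiLp 2 fun _ : Fin (H + 1) × (Fin H → Fin K) => EuclideanSpace ℝ (Fin N) :=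
    fun x => r⁻¹ • WithLp.toLp 2 fun e => ∑ u, M u e • x.1 u with hw
  have hvin : ∀ x Z, inner ℝ (v x) Z = r⁻¹ * ∑ u, inner ℝ (feat P c (x.1 u)) (∑ e, α u e • Z e) := by
    intro x Z
    rw [hv, real_inner_smul_left, inner_toLp_combination]
  have hwin : ∀ x Z, inner ℝ (w x) Z = r⁻¹ * ∑ u, inner ℝ (x.1 u) (∑ e, M u e • Z e) := by
    intro x Z
    rw [hw, real_inner_smul_left, inner_toLp_combination]
  have hset : {Z : PiLp 2 fun _ : J => EuclideanSpace ℝ (GIdx N P) |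
      ∃ x : (Fin H → Fin K) → EuclideanSpace ℝ (Fin N),
        (∀ u v, inner ℝ (x u) (x v) = q (cp u v)) ∧
        r * (B + δ) < ∑ u, inner ℝ (feat P c (x u)) (∑ e, α u e • Z e)} =
      {Z | ∃ x, B + δ < inner ℝ (v x) Z} := by
    ext Z
    simp only [hvin, lt_inv_mul_iff₀ hr0]
    exact ⟨fun ⟨x, hx, h⟩ => ⟨⟨x, hx⟩, h⟩, fun ⟨x, h⟩ => ⟨x.1, x.2, h⟩⟩
  rw [hset]
  have hvc : Continuous v := by
    have := continuous_feat (N := N) (P := P) (c := c)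
    have h1 : Continuous fun x : X => fun e : J => ∑ u, α u e • feat P c (x.1 u) := by
      refine continuous_pi fun e => ?_
      refine continuous_finsetSum _ fun u _ => Continuous.fun_const_smul (this.comp ?_) _
      exact (continuous_apply u).comp continuous_subtype_val
    exact ((PiLp.continuous_toLp 2 (fun _ : J => EuclideanSpace ℝ (GIdx N P))).comp h1).fun_const_smul _
  have hvw : ∀ x y, ‖v x - v y‖ ≤ ‖w x - w y‖ := by
    intro x y
    have e1 : v x - v y = r⁻¹ • WithLp.toLp 2 fun e =>
        ∑ u, α u e • (feat P c (x.1 u) - feat P c (y.1 u)) := by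
      rw [hv, ← smul_sub, ← WithLp.toLp_sub]
      congr 2
      funext e
      simp only [Pi.sub_apply, ← Finset.sum_sub_distrib, ← smul_sub]
    have e2 : w x - w y = r⁻¹ • WithLp.toLp 2 fun e => ∑ u, M u e • (x.1 u - y.1 u) := by
      rw [hw, ← smul_sub, ← WithLp.toLp_sub]
      congr 2
      funext e
      simp only [Pi.sub_apply, ← Finset.sum_sub_distrib, ← smul_sub]
    rw [e1, e2, norm_smul, norm_smul]
    refine mul_le_mul_of_nonneg_left ?_ (norm_nonneg _)
    refine (sq_le_sq₀ (norm_nonneg _) (norm_nonneg _)).1 ?_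
    rw [norm_sq_toLp_combination, norm_sq_toLp_combination]
    refine Finset.sum_le_sum fun u _ => Finset.sum_le_sum fun u' _ => ?_
    rw [hα, hM]
    simp only [hφdef, inner_sub_left, inner_sub_right, inner_feat, x.2, y.2]
    rw [mul_assoc]
    refine mul_le_mul_of_nonneg_left ?_ (htn _ (cp_le _ _))
    have h1 := xiFun_tangent P c heven (q (cp u u')) (inner ℝ (x.1 u) (y.1 u'))
    have h2 := xiFun_tangent P c heven (q (cp u u')) (inner ℝ (y.1 u) (x.1 u'))
    linarith
  have hcard : (Fintype.card (Fin H → Fin K) : ℝ) = (K : ℝ) ^ H := by simp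
  have hxi2 := xiFun_nonneg P c (x := 2) zero_le_two
  have hvn : ∀ x, ‖v x‖ ≤ (Real.toNNReal √(xiFun P c 2 / N) : ℝ) := by
    intro x
    rw [Real.coe_toNNReal _ (Real.sqrt_nonneg _)]
    refine Real.le_sqrt_of_sq_le ?_
    rw [hv, norm_smul, mul_pow, norm_sq_toLp_combination, Real.norm_eq_abs, sq_abs]
    have : ∑ u, ∑ u', (∑ e, α u e * α u' e) * inner ℝ (feat P c (x.1 u)) (feat P c (x.1 u')) ≤
        ∑ u : Fin H → Fin K, ∑ u' : Fin H → Fin K, xiFun P c 2 := by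
      refine Finset.sum_le_sum fun u _ => Finset.sum_le_sum fun u' _ => ?_
      rw [hα, inner_feat, x.2]
      have h1 := xiFun_mono P c (hqn _ (cp_le u u')) (hq2 _ (cp_le u u'))
      have h2 := xiFun_nonneg P c (hqn _ (cp_le u u'))
      have h3 := (htm _ H (cp_le u u') le_rfl).trans htH
      nlinarith
    simp only [Finset.sum_const, Finset.card_univ, nsmul_eq_mul, hcard] at this
    refine (mul_le_mul_of_nonneg_left this (by positivity)).trans (le_of_eq ?_)
    rw [hr, inv_pow, mul_pow, Real.sq_sqrt hN0.le]
    field_simp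
  set s : ℕ → ℝ := fun k => (if k = 0 then 0 else √(xiD2 P c (q k))) + ϑ with hs
  have hspos : ∀ k, 0 < s k := fun k => by
    simp only [hs]; split_ifs
    · linarith
    · linarith [Real.sqrt_nonneg (xiD2 P c (q k))]
  set n : ℝ := (K : ℝ) ^ H with hn
  have hn0 : 0 < n := by positivity
  set e : ℕ → ℝ := fun k => n⁻¹ * ∑ u : Fin H → Fin K, treeAvg k q u with he
  set f : ℕ → ℝ := fun k => n⁻¹ * ∑ u : Fin H → Fin K, treeAvg k φ u with hf
  set ζ : (PiLp 2 fun _ : Fin (H + 1) × (Fin H → Fin K) => EuclideanSpace ℝ (Fin N)) →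
    (Fin H → Fin K) → EuclideanSpace ℝ (Fin N) := fun z u => ∑ e, M u e • z e with hζ
  set Ψ : (PiLp 2 fun _ : Fin (H + 1) × (Fin H → Fin K) => EuclideanSpace ℝ (Fin N)) → ℝ :=
    fun z => (abelSum H s e + abelSum H (fun k => (s k)⁻¹)
      (fun k => (n⁻¹ / N) * treeForm k (ζ z) (ζ z))) / 2 with hΨ
  have hTi : ∀ k, Integrable (fun z => treeForm k (ζ z) (ζ z))
      (stdGaussian (PiLp 2 fun _ : Fin (H + 1) × (Fin H → Fin K) => EuclideanSpace ℝ (Fin N))) := by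
    intro k
    exact (integrable_finsetSum _ fun u _ => integrable_finsetSum _ fun v _ =>
      (integral_inner_combination (M u) (M v)).1).div_const _
  have hTint : ∀ k, ∫ z, treeForm k (ζ z) (ζ z) ∂(stdGaussian
      (PiLp 2 fun _ : Fin (H + 1) × (Fin H → Fin K) => EuclideanSpace ℝ (Fin N))) =
      N * ∑ u : Fin H → Fin K, treeAvg k φ u := by
    intro k
    unfold treeForm
    rw [integral_div, integral_finsetSum _ fun u _ => integrable_finsetSum _ fun v _ =>
      (integral_inner_combination (M u) (M v)).1]
    simp only [treeAvg]
    rw [← Finset.sum_div, ← mul_div_assoc, Finset.mul_sum]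
    congr 1
    refine Finset.sum_congr rfl fun u _ => ?_
    rw [integral_finsetSum _ fun v _ => (integral_inner_combination (M u) (M v)).1, Finset.mul_sum]
    refine Finset.sum_congr rfl fun v _ => ?_
    rw [← hM]
    exact (integral_inner_combination (M u) (M v)).2
  obtain ⟨hAi, hAint⟩ := integral_abelSum H (fun k => (s k)⁻¹)
    (F := fun k z => (n⁻¹ / N) * treeForm k (ζ z) (ζ z)) fun k => (hTi k).const_mul _
  have hΨi : Integrable Ψ (stdGaussian
      (PiLp 2 fun _ : Fin (H + 1) × (Fin H → Fin K) => EuclideanSpace ℝ (Fin N))) :=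
    ((integrable_const _).add hAi).div_const _
  have hΨint : ∫ z, Ψ z ∂(stdGaussian
      (PiLp 2 fun _ : Fin (H + 1) × (Fin H → Fin K) => EuclideanSpace ℝ (Fin N))) =
      (abelSum H s e + abelSum H (fun k => (s k)⁻¹) f) / 2 := by
    rw [hΨ, integral_div, integral_add (integrable_const _) hAi, hAint]
    simp only [integral_const, probReal_univ, one_smul, integral_const_mul, hTint]
    congr 3
    funext k
    rw [hf]
    field_simp
  have hwΨ : ∀ x g, inner ℝ (w x) g ≤ Ψ g := by
    intro x g
    rw [hwin]
    have hsN : 0 < √(N : ℝ) := Real.sqrt_pos.2 hN0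
    have h1 := sum_inner_le x.1 (fun u => (√(N : ℝ))⁻¹ • ζ g u) s hspos
    have h2 : ∀ k, treeForm k x.1 x.1 = n * e k := by
      intro k
      rw [treeForm_eq_of_inner x.2, he]
      field_simp
    have h3 : ∀ k, treeForm k (fun u => (√(N : ℝ))⁻¹ • ζ g u) (fun u => (√(N : ℝ))⁻¹ • ζ g u) =
        n * ((n⁻¹ / N) * treeForm k (ζ g) (ζ g)) := by
      intro k
      have := treeForm_smul_sub k (ζ g) 0 (√(N : ℝ))⁻¹ 0
      simp only [zero_smul, sub_zero, inv_pow, Real.sq_sqrt hN0.le] at this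
      rw [this]
      field_simp
      ring
    simp only [h2, h3, abelSum_const_mul, real_inner_smul_right, ← Finset.mul_sum] at h1
    rw [hΨ]
    simp only [abelSum_const_mul]
    rw [hr, mul_inv, mul_assoc, inv_mul_le_iff₀ hn0]
    linarith
  refine (measure_exists_inner_gt_le hvc hvw hvn hΨi hwΨ ?_ hδ).trans (le_of_eq ?_)
  · rw [hΨint]
    have hnc : ∀ r : ℝ, n⁻¹ * ∑ _u : Fin H → Fin K, r = r := by
      intro r
      simp only [Finset.sum_const, Finset.card_univ, nsmul_eq_mul, hcard]
      field_simp
    have := abelSum_bound P c (H := H) (K := K) (e := e) (f := f) hϑ hη hη1 ht₀ (NeZero.pos K) hq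
      hq0 hqη hqH (fun k hk => (htm k H hk le_rfl).trans htH) ht0
      (fun k hk => by
        rw [← hnc (q k), he]
        refine mul_le_mul_of_nonneg_left (Finset.sum_le_sum fun u _ => ?_) (by positivity)
        exact le_treeAvg hk.le hqm u)
      (by simp only [he, treeAvg_top, hnc])
      (fun k hk => by
        rw [← hnc (t k * _ + _), hf]
        refine mul_le_mul_of_nonneg_left (Finset.sum_le_sum fun u _ => ?_) (by positivity)
        exact treeAvg_le hk (hmon φ hφ) hφ0 u)
      (by simp only [hf, treeAvg_top, hnc, hφdef])
    refine le_trans ?_ hB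
    linarith
  · rw [Real.coe_toNNReal _ (Real.sqrt_nonneg _), Real.sq_sqrt (by positivity)]

end EnergyBound

section Tame

variable {N P : ℕ} {c : ℕ → ℝ}

/-- The tensor product of `k` vectors, as an element of the space of couplings. -/
def tens (N : ℕ) {P : ℕ} (k : {k : ℕ // k ∈ Finset.Icc 2 P}) :
    MultilinearMap ℝ (fun _ : Fin (k : ℕ) => EuclideanSpace ℝ (Fin N))
      (EuclideanSpace ℝ (GIdx N P)) :=
  ∑ j : Fin (k : ℕ) → Fin N,
    ((MultilinearMap.mkPiAlgebra ℝ (Fin (k : ℕ)) ℝ).compLinearMap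
      fun l => (EuclideanSpace.proj (𝕜 := ℝ) (j l)).toLinearMap).smulRight
      (EuclideanSpace.single (⟨k, j⟩ : GIdx N P) (1 : ℝ))

lemma tens_apply (k : {k : ℕ // k ∈ Finset.Icc 2 P})
    (x : Fin (k : ℕ) → EuclideanSpace ℝ (Fin N)) :
    tens N k x = ∑ j : Fin (k : ℕ) → Fin N, (∏ l, x l (j l)) •
      EuclideanSpace.single (⟨k, j⟩ : GIdx N P) (1 : ℝ) := by
  simp [tens]

lemma norm_tens (k : {k : ℕ // k ∈ Finset.Icc 2 P})
    (x : Fin (k : ℕ) → EuclideanSpace ℝ (Fin N)) : ‖tens N k x‖ = ∏ l, ‖x l‖ := by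
  rw [← sq_eq_sq₀ (norm_nonneg _) (Finset.prod_nonneg fun _ _ => norm_nonneg _),
    ← real_inner_self_eq_norm_sq, ← Finset.prod_pow]
  have h : ∀ l, ‖x l‖ ^ 2 = ∑ i, (x l i) ^ 2 := fun l => by
    rw [EuclideanSpace.norm_sq_eq]; simp
  simp only [h]
  rw [Finset.prod_univ_sum, Fintype.piFinset_univ, tens_apply, sum_inner]
  refine Finset.sum_congr rfl fun j _ => ?_
  rw [inner_sum, Finset.sum_eq_single j]
  · rw [real_inner_self_eq_norm_sq, norm_smul, PiLp.norm_single, norm_one, mul_one,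
      Real.norm_eq_abs, sq_abs, Finset.prod_pow]
  · intro j' _ hj
    simp [real_inner_smul_left, real_inner_smul_right, EuclideanSpace.inner_single_left, hj.symm]
  · simp

lemma feat_eq_sum_tens (x : EuclideanSpace ℝ (Fin N)) :
    feat P c x = ∑ k : {k : ℕ // k ∈ Finset.Icc 2 P}, c k • tens N k fun _ => x := by
  ext ⟨k, j⟩
  simp only [tens_apply, feat]
  rw [WithLp.ofLp_sum, Finset.sum_apply, Finset.sum_eq_single k]
  · rw [WithLp.ofLp_smul, WithLp.ofLp_sum, Pi.smul_apply, Finset.sum_apply,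
      Finset.sum_eq_single j]
    · simp
    · intro j' _ hj
      simp [hj.symm]
    · simp
  · intro k' _ hk
    rw [WithLp.ofLp_smul, WithLp.ofLp_sum, Pi.smul_apply, Finset.sum_apply]
    have : ∀ j', (⟨k, j⟩ : GIdx N P) ≠ ⟨k', j'⟩ := fun j' h => hk (Sigma.mk.inj_iff.1 h).1.symm
    simp [this]
  · simp

/-- The energy landscape of the couplings `g` is Lipschitz on the ball of radius two. -/
def Tame (c : ℕ → ℝ) (C : ℝ) (g : EuclideanSpace ℝ (GIdx N P)) : Prop :=
  ∀ x y : EuclideanSpace ℝ (Fin N), ‖x‖ ≤ 2 → ‖y‖ ≤ 2 →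
    |inner ℝ (feat P c x) g - inner ℝ (feat P c y) g| ≤ C * √N * ‖x - y‖

lemma measure_tens_gt_le (hN : 1 ≤ N) (k : {k : ℕ // k ∈ Finset.Icc 2 P}) :
    stdGaussian (EuclideanSpace ℝ (GIdx N P))
      {g | ∃ x : Fin (k : ℕ) → EuclideanSpace ℝ (Fin N), (∀ l, ‖x l‖ ≤ 1) ∧
        √N * ((k : ℝ) ^ 3 + 1) < inner ℝ (tens N k x) g} ≤ ENNReal.ofReal (2 / N) := by
  have hN0 : (0 : ℝ) < N := by exact_mod_cast hN
  have hs : 0 < √(N : ℝ) := Real.sqrt_pos.2 hN0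
  have hk2 : 2 ≤ (k : ℕ) := (Finset.mem_Icc.1 k.2).1
  have hk1 : (1 : ℝ) ≤ ((k : ℕ) : ℝ) := by exact_mod_cast (by omega : 1 ≤ (k : ℕ))
  set X := {x : Fin (k : ℕ) → EuclideanSpace ℝ (Fin N) // ∀ l, ‖x l‖ ≤ 1}
  set v : X → EuclideanSpace ℝ (GIdx N P) := fun x => (√(N : ℝ))⁻¹ • tens N k x.1 with hv
  set w : X → PiLp 2 fun _ : Fin (k : ℕ) => EuclideanSpace ℝ (Fin N) :=
    fun x => ((√(N : ℝ))⁻¹ * (k : ℝ)) • WithLp.toLp 2 x.1 with hw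
  have hset : {g : EuclideanSpace ℝ (GIdx N P) |
      ∃ x : Fin (k : ℕ) → EuclideanSpace ℝ (Fin N), (∀ l, ‖x l‖ ≤ 1) ∧
        √N * ((k : ℝ) ^ 3 + 1) < inner ℝ (tens N k x) g} =
      {g | ∃ x, (k : ℝ) ^ 3 + 1 < inner ℝ (v x) g} := by
    ext g
    simp only [hv, real_inner_smul_left, lt_inv_mul_iff₀ hs]
    exact ⟨fun ⟨x, hx, h⟩ => ⟨⟨x, hx⟩, h⟩, fun ⟨x, h⟩ => ⟨x.1, x.2, h⟩⟩
  rw [hset]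
  have hbd : ∀ m, ‖tens (P := P) N k m‖ ≤ 1 * ∏ i, ‖m i‖ := fun m => by rw [norm_tens, one_mul]
  have hcont : Continuous v := by
    have h1 : Continuous fun x : X => tens N k x.1 :=
      ((tens N k).continuous_of_bound 1 hbd).comp continuous_subtype_val
    exact h1.fun_const_smul _
  have hnx : ∀ x : X, ‖x.1‖ ≤ 1 := fun x => (pi_norm_le_iff_of_nonneg zero_le_one).2 x.2
  have hvw : ∀ x y, ‖v x - v y‖ ≤ ‖w x - w y‖ := by
    intro x y
    rw [hv, hw, ← smul_sub, ← smul_sub, norm_smul, norm_smul, norm_mul, mul_assoc]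
    refine mul_le_mul_of_nonneg_left ?_ (norm_nonneg _)
    have h1 := (tens (P := P) N k).norm_image_sub_le_of_bound zero_le_one hbd x.1 y.1
    have h2 : max ‖x.1‖ ‖y.1‖ ^ (Fintype.card (Fin (k : ℕ)) - 1) ≤ 1 :=
      pow_le_one₀ (le_max_of_le_left (norm_nonneg _)) (max_le (hnx x) (hnx y))
    have h3 : ‖x.1 - y.1‖ ≤ ‖(WithLp.toLp 2 x.1 - WithLp.toLp 2 y.1 :
        PiLp 2 fun _ : Fin (k : ℕ) => EuclideanSpace ℝ (Fin N))‖ := by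
      refine (pi_norm_le_iff_of_nonneg (norm_nonneg _)).2 fun l => ?_
      exact PiLp.norm_apply_le (WithLp.toLp 2 x.1 - WithLp.toLp 2 y.1 :
        PiLp 2 fun _ : Fin (k : ℕ) => EuclideanSpace ℝ (Fin N)) l
    refine h1.trans ?_
    rw [one_mul, Fintype.card_fin, Real.norm_natCast] at *
    calc ((k : ℕ) : ℝ) * max ‖x.1‖ ‖y.1‖ ^ ((k : ℕ) - 1) * ‖x.1 - y.1‖
        ≤ ((k : ℕ) : ℝ) * 1 * ‖x.1 - y.1‖ := by gcongr
      _ ≤ _ := by rw [mul_one]; gcongr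
  have hvn : ∀ x, ‖v x‖ ≤ (Real.toNNReal (√(N : ℝ))⁻¹ : ℝ) := by
    intro x
    rw [Real.coe_toNNReal _ (by positivity), hv, norm_smul, norm_tens, norm_inv, Real.norm_eq_abs,
      abs_of_pos hs]
    exact mul_le_of_le_one_right (by positivity)
      (Finset.prod_le_one (fun _ _ => norm_nonneg _) fun l _ => x.2 l)
  refine (measure_exists_inner_gt_le hcont hvw hvn
    (Ψ := fun g => ((√(N : ℝ))⁻¹ * (k : ℝ) ^ 2) * ‖g‖)
    (integrable_norm_stdGaussian.const_mul _) ?_ ?_ zero_lt_one).trans (le_of_eq ?_)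
  · intro x g
    rw [hw, real_inner_smul_left, sq, ← mul_assoc, mul_assoc _ _ ‖g‖]
    refine mul_le_mul_of_nonneg_left ((real_inner_le_norm _ _).trans ?_) (by positivity)
    refine mul_le_mul_of_nonneg_right ?_ (norm_nonneg _)
    refine (sq_le_sq₀ (norm_nonneg _) (by positivity)).1 ?_
    rw [PiLp.norm_sq_eq_of_L2]
    calc ∑ l, ‖x.1 l‖ ^ 2 ≤ ∑ l : Fin (k : ℕ), (1 : ℝ) :=
          Finset.sum_le_sum fun l _ => pow_le_one₀ (norm_nonneg _) (x.2 l)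
      _ = (k : ℕ) := by simp
      _ ≤ _ := by nlinarith
  · rw [integral_const_mul]
    have h1 := integral_norm_stdGaussian_le
      (V := PiLp 2 fun _ : Fin (k : ℕ) => EuclideanSpace ℝ (Fin N))
    have h2 : Module.finrank ℝ (PiLp 2 fun _ : Fin (k : ℕ) => EuclideanSpace ℝ (Fin N)) =
        (k : ℕ) * N := by
      rw [(WithLp.linearEquiv 2 ℝ (Fin (k : ℕ) → EuclideanSpace ℝ (Fin N))).finrank_eq,
        Module.finrank_pi_fintype]
      simp
    rw [h2, Nat.cast_mul, Real.sqrt_mul (by positivity)] at h1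
    have h3 : √((k : ℕ) : ℝ) ≤ (k : ℕ) := by
      rw [Real.sqrt_le_left (by positivity)]; nlinarith
    refine (mul_le_mul_of_nonneg_left h1 (by positivity)).trans ?_
    calc (√(N : ℝ))⁻¹ * ((k : ℕ) : ℝ) ^ 2 * (√((k : ℕ) : ℝ) * √N)
        = ((k : ℕ) : ℝ) ^ 2 * √((k : ℕ) : ℝ) := by field_simp
      _ ≤ ((k : ℕ) : ℝ) ^ 2 * (k : ℕ) := by gcongr
      _ = _ := by ring
  · rw [Real.coe_toNNReal _ (by positivity), inv_pow, Real.sq_sqrt hN0.le]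
    congr 1
    field_simp

lemma abs_inner_tens_le {k : {k : ℕ // k ∈ Finset.Icc 2 P}} {C : ℝ}
    {g : EuclideanSpace ℝ (GIdx N P)}
    (h : ∀ x : Fin (k : ℕ) → EuclideanSpace ℝ (Fin N), (∀ l, ‖x l‖ ≤ 1) →
      inner ℝ (tens N k x) g ≤ C) (x : Fin (k : ℕ) → EuclideanSpace ℝ (Fin N)) :
    |inner ℝ (tens N k x) g| ≤ C * ∏ l, ‖x l‖ := by
  have hk2 : 2 ≤ (k : ℕ) := (Finset.mem_Icc.1 k.2).1
  set n : Fin (k : ℕ) → EuclideanSpace ℝ (Fin N) := fun l => ‖x l‖⁻¹ • x l with hn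
  have hn1 : ∀ l, ‖n l‖ ≤ 1 := fun l => by
    rw [hn, norm_smul, norm_inv, norm_norm]
    exact inv_mul_le_one
  have hx : x = fun l => ‖x l‖ • n l := by
    funext l
    by_cases hl : ‖x l‖ = 0
    · rw [hl, zero_smul]; exact norm_eq_zero.1 hl
    · rw [hn, smul_smul, mul_inv_cancel₀ hl, one_smul]
  have h1 : tens (P := P) N k x = (∏ l, ‖x l‖) • tens N k n := by
    conv_lhs => rw [hx]
    rw [MultilinearMap.map_smul_univ]
  have h2 := h n hn1
  set i0 : Fin (k : ℕ) := ⟨0, by omega⟩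
  have h3 := h (fun l => (if l = i0 then (-1 : ℝ) else 1) • n l) (fun l => by
    rw [norm_smul]
    split_ifs <;> simpa using hn1 l)
  rw [MultilinearMap.map_smul_univ, Finset.prod_ite_eq' Finset.univ i0 (fun _ => (-1 : ℝ)),
    if_pos (Finset.mem_univ _), real_inner_smul_left] at h3
  have hp : 0 ≤ ∏ l, ‖x l‖ := Finset.prod_nonneg fun _ _ => norm_nonneg _
  rw [h1, real_inner_smul_left, abs_mul, abs_of_nonneg hp, mul_comm]
  exact mul_le_mul_of_nonneg_right (abs_le.2 ⟨by linarith, h2⟩) hp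

/-- With high probability the couplings are tame. -/
lemma exists_measure_not_tame_le (P : ℕ) (c : ℕ → ℝ) : ∃ C : ℝ, 0 ≤ C ∧ ∀ N : ℕ, 1 ≤ N →
    stdGaussian (EuclideanSpace ℝ (GIdx N P)) {g | ¬ Tame c C g} ≤ ENNReal.ofReal (2 * P / N) := by
  refine ⟨∑ k : {k : ℕ // k ∈ Finset.Icc 2 P}, |c k| * (((k : ℝ) ^ 3 + 1) * k * 2 ^ (k : ℕ)),
    by positivity, fun N hN => ?_⟩
  set bad : {k : ℕ // k ∈ Finset.Icc 2 P} → Set (EuclideanSpace ℝ (GIdx N P)) := fun k =>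
    {g | ∃ x : Fin (k : ℕ) → EuclideanSpace ℝ (Fin N), (∀ l, ‖x l‖ ≤ 1) ∧
        √N * ((k : ℝ) ^ 3 + 1) < inner ℝ (tens N k x) g} with hbad
  have hsub : {g : EuclideanSpace ℝ (GIdx N P) | ¬ Tame c
      (∑ k : {k : ℕ // k ∈ Finset.Icc 2 P}, |c k| * (((k : ℝ) ^ 3 + 1) * k * 2 ^ (k : ℕ))) g} ⊆
      ⋃ k, bad k := by
    intro g hg
    by_contra hg'
    rw [Set.mem_iUnion] at hg'
    push Not at hg'
    refine hg fun x y hx hy => ?_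
    have hk : ∀ k : {k : ℕ // k ∈ Finset.Icc 2 P},
        |inner ℝ (tens N k fun _ => x) g - inner ℝ (tens N k fun _ => y) g| ≤
        √N * ((k : ℝ) ^ 3 + 1) * k * 2 ^ (k : ℕ) * ‖x - y‖ := by
      intro k
      have h1 : ∀ x : Fin (k : ℕ) → EuclideanSpace ℝ (Fin N), (∀ l, ‖x l‖ ≤ 1) →
          inner ℝ (tens N k x) g ≤ √N * ((k : ℝ) ^ 3 + 1) := by
        intro z hz
        by_contra hlt
        exact hg' k ⟨z, hz, not_le.1 hlt⟩
      have hk2 : 2 ≤ (k : ℕ) := (Finset.mem_Icc.1 k.2).1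
      have : Nonempty (Fin (k : ℕ)) := ⟨⟨0, by omega⟩⟩
      have h2 := ((innerSL ℝ g).toLinearMap.compMultilinearMap
        (tens N k)).norm_image_sub_le_of_bound (C := √N * ((k : ℝ) ^ 3 + 1)) (by positivity)
        (fun m => by simpa [real_inner_comm] using abs_inner_tens_le h1 m)
        (fun _ => x) (fun _ => y)
      have h3 : (fun _ : Fin (k : ℕ) => x) - (fun _ => y) = fun _ => x - y := rfl
      rw [h3, pi_norm_const, pi_norm_const, pi_norm_const, Fintype.card_fin] at h2
      have h4 : max ‖x‖ ‖y‖ ^ ((k : ℕ) - 1) ≤ 2 ^ (k : ℕ) :=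
        (pow_le_pow_left₀ (le_max_of_le_left (norm_nonneg _)) (max_le hx hy) _).trans
          (pow_le_pow_right₀ one_le_two (Nat.sub_le _ _))
      have h5 : |inner ℝ (tens N k fun _ => x) g - inner ℝ (tens N k fun _ => y) g| ≤
          √N * ((k : ℝ) ^ 3 + 1) * k * max ‖x‖ ‖y‖ ^ ((k : ℕ) - 1) * ‖x - y‖ := by
        simpa [real_inner_comm] using h2
      refine h5.trans ?_
      gcongr
    rw [feat_eq_sum_tens, feat_eq_sum_tens, sum_inner, sum_inner, ← Finset.sum_sub_distrib,
      Finset.sum_mul, Finset.sum_mul]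
    refine (Finset.abs_sum_le_sum_abs _ _).trans (Finset.sum_le_sum fun k _ => ?_)
    rw [real_inner_smul_left, real_inner_smul_left, ← mul_sub, abs_mul]
    refine (mul_le_mul_of_nonneg_left (hk k) (abs_nonneg _)).trans (le_of_eq ?_)
    ring
  refine (measure_mono hsub).trans ((measure_iUnion_le _).trans ?_)
  rw [tsum_fintype]
  refine (Finset.sum_le_sum fun k _ => measure_tens_gt_le hN k).trans ?_
  rw [Finset.sum_const, nsmul_eq_mul, ← ENNReal.ofReal_natCast, ← ENNReal.ofReal_mul (by positivity)]
  refine ENNReal.ofReal_le_ofReal ?_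
  rw [mul_div_assoc', mul_comm (2 : ℝ)]
  gcongr
  simp

end Tame

section GramCorrection

variable {E : Type*} [NormedAddCommGroup E] [InnerProductSpace ℝ E] [FiniteDimensional ℝ E]
variable {U : Type*} [Fintype U] [DecidableEq U]

open scoped MatrixOrder in
lemma exists_factor_of_diagonally_dominant {κ : ℝ} (A : U → U → ℝ) (hA : ∀ u v, A u v = A v u)
    (hκ : ∀ u v, |A u v| ≤ κ) : ∃ B : U → U → ℝ, ∀ u v,
      ∑ i, B i u * B i v = A u v + if u = v then Fintype.card U * κ else 0 := by
  set M : Matrix U U ℝ := Matrix.of fun u v =>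
    A u v + if u = v then Fintype.card U * κ else 0 with hM
  have hpsd : M.PosSemidef := by
    rw [Matrix.posSemidef_iff_dotProduct_mulVec]
    refine ⟨Matrix.IsHermitian.ext fun u v => by simp [hM, hA u v, eq_comm], fun x => ?_⟩
    have h1 : star x ⬝ᵥ (M.mulVec x) =
        (∑ u, ∑ v, x u * x v * A u v) + Fintype.card U * κ * ∑ u, x u ^ 2 := by
      simp only [dotProduct, Matrix.mulVec, hM, Matrix.of_apply, Pi.star_apply, star_trivial,
        Finset.mul_sum, ← Finset.sum_add_distrib]
      refine Finset.sum_congr rfl fun u _ => ?_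
      simp only [add_mul, mul_add, Finset.sum_add_distrib, ite_mul, mul_ite, zero_mul, mul_zero,
        Finset.sum_ite_eq, Finset.mem_univ, if_true]
      congr 1
      · exact Finset.sum_congr rfl fun v _ => by ring
      · ring
    rw [h1]
    have h2 : ∀ u v, -(κ * (|x u| * |x v|)) ≤ x u * x v * A u v := fun u v => by
      have := neg_abs_le (x u * x v * A u v)
      rw [abs_mul, abs_mul] at this
      nlinarith [hκ u v, mul_nonneg (abs_nonneg (x u)) (abs_nonneg (x v))]
    have h3 : -(κ * (∑ u, |x u|) ^ 2) ≤ ∑ u, ∑ v, x u * x v * A u v := by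
      rw [sq, Finset.sum_mul_sum, Finset.mul_sum, ← Finset.sum_neg_distrib]
      refine Finset.sum_le_sum fun u _ => ?_
      rw [Finset.mul_sum, ← Finset.sum_neg_distrib]
      exact Finset.sum_le_sum fun v _ => h2 u v
    have h4 : (∑ u, |x u|) ^ 2 ≤ Fintype.card U * ∑ u, x u ^ 2 := by
      have := sq_sum_le_card_mul_sum_sq (s := Finset.univ) (f := fun u => |x u|)
      simpa using this
    rcases isEmpty_or_nonempty U with hU | ⟨⟨u0⟩⟩
    · simp
    have hκ0 : 0 ≤ κ := (abs_nonneg _).trans (hκ u0 u0)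
    nlinarith [mul_le_mul_of_nonneg_left h4 hκ0]
  obtain ⟨B, hB⟩ := CStarAlgebra.nonneg_iff_eq_star_mul_self.mp hpsd.nonneg
  refine ⟨fun i u => B i u, fun u v => ?_⟩
  have := congrFun (congrFun hB u) v
  rw [Matrix.mul_apply] at this
  simpa [hM, Matrix.star_apply] using this.symm

/-- Vectors whose Gram matrix is close to a prescribed one can be moved slightly so that the
Gram matrix is exact up to a small multiple of the identity. -/
lemma exists_gram_correction {κ : ℝ} (x : U → E) (Q : U → U → ℝ) (hQ : ∀ u v, Q u v = Q v u)
    (hκ : ∀ u v, |inner ℝ (x u) (x v) - Q u v| ≤ κ)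
    (hU : 2 * Fintype.card U ≤ Module.finrank ℝ E) :
    ∃ z : U → E, (∀ u v, inner ℝ (z u) (z v) = Q u v + if u = v then Fintype.card U * κ else 0) ∧
      ∀ u, ‖z u - x u‖ ^ 2 ≤ (Fintype.card U + 1) * κ := by
  obtain ⟨B, hB⟩ := exists_factor_of_diagonally_dominant
    (fun u v => Q u v - inner ℝ (x u) (x v)) (fun u v => by rw [hQ, real_inner_comm])
    (fun u v => by rw [abs_sub_comm]; exact hκ u v)
  set W := Submodule.span ℝ (Set.range x)
  have h1 : Module.finrank ℝ W ≤ Fintype.card U := finrank_range_le_card x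
  have h2 := W.finrank_add_finrank_orthogonal
  have h3 : Fintype.card U ≤ Fintype.card (Fin (Module.finrank ℝ Wᗮ)) := by
    rw [Fintype.card_fin]; omega
  obtain ⟨ι⟩ := Function.Embedding.nonempty_of_card_le h3
  set e : U → E := fun i => ((stdOrthonormalBasis ℝ Wᗮ (ι i) : Wᗮ) : E) with he
  have hee : ∀ i j, inner ℝ (e i) (e j) = if i = j then 1 else 0 := fun i j => by
    have := (orthonormal_iff_ite.1 (stdOrthonormalBasis ℝ Wᗮ).orthonormal) (ι i) (ι j)
    rw [Submodule.coe_inner] at this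
    rw [he, this]
    simp [ι.injective.eq_iff]
  have hxe : ∀ u i, inner ℝ (x u) (e i) = 0 := fun u i =>
    (Submodule.mem_orthogonal W _).1 (stdOrthonormalBasis ℝ Wᗮ (ι i)).2 _
      (Submodule.subset_span ⟨u, rfl⟩)
  set a : U → E := fun u => ∑ i, B i u • e i with ha
  have hxa : ∀ u v, inner ℝ (x u) (a v) = 0 := fun u v => by
    simp [ha, inner_sum, real_inner_smul_right, hxe]
  have haa : ∀ u v, inner ℝ (a u) (a v) = ∑ i, B i u * B i v := fun u v => by
    simp [ha, inner_sum, sum_inner, real_inner_smul_right, real_inner_smul_left, hee, mul_comm]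
  refine ⟨fun u => x u + a u, fun u v => ?_, fun u => ?_⟩
  · rw [inner_add_left, inner_add_right, inner_add_right, hxa, real_inner_comm (x v) (a u), hxa,
      haa, hB]
    ring
  · rw [add_sub_cancel_left, ← real_inner_self_eq_norm_sq, haa, hB, if_pos rfl]
    have := neg_le_of_abs_le (hκ u u)
    linarith

end GramCorrection

section Chain

/-- A monotone sequence with small jumps can be sampled at few times with small increments. -/
lemma exists_coarse_chain {Q : ℕ → ℝ} {D h : ℕ} (hh : 1 ≤ h) {η ρ : ℝ}
    (hη : 0 ≤ η) (hρ : 0 ≤ ρ) (hj : ∀ j < D, Q (j + 1) ≤ Q j + ρ) (hD : Q D ≤ Q 0 + h * η) :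
    ∃ d : ℕ → ℕ, d 0 = 0 ∧ (∀ k, h ≤ k → d k = D) ∧ Monotone d ∧ (∀ k, d k ≤ D) ∧
      ∀ k, Q (d (k + 1)) - Q (d k) ≤ η + ρ := by
  classical
  set d : ℕ → ℕ := fun k =>
    if k = 0 then 0 else Nat.findGreatest (fun j => Q j ≤ Q 0 + k * η) D with hd
  have hd0 : d 0 = 0 := by simp [hd]
  have hdk : ∀ k, k ≠ 0 → d k = Nat.findGreatest (fun j => Q j ≤ Q 0 + k * η) D := fun k hk => by
    simp [hd, hk]
  have hle : ∀ k, d k ≤ D := fun k => by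
    simp only [hd]; split_ifs
    · exact Nat.zero_le _
    · exact Nat.findGreatest_le _
  have hspec : ∀ k, Q (d k) ≤ Q 0 + k * η := fun k => by
    by_cases hk : k = 0
    · subst hk; simp [hd0]
    · rw [hdk k hk]
      refine Nat.findGreatest_spec (P := fun j => Q j ≤ Q 0 + k * η) (Nat.zero_le D) ?_
      have : 0 ≤ (k : ℝ) * η := by positivity
      linarith
  have hmono : Monotone d := by
    refine monotone_nat_of_le_succ fun k => ?_
    rw [hdk (k + 1) k.succ_ne_zero]
    refine Nat.le_findGreatest (hle k) ((hspec k).trans ?_)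
    push_cast
    nlinarith
  refine ⟨d, hd0, fun k hk => ?_, hmono, hle, fun k => ?_⟩
  · rw [hdk k (by omega)]
    refine (Nat.findGreatest_le D).antisymm (Nat.le_findGreatest le_rfl (hD.trans ?_))
    have : (h : ℝ) ≤ k := by exact_mod_cast hk
    nlinarith
  · have h1 := hspec (k + 1)
    push_cast at h1
    by_cases hk : k = 0
    · subst hk
      rw [hd0]
      push_cast at h1
      linarith
    · by_cases hkD : d k = D
      · have : d (k + 1) = D := (hle _).antisymm (hkD ▸ hmono k.le_succ)
        rw [this, hkD]; linarith
      · have hlt : d k < D := lt_of_le_of_ne (hle k) hkD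
        have h2 : ¬ Q (d k + 1) ≤ Q 0 + k * η := by
          have hlt' : Nat.findGreatest (fun j => Q j ≤ Q 0 + k * η) D < d k + 1 := by
            rw [← hdk k hk]; omega
          exact Nat.findGreatest_is_greatest hlt' hlt
        have h3 := hj _ hlt
        linarith [not_le.1 h2]

end Chain

section Overlaps

variable {E : Type*} [NormedAddCommGroup E] [InnerProductSpace ℝ E]

lemma norm_sum_sq_le_of_inner_le {m : ℕ} {v : Fin m → E} {a : ℝ} (hv : ∀ i, ‖v i‖ ≤ 1)
    (ha : -1 ≤ a) (h : ∀ i j, i ≠ j → inner ℝ (v i) (v j) ≤ a) :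
    ‖∑ i, v i‖ ^ 2 ≤ (m : ℝ) ^ 2 * a + 2 * m := by
  rw [← real_inner_self_eq_norm_sq, sum_inner]
  have : ∀ i, inner ℝ (v i) (∑ j, v j) ≤ m * a + 2 := by
    intro i
    rw [inner_sum]
    calc ∑ j, inner ℝ (v i) (v j) ≤ ∑ j, (a + if i = j then 2 else 0) := by
          refine Finset.sum_le_sum fun j _ => ?_
          split_ifs with hij
          · subst hij
            rw [real_inner_self_eq_norm_sq]
            nlinarith [hv i, norm_nonneg (v i)]
          · simpa using h i j hij
      _ = m * a + 2 := by simp [Finset.sum_add_distrib]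
  calc ∑ i, inner ℝ (v i) (∑ j, v j) ≤ ∑ _i : Fin m, (m * a + 2) := Finset.sum_le_sum fun i _ => this i
    _ = _ := by simp; ring

variable {D K : ℕ} {y : (Fin D → Fin K) → E}

/-- Overlaps of words that agree exactly on the coordinates in `A` are within `r` of `Q`. -/
def PatternOverlap (y : (Fin D → Fin K) → E) (A : Fin D → Prop) (Q r : ℝ) : Prop :=
  ∀ w w' : Fin D → Fin K, (∀ d, A d → w d = w' d) → (∀ d, ¬ A d → w d < w' d) →
    |inner ℝ (y w) (y w') - Q| ≤ r

lemma PatternOverlap.inner_le {A : Fin D → Prop} {Q r : ℝ} (h : PatternOverlap y A Q r) {m : ℕ}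
    (W : Fin m → Fin D → Fin K) (hA : ∀ i j d, A d → W i d = W j d)
    (hA' : ∀ i j d, i < j → ¬ A d → W i d < W j d) (i j : Fin m) (hij : i ≠ j) :
    inner ℝ (y (W i)) (y (W j)) ≤ Q + r := by
  rcases lt_or_gt_of_ne hij with hlt | hlt
  · linarith [(abs_le.1 (h (W i) (W j) (hA i j) fun d => hA' i j d hlt)).2]
  · rw [real_inner_comm]
    linarith [(abs_le.1 (h (W j) (W i) (hA j i) fun d => hA' j i d hlt)).2]

lemma PatternOverlap.neg_one_le {A : Fin D → Prop} {Q r : ℝ} (h : PatternOverlap y A Q r)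
    (hy : ∀ w, ‖y w‖ ≤ 1) (hK : 2 ≤ K) : -1 ≤ Q + r := by
  classical
  have h1 := h (fun _ => ⟨0, by omega⟩) (fun d => if A d then ⟨0, by omega⟩ else ⟨1, by omega⟩)
    (fun d hd => by simp [hd]) (fun d hd => by simp [hd])
  have h2 := (abs_le.1 (abs_real_inner_le_norm (y fun _ => ⟨0, by omega⟩)
    (y fun d => if A d then ⟨0, by omega⟩ else ⟨1, by omega⟩))).1
  have h3 := mul_le_one₀ (hy fun _ => ⟨0, by omega⟩) (norm_nonneg _)
    (hy fun d => if A d then ⟨0, by omega⟩ else ⟨1, by omega⟩)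
  linarith [(abs_le.1 h1).2]

lemma PatternOverlap.le_of_subset {A A' : Fin D → Prop} {Q Q' r : ℝ} (h : PatternOverlap y A Q r)
    (h' : PatternOverlap y A' Q' r) (hAA' : ∀ d, A d → A' d) (hy : ∀ w, ‖y w‖ ≤ 1) {m : ℕ}
    (hm : 1 ≤ m) (hK : 2 * m ≤ K) : Q ≤ Q' + 2 * r + 2 / m := by
  classical
  have hm0 : (0 : ℝ) < m := by exact_mod_cast hm
  set W : Fin m → Fin D → Fin K := fun i d =>
    if A' d then ⟨0, by omega⟩ else ⟨i, by omega⟩ with hW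
  set W' : Fin m → Fin D → Fin K := fun i d =>
    if A d then ⟨0, by omega⟩ else if A' d then ⟨1, by omega⟩ else ⟨m + i, by omega⟩ with hW'
  have ha := h'.neg_one_le hy (by omega)
  have h1 := norm_sum_sq_le_of_inner_le (v := fun i => y (W i)) (fun i => hy _) ha
    (h'.inner_le W (fun i j d hd => by simp [hW, hd]) fun i j d hij hd => by simpa [hW, hd] using hij)
  have h2 := norm_sum_sq_le_of_inner_le (v := fun i => y (W' i)) (fun i => hy _) ha
    (h'.inner_le W' (fun i j d hd => by simp [hW', hd]) fun i j d hij hd => by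
      have hd' : ¬ A d := fun hA => hd (hAA' d hA)
      simpa [hW', hd, hd'] using hij)
  have h3 : ∀ i j, Q - r ≤ inner ℝ (y (W i)) (y (W' j)) := by
    intro i j
    have := (abs_le.1 (h (W i) (W' j) (fun d hd => by simp [hW, hW', hd, hAA' d hd]) fun d hd => by
      by_cases hd' : A' d
      · simp [hW, hW', hd, hd']
      · simp only [hW, hW', hd, hd', if_false, Fin.mk_lt_mk]
        omega)).1
    linarith
  have h4 : (m : ℝ) ^ 2 * (Q - r) ≤ inner ℝ (∑ i, y (W i)) (∑ j, y (W' j)) := by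
    rw [sum_inner]
    simp only [inner_sum]
    calc (m : ℝ) ^ 2 * (Q - r) = ∑ _i : Fin m, ∑ _j : Fin m, (Q - r) := by simp; ring
      _ ≤ _ := Finset.sum_le_sum fun i _ => Finset.sum_le_sum fun j _ => h3 i j
  have h5 := norm_sub_sq_real (∑ i, y (W i)) (∑ j, y (W' j))
  have h6 : 0 ≤ ‖∑ i, y (W i) - ∑ j, y (W' j)‖ ^ 2 := sq_nonneg _
  have h7 : 0 ≤ (m : ℝ) ^ 2 * (Q' + 2 * r + 2 / m - Q) := by
    have : (m : ℝ) ^ 2 * (2 / m) = 2 * m := by field_simp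
    nlinarith
  have := nonneg_of_mul_nonneg_right h7 (by positivity)
  linarith

lemma PatternOverlap.neg_le {A : Fin D → Prop} {Q r : ℝ} (h : PatternOverlap y A Q r)
    (hy : ∀ w, ‖y w‖ ≤ 1) {m : ℕ} (hm : 1 ≤ m) (hK : 2 * m ≤ K) : -(r + 2 / m) ≤ Q := by
  classical
  have hm0 : (0 : ℝ) < m := by exact_mod_cast hm
  set W : Fin m → Fin D → Fin K := fun i d =>
    if A d then ⟨0, by omega⟩ else ⟨i, by omega⟩ with hW
  have h1 := norm_sum_sq_le_of_inner_le (v := fun i => y (W i)) (fun i => hy _)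
    (h.neg_one_le hy (by omega))
    (h.inner_le W (fun i j d hd => by simp [hW, hd]) fun i j d hij hd => by simpa [hW, hd] using hij)
  have h7 : 0 ≤ (m : ℝ) ^ 2 * (Q + r + 2 / m) := by
    have : (m : ℝ) ^ 2 * (2 / m) = 2 * m := by field_simp
    nlinarith [sq_nonneg ‖∑ i, y (W i)‖]
  have := nonneg_of_mul_nonneg_right h7 (by positivity)
  linarith

lemma PatternOverlap.le_one {A : Fin D → Prop} {Q r : ℝ} (h : PatternOverlap y A Q r)
    (hy : ∀ w, ‖y w‖ ≤ 1) (hK : 2 ≤ K) : Q ≤ 1 + r := by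
  classical
  have h1 := h (fun _ => ⟨0, by omega⟩) (fun d => if A d then ⟨0, by omega⟩ else ⟨1, by omega⟩)
    (fun d hd => by simp [hd]) (fun d hd => by simp [hd])
  have h2 := (abs_le.1 (abs_real_inner_le_norm (y fun _ => ⟨0, by omega⟩)
    (y fun d => if A d then ⟨0, by omega⟩ else ⟨1, by omega⟩))).2
  have h3 := mul_le_one₀ (hy fun _ => ⟨0, by omega⟩) (norm_nonneg _)
    (hy fun d => if A d then ⟨0, by omega⟩ else ⟨1, by omega⟩)
  linarith [(abs_le.1 h1).1]

/-- Adding a coordinate of small influence to a pattern changes the overlap little. -/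
lemma PatternOverlap.abs_sub_le {A A' : Fin D → Prop} {Q Q' r ρ : ℝ} (h : PatternOverlap y A Q r)
    (h' : PatternOverlap y A' Q' r) (i : Fin D) (hAA' : ∀ d, A' d ↔ A d ∨ d = i)
    (hy : ∀ w, ‖y w‖ ≤ 1) (hK : 2 ≤ K)
    (hρ : ∀ w w' : Fin D → Fin K, (∀ d, d ≠ i → w d = w' d) → ‖y w - y w'‖ ≤ ρ) :
    |Q - Q'| ≤ 2 * r + ρ := by
  classical
  set w₀ : Fin D → Fin K := fun _ => ⟨0, by omega⟩
  set w₁ : Fin D → Fin K := fun d => if A d then ⟨0, by omega⟩ else ⟨1, by omega⟩ with hw₁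
  set w₂ : Fin D → Fin K := fun d => if A' d then ⟨0, by omega⟩ else ⟨1, by omega⟩ with hw₂
  have h1 := abs_le.1 (h w₀ w₁ (fun d hd => by simp [w₀, hw₁, hd]) (fun d hd => by simp [w₀, hw₁, hd]))
  have h2 := abs_le.1 (h' w₀ w₂ (fun d hd => by simp [w₀, hw₂, hd]) (fun d hd => by simp [w₀, hw₂, hd]))
  have h3 := hρ w₁ w₂ fun d hd => by simp [hw₁, hw₂, hAA', hd]
  have h4 := abs_real_inner_le_norm (y w₀) (y w₁ - y w₂)
  rw [inner_sub_right] at h4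
  have h5 : ‖y w₀‖ * ‖y w₁ - y w₂‖ ≤ ρ := by
    have := mul_le_mul (hy w₀) h3 (norm_nonneg _) zero_le_one
    linarith
  have h6 := abs_le.1 (h4.trans h5)
  rw [abs_le]
  constructor <;> linarith [h1.1, h1.2, h2.1, h2.2, h6.1, h6.2]

end Overlaps

section Labels

lemma exists_tree_labels (H K : ℕ) [NeZero K] :
    ∃ lab : ℕ → (Fin H → Fin K) → Fin (K ^ H),
      (∀ k u v, Agree k u v → lab k u = lab k v) ∧
      ∀ u v, (∀ k, ¬ Agree k u v → lab k u < lab k v) ∨ (∀ k, ¬ Agree k u v → lab k v < lab k u) := by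
  classical
  have hcard : Fintype.card (Lex (Fin H → Fin K)) = K ^ H := by
    rw [Fintype.card_lex]; simp
  set ι := (Fintype.orderIsoFinOfCardEq (Lex (Fin H → Fin K)) hcard).symm
  set tr : ℕ → (Fin H → Fin K) → Lex (Fin H → Fin K) :=
    fun k u => toLex fun i => if (i : ℕ) < k then u i else 0 with htr
  refine ⟨fun k u => ι (tr k u), fun k u v h => ?_, fun u v => ?_⟩
  · have : tr k u = tr k v := by
      refine congrArg toLex (funext fun i => ?_)
      split_ifs with hi
      · exact h i hi
      · rfl
    simp only [this]
  · have key : ∀ u v : Fin H → Fin K, toLex u < toLex v →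
        ∀ k, ¬ Agree k u v → ι (tr k u) < ι (tr k v) := by
      rintro u v ⟨i, hi, hlt⟩ k hk
      refine ι.strictMono ⟨i, fun j hj => ?_, ?_⟩
      · have := hi j hj
        simp only [Pi.toLex_apply] at this
        simp [htr, this]
      · have hik : (i : ℕ) < k := by
          by_contra hik
          exact hk fun j hj => hi j (show (j : ℕ) < i by omega)
        simp only [htr, Pi.toLex_apply, if_pos hik] at hlt ⊢
        exact hlt
    rcases lt_trichotomy (toLex u) (toLex v) with h | h | h
    · exact Or.inl (key u v h)
    · have huv : u = v := toLex.injective h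
      exact Or.inl fun k hk => absurd (huv ▸ agree_refl k u) hk
    · exact Or.inr fun k hk => key v u h k fun h' => hk h'.symm

end Labels

section Selection

lemma exists_perm_lt_card_iff {D : ℕ} (S : Finset (Fin D)) :
    ∃ σ : Equiv.Perm (Fin D), ∀ i, (σ i : ℕ) < S.card ↔ i ∈ S := by
  classical
  have hS : S.card ≤ D := by simpa using S.card_le_univ
  have hc : Fintype.card {i // i ∈ S} = Fintype.card {i : Fin D // (i : ℕ) < S.card} := by
    rw [Fintype.card_coe, Fintype.card_subtype, Fin.card_filter_val_lt]
    exact (min_eq_right hS).symm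
  set e := Fintype.equivOfCardEq hc
  refine ⟨e.extendSubtype, fun i => ⟨fun h => ?_, fun h => e.extendSubtype_mem i h⟩⟩
  by_contra hi
  exact e.extendSubtype_not_mem i hi h

lemma floor_mem_Icc {R : ℕ} {x : ℝ} (hx : |x| ≤ 1) :
    ⌊(R : ℝ) * x⌋ ∈ Set.Icc (-(R : ℤ)) (R : ℤ) := by
  obtain ⟨h1, h2⟩ := abs_le.1 hx
  have hR : (0 : ℝ) ≤ R := Nat.cast_nonneg R
  constructor
  · rw [Int.le_floor]; push_cast; nlinarith
  · have : (⌊(R : ℝ) * x⌋ : ℝ) ≤ (R : ℤ) := (Int.floor_le _).trans (by push_cast; nlinarith)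
    exact_mod_cast this

lemma abs_sub_floor_div_le {R : ℕ} (hR : 1 ≤ R) (x : ℝ) :
    |x - (⌊(R : ℝ) * x⌋ : ℝ) / R| ≤ 1 / R := by
  have hR0 : (0 : ℝ) < R := by exact_mod_cast hR
  have h1 := Int.floor_le ((R : ℝ) * x)
  have h2 := (Int.lt_floor_add_one ((R : ℝ) * x)).le
  have : x - (⌊(R : ℝ) * x⌋ : ℝ) / R = ((R : ℝ) * x - ⌊(R : ℝ) * x⌋) / R := by field_simp
  rw [this, abs_div, abs_of_pos hR0]
  gcongr
  rw [abs_le]; constructor <;> linarith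

/-- Among words over a large alphabet one finds a tree of words whose overlaps depend only on the
height of the last common ancestor, and whose overlaps increase by small steps along the tree. -/
lemma exists_tree_of_words (D H₁ H K j m R : ℕ) [NeZero K] (hH : H₁ ≤ H) (hH₁ : 1 ≤ H₁) (hm : 1 ≤ m)
    (hR : 1 ≤ R) : ∃ K' : ℕ, ∀ {E : Type} [NormedAddCommGroup E] [InnerProductSpace ℝ E]
      (y : (Fin D → Fin K') → E) (n₂ : (Fin D → Fin K') → ℝ) (B : (Fin D → Fin K') → Finset (Fin D))
      {ρ η : ℝ}, 0 ≤ ρ → 0 ≤ η → (∀ w, ‖y w‖ ≤ 1) → (∀ w, |n₂ w| ≤ 1) → (∀ w, (B w).card ≤ j) →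
      (∀ w w' i, (∀ d, d ≠ i → w d = w' d) → i ∉ B w → i ∉ B w' → ‖y w - y w'‖ ≤ ρ) →
      2 ≤ H₁ * η →
      ∃ (W : (Fin H → Fin K) → (Fin D → Fin K')) (d : ℕ → ℕ) (q : ℕ → ℝ) (Qe : ℝ),
        (∀ u v, Agree H₁ u v → W u = W v) ∧
        (∀ u v, (Finset.univ.filter fun i => W u i = W v i).card = d (cp u v)) ∧
        Monotone d ∧ (∀ k, d k ≤ D) ∧ d 0 ≤ j ∧ Monotone q ∧ 0 ≤ q 0 ∧
        (∀ k, q (k + 1) - q k ≤ η + (2 / R + ρ)) ∧ (∀ k, H₁ ≤ k → q k = q H₁) ∧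
        (∀ u v, |inner ℝ (y (W u)) (y (W v)) - q (cp u v)| ≤ 3 / R + 2 / m) ∧
        ∀ u, |n₂ (W u) - Qe| ≤ 1 / R := by
  classical
  have hR0 : (0 : ℝ) < R := by exact_mod_cast hR
  have hR1 : (1 : ℝ) ≤ R := by exact_mod_cast hR
  set L := max (K ^ H) (2 * m) with hL
  have hLm : 2 * m ≤ L := le_max_right _ _
  have hLK : K ^ H ≤ L := le_max_left _ _
  have hL2 : 2 ≤ L := by omega
  have : Nonempty (Set.Icc (-(R : ℤ)) (R : ℤ)) := ⟨⟨0, by constructor <;> simp⟩⟩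
  obtain ⟨K', hK'⟩ := exists_product_ramsey D
    (C := Set.Icc (-(R : ℤ)) (R : ℤ) × Finset (Fin D) × Set.Icc (-(R : ℤ)) (R : ℤ)) L
  refine ⟨K', fun {E} _ _ y n₂ B {ρ η} hρ hη hy hn₂ hB hyB hHη => ?_⟩
  have hin : ∀ w w', |inner ℝ (y w) (y w')| ≤ 1 := fun w w' =>
    (abs_real_inner_le_norm _ _).trans (mul_le_one₀ (hy w) (norm_nonneg _) (hy w'))
  obtain ⟨a, ha, hcol⟩ := hK' fun w w' =>
    (⟨_, floor_mem_Icc (R := R) (hin w w')⟩, B w, ⟨_, floor_mem_Icc (R := R) (hn₂ w)⟩)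
  choose col hcol using hcol
  set Q : (Fin D → Prop) → ℝ := fun A => ((col A).1 : ℤ) / R with hQ
  set y' : (Fin D → Fin L) → E := fun w => y fun d => a d (w d) with hy'
  have hy'1 : ∀ w, ‖y' w‖ ≤ 1 := fun w => hy _
  have hpat : ∀ A, PatternOverlap y' A (Q A) (1 / R) := by
    intro A w w' h1 h2
    have h3 := congrArg (fun c => ((c.1 : ℤ) : ℝ)) (hcol A w w' h1 h2)
    simp only at h3
    rw [hQ]
    simp only
    rw [← h3]
    exact abs_sub_floor_div_le hR _
  set S := (col fun _ => True).2.1 with hS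
  have hBS : ∀ w : Fin D → Fin L, B (fun d => a d (w d)) = S := fun w => by
    rw [hS, ← hcol (fun _ => True) w w (fun _ _ => rfl) (fun _ h => absurd trivial h)]
  set Qe : ℝ := (((col fun _ => True).2.2 : ℤ) : ℝ) / R with hQe
  have hnQ : ∀ w : Fin D → Fin L, |n₂ (fun d => a d (w d)) - Qe| ≤ 1 / R := fun w => by
    have h3 := congrArg (fun c => ((c.2.2 : ℤ) : ℝ))
      (hcol (fun _ => True) w w (fun _ _ => rfl) (fun _ h => absurd trivial h))
    simp only at h3
    rw [hQe, ← h3]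
    exact abs_sub_floor_div_le hR _
  have hSj : S.card ≤ j := by
    rw [← hBS fun _ => ⟨0, by omega⟩]; exact hB _
  have hSD : S.card ≤ D := by simpa using S.card_le_univ
  obtain ⟨σ, hσ⟩ := exists_perm_lt_card_iff S
  set A : ℕ → Fin D → Prop := fun i d => (σ d : ℕ) < S.card + i with hA
  set p : ℕ → ℝ := fun i => Q (A i) with hp
  have hpm : ∀ i i', i ≤ i' → p i ≤ p i' + 2 * (1 / R) + 2 / m := fun i i' h =>
    (hpat (A i)).le_of_subset (hpat (A i')) (fun d (hd : (σ d : ℕ) < S.card + i) =>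
      show (σ d : ℕ) < S.card + i' by omega) hy'1 hm hLm
  have hp0 : ∀ i, -(1 / R + 2 / m) ≤ p i := fun i => (hpat (A i)).neg_le hy'1 hm hLm
  have hp1 : ∀ i, p i ≤ 1 + 1 / R := fun i => (hpat (A i)).le_one hy'1 hL2
  have hpj : ∀ i < D - S.card, p (i + 1) ≤ p i + (2 / R + ρ) := by
    intro i hi
    have := (hpat (A i)).abs_sub_le (hpat (A (i + 1))) (ρ := ρ)
      (σ.symm ⟨S.card + i, by omega⟩) (fun d => by
        rw [Equiv.eq_symm_apply, Fin.ext_iff]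
        simp only [hA]
        omega) hy'1 hL2 (fun w w' h => by
        have hnot : σ.symm ⟨S.card + i, by omega⟩ ∉ S := by
          rw [← hσ]; simp
        refine hyB _ _ (σ.symm ⟨S.card + i, by omega⟩) (fun d hd => by rw [h d hd]) ?_ ?_ <;>
        rwa [hBS])
    have h2 : 2 * (1 / (R : ℝ)) = 2 / R := by ring
    linarith [(abs_le.1 this).1]
  set f : ℕ → ℝ := fun i => max 0 (p i) with hf
  set F : ℕ → ℝ := fun i => partialSups f i with hF
  have hFmono : Monotone F := (partialSups f).monotone
  have hF0 : 0 ≤ F 0 := (le_max_left 0 (p 0)).trans (le_partialSups f 0)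
  have hFp : ∀ i, p i ≤ F i := fun i => (le_max_right 0 (p i)).trans (le_partialSups f i)
  have h2m : 0 ≤ 2 / (m : ℝ) := by positivity
  have h1R : 0 ≤ 1 / (R : ℝ) := by positivity
  have hFp' : ∀ i, F i ≤ p i + (2 * (1 / R) + 2 / m) := fun i =>
    partialSups_le f i _ fun i' hi' => max_le (by linarith [hp0 i]) (by linarith [hpm i' i hi'])
  have hjump : 0 ≤ 2 / R + ρ := by positivity
  have hFj : ∀ i < D - S.card, F (i + 1) ≤ F i + (2 / R + ρ) := by
    intro i hi
    have h0 : F (i + 1) = max (F i) (f (i + 1)) := partialSups_add_one f i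
    have h0' : 0 ≤ F i := hF0.trans (hFmono (Nat.zero_le i))
    rw [h0]
    exact max_le (by linarith) (max_le (by linarith) (by linarith [hpj i hi, hFp i]))
  have hF2 : F (D - S.card) ≤ F 0 + H₁ * η := by
    have : F (D - S.card) ≤ 2 := partialSups_le f _ _ fun i _ => max_le zero_le_two (by
      have : 1 / (R : ℝ) ≤ 1 := by rw [div_le_one hR0]; exact hR1
      linarith [hp1 i])
    linarith
  obtain ⟨d', hd'0, hd'H, hd'm, hd'D, hd'q⟩ := exists_coarse_chain hH₁ hη hjump hFj hF2
  obtain ⟨lab, hlab, hlab'⟩ := exists_tree_labels H K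
  have hex : ∀ i : Fin D, ∃ k, (σ i : ℕ) < S.card + d' k := fun i =>
    ⟨H₁, by rw [hd'H H₁ le_rfl]; have := (σ i).2; omega⟩
  set lev : Fin D → ℕ := fun i => Nat.find (hex i) with hlev
  have hlev_iff : ∀ i k, lev i ≤ k ↔ (σ i : ℕ) < S.card + d' k := fun i k => by
    constructor
    · intro h
      have h1 : (σ i : ℕ) < S.card + d' (lev i) := Nat.find_spec (hex i)
      have h2 := hd'm h
      omega
    · exact fun h => Nat.find_min' (hex i) h
  have hlevH : ∀ i, lev i ≤ H₁ := fun i => (hlev_iff i H₁).2 (by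
    rw [hd'H H₁ le_rfl]; have := (σ i).2; omega)
  set W₀ : (Fin H → Fin K) → Fin D → Fin L := fun u i => Fin.castLE hLK (lab (lev i) u) with hW₀
  have hagree : ∀ (u v : Fin H → Fin K) i, Agree (lev i) u v ↔ A (d' (cp u v)) i := fun u v i =>
    (le_cp_iff ((hlevH i).trans hH)).symm.trans (hlev_iff i _)
  have heq : ∀ u v i, W₀ u i = W₀ v i ↔ A (d' (cp u v)) i := fun u v i => by
    rw [← hagree]
    refine ⟨fun h => ?_, fun h => by simp only [hW₀, hlab _ _ _ h]⟩
    by_contra hn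
    have h1 : lab (lev i) u = lab (lev i) v := Fin.castLE_injective hLK h
    rcases hlab' u v with h2 | h2
    · exact absurd h1 (h2 _ hn).ne
    · exact absurd h1 (h2 _ hn).ne'
  refine ⟨fun u i => a i (W₀ u i), fun k => S.card + d' k, fun k => F (d' k), Qe,
    fun u v h => ?_, fun u v => ?_, fun k l h => ?_, fun k => ?_, ?_, hFmono.comp hd'm, ?_, hd'q,
    fun k hk => ?_, fun u v => ?_, fun u => hnQ _⟩
  · funext i
    simp only [hW₀, hlab _ _ _ (h.mono (hlevH i))]
  · simp only [(ha _).injective.eq_iff, heq, hA]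
    have : (Finset.univ.filter fun i => (σ i : ℕ) < S.card + d' (cp u v)).card =
        (Finset.univ.filter fun i : Fin D => (i : ℕ) < S.card + d' (cp u v)).card :=
      Finset.card_bijective σ σ.bijective (by simp)
    rw [this, Fin.card_filter_val_lt]
    have := hd'D (cp u v)
    omega
  · have := hd'm h
    simp only
    omega
  · have := hd'D k
    simp only
    omega
  · simpa [hd'0] using hSj
  · simpa [hd'0] using hF0
  · simp only [hd'H k hk, hd'H H₁ le_rfl]
  · have h1 : |inner ℝ (y' (W₀ u)) (y' (W₀ v)) - p (d' (cp u v))| ≤ 1 / R := by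
      rcases hlab' u v with h2 | h2
      · exact hpat _ _ _ (fun i hi => (heq u v i).2 hi) fun i hi =>
          h2 _ fun h => hi ((hagree u v i).1 h)
      · rw [real_inner_comm]
        exact hpat _ _ _ (fun i hi => ((heq u v i).2 hi).symm) fun i hi =>
          h2 _ fun h => hi ((hagree u v i).1 h)
    have h3 := hFp (d' (cp u v))
    have h4 := hFp' (d' (cp u v))
    have h5 : 3 / (R : ℝ) = 3 * (1 / R) := by ring
    rw [abs_le] at h1 ⊢
    rw [h5]
    constructor <;> simp only <;> linarith [h1.1, h1.2]

end Selection

section Correlation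

variable {V E : Type*} [NormedAddCommGroup V] [InnerProductSpace ℝ V] [FiniteDimensional ℝ V]
  [MeasurableSpace V] [BorelSpace V]
  [NormedAddCommGroup E] [InnerProductSpace ℝ E] [FiniteDimensional ℝ E]
  [MeasurableSpace E] [BorelSpace E]

/-- The mean overlap of the values of `f` at two noisy points, the noises having correlation `r`. -/
def noiseCorr (f : V → E) (τ : ℝ) (b b' : V) (r : ℝ) : ℝ :=
  ∫ p, inner ℝ (f (b + τ • p.1)) (f (b' + τ • (r • p.1 + √(1 - r ^ 2) • p.2)))
    ∂((stdGaussian V).prod (stdGaussian V))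

variable {f : V → E} {L : ℝ≥0}

lemma abs_inner_le_one (hb : ∀ x, ‖f x‖ ≤ 1) (x y : V) : |inner ℝ (f x) (f y)| ≤ 1 :=
  (abs_real_inner_le_norm _ _).trans (mul_le_one₀ (hb x) (norm_nonneg _) (hb y))

lemma continuous_noiseCorr (hf : Continuous f) (hb : ∀ x, ‖f x‖ ≤ 1) (τ : ℝ) (b b' : V) :
    Continuous (noiseCorr f τ b b') := by
  unfold noiseCorr
  refine continuous_of_dominated (bound := fun _ => 1) (fun r => ?_) (fun r => ?_)
    (integrable_const _) ?_
  · exact Continuous.aestronglyMeasurable (by fun_prop)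
  · exact Eventually.of_forall fun p => abs_inner_le_one hb _ _
  · exact Eventually.of_forall fun p => by fun_prop

lemma integrable_smooth (hf : Continuous f) (hb : ∀ x, ‖f x‖ ≤ 1) (τ : ℝ) (b : V) :
    Integrable (fun ω => f (b + τ • ω)) (stdGaussian V) :=
  integrable_of_bounded (by fun_prop) fun _ => hb _

lemma noiseCorr_zero (hf : Continuous f) (hb : ∀ x, ‖f x‖ ≤ 1) (τ : ℝ) (b b' : V) :
    noiseCorr f τ b b' 0 = inner ℝ (smooth f τ b) (smooth f τ b') := by
  unfold noiseCorr smooth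
  simp only [zero_smul, zero_add, ne_eq, OfNat.ofNat_ne_zero, not_false_eq_true, zero_pow, sub_zero,
    Real.sqrt_one, one_smul]
  rw [integral_prod _ (integrable_of_bounded (B := 1) (by fun_prop)
    fun p => abs_inner_le_one hb _ _)]
  simp_rw [integral_inner (integrable_smooth hf hb τ b')]
  simp_rw [real_inner_comm _ (f _)]
  rw [integral_inner (integrable_smooth hf hb τ b), real_inner_comm]

lemma noiseCorr_one (τ : ℝ) (b : V) :
    noiseCorr f τ b b 1 = ∫ ω, ‖f (b + τ • ω)‖ ^ 2 ∂(stdGaussian V) := by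
  unfold noiseCorr
  simp only [one_smul, one_pow, sub_self, Real.sqrt_zero, zero_smul, add_zero,
    real_inner_self_eq_norm_sq]
  rw [integral_fun_fst (fun ω => ‖f (b + τ • ω)‖ ^ 2)]
  simp

lemma noiseCorr_zero_le_one (hf : Continuous f) (hb : ∀ x, ‖f x‖ ≤ 1) (τ : ℝ) (b : V) :
    noiseCorr f τ b b 0 ≤ noiseCorr f τ b b 1 := by
  rw [noiseCorr_zero hf hb, noiseCorr_one, real_inner_self_eq_norm_sq]
  have h1 : Integrable (fun ω => ‖f (b + τ • ω)‖ ^ 2) (stdGaussian V) :=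
    integrable_of_bounded (B := 1) (by fun_prop) fun x => by
      rw [Real.norm_eq_abs, abs_of_nonneg (sq_nonneg _)]
      exact pow_le_one₀ (norm_nonneg _) (hb _)
  have h2 : Integrable (fun ω => inner ℝ (smooth f τ b) (f (b + τ • ω))) (stdGaussian V) :=
    (integrable_smooth hf hb τ b).const_inner _
  have h3 : ∫ ω, inner ℝ (smooth f τ b) (f (b + τ • ω)) ∂(stdGaussian V) = ‖smooth f τ b‖ ^ 2 := by
    rw [integral_inner (integrable_smooth hf hb τ b), ← real_inner_self_eq_norm_sq]; rfl
  have h4 : 0 ≤ ∫ ω, ‖f (b + τ • ω) - smooth f τ b‖ ^ 2 ∂(stdGaussian V) :=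
    integral_nonneg fun _ => sq_nonneg _
  have h5 : ∀ ω, ‖f (b + τ • ω) - smooth f τ b‖ ^ 2 =
      ‖f (b + τ • ω)‖ ^ 2 - 2 * inner ℝ (smooth f τ b) (f (b + τ • ω)) + ‖smooth f τ b‖ ^ 2 :=
    fun ω => by rw [norm_sub_sq_real, real_inner_comm]
  simp_rw [h5] at h4
  have h6 : Integrable (fun ω => ‖f (b + τ • ω)‖ ^ 2 -
      2 * inner ℝ (smooth f τ b) (f (b + τ • ω))) (stdGaussian V) := h1.sub (h2.const_mul 2)
  rw [integral_add h6 (integrable_const _),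
    integral_sub h1 (h2.const_mul 2), integral_const_mul, h3] at h4
  simp only [integral_const, probReal_univ, one_smul] at h4
  linarith

/-- Preimages of a monotone sequence under a continuous function can be chosen monotonically. -/
lemma exists_monotone_preimages {χ : ℝ → ℝ} (hχ : Continuous χ) {T : ℕ → ℝ} (hT : Monotone T)
    (h0 : χ 0 ≤ T 0) (h1 : ∀ k, T k ≤ χ 1) :
    ∃ r : ℕ → ℝ, Monotone r ∧ (∀ k, r k ∈ Set.Icc (0 : ℝ) 1) ∧ ∀ k, χ (r k) = T k := by
  have step : ∀ k, ∀ x : {x : ℝ // x ∈ Set.Icc (0 : ℝ) 1 ∧ χ x ≤ T k},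
      ∃ y : {y : ℝ // y ∈ Set.Icc (0 : ℝ) 1 ∧ χ y = T k}, x.1 ≤ y.1 := by
    intro k x
    obtain ⟨y, hy, hyx⟩ := intermediate_value_Icc x.2.1.2 hχ.continuousOn ⟨x.2.2, h1 k⟩
    exact ⟨⟨y, ⟨x.2.1.1.trans hy.1, hy.2⟩, hyx⟩, hy.1⟩
  choose g hg using step
  let s : (k : ℕ) → {y : ℝ // y ∈ Set.Icc (0 : ℝ) 1 ∧ χ y = T k} := fun k =>
    Nat.rec (g 0 ⟨0, by simp, h0⟩)
      (fun k y => g (k + 1) ⟨y.1, y.2.1, y.2.2.le.trans (hT (Nat.le_succ k))⟩) k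
  exact ⟨fun k => (s k).1, monotone_nat_of_le_succ fun k =>
    hg (k + 1) ⟨(s k).1, (s k).2.1, (s k).2.2.le.trans (hT (Nat.le_succ k))⟩, fun k => (s k).2.1,
    fun k => (s k).2.2⟩

variable {H K : ℕ} [NeZero K]

/-- Truncation of a leaf at height `h`. -/
def trunc (h : ℕ) (u : Fin H → Fin K) : Fin H → Fin K := fun i => if (i : ℕ) < h then u i else 0

lemma trunc_eq_iff {h : ℕ} {u v : Fin H → Fin K} : trunc h u = trunc h v ↔ Agree h u v := by
  constructor
  · intro e i hi
    simpa [trunc, hi] using congrFun e i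
  · intro e
    funext i
    by_cases hi : (i : ℕ) < h
    · simp [trunc, hi, e i hi]
    · simp [trunc, hi]

/-- Noises on the leaves of a tree can be correlated so as to achieve prescribed mean overlaps. -/
lemma exists_tree_noise (hf : Continuous f) (hb : ∀ x, ‖f x‖ ≤ 1) (τ : ℝ) {H₁ : ℕ}
    (hH : H₁ < H) (b : (Fin H → Fin K) → V) (hbA : ∀ u v, Agree H₁ u v → b u = b v)
    {Q : ℕ → ℝ} (hQ : Monotone Q) {κ : ℝ}
    (hκ : ∀ u v, |inner ℝ (smooth f τ (b u)) (smooth f τ (b v)) - Q (min (cp u v) H₁)| ≤ κ)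
    (hκ' : ∀ u, |noiseCorr f τ (b u) (b u) 1 - Q H| ≤ κ) :
    ∃ M : (Fin H → Fin K) → ((Fin H → Fin K) × (Fin (H + 1) × (Fin H → Fin K))) → ℝ,
      (∀ u, ∑ e, M u e ^ 2 = 1) ∧
      ∀ u v, |(∫ Z, inner ℝ (f (b u + τ • ∑ e, M u e • Z e)) (f (b v + τ • ∑ e, M v e • Z e))
        ∂(Measure.pi fun _ => stdGaussian V)) - Q (cp u v)| ≤ κ := by
  classical
  have hT : ∀ a : V, ∃ r : ℕ → ℝ, Monotone r ∧ (∀ k, r k ∈ Set.Icc (0 : ℝ) 1) ∧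
      ∀ k, noiseCorr f τ a a (r k) =
        max (noiseCorr f τ a a 0) (min (Q k) (noiseCorr f τ a a 1)) := fun a =>
    exists_monotone_preimages (continuous_noiseCorr hf hb τ a a)
      (fun k l h => max_le_max_left _ (min_le_min_right _ (hQ h))) (le_max_left _ _)
      fun k => max_le (noiseCorr_zero_le_one hf hb τ a) (min_le_right _ _)
  choose r hrm hr01 hr using hT
  set φ : V → ℕ → ℝ := fun a k => if k ≤ H₁ then 0 else if k < H then r a k else 1 with hφ
  have hφm : ∀ a, ∀ k < H, φ a k ≤ φ a (k + 1) := by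
    intro a k hk
    simp only [hφ]
    have h0 := (hr01 a (k + 1)).1
    have h1 := (hr01 a k).2
    have h2 := hrm a (Nat.le_succ k)
    split_ifs <;> first | omega | linarith
  have hφ0 : ∀ a, φ a 0 = 0 := fun a => by simp [hφ]
  have hφH : ∀ a, φ a H = 1 := fun a => by simp [hφ, hH]
  have hφ01 : ∀ a k, 0 ≤ φ a k ∧ φ a k ≤ 1 := fun a k => by
    simp only [hφ]
    have := hr01 a k
    split_ifs
    · simp
    · exact this
    · simp
  choose M hM using fun a : V => exists_tree_gram (K := K) (φ := φ a) (hφ0 a).ge (hφm a)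
  set M' : (Fin H → Fin K) → ((Fin H → Fin K) × (Fin (H + 1) × (Fin H → Fin K))) → ℝ :=
    fun u e => if e.1 = trunc H₁ u then M (b u) u e.2 else 0 with hM'
  have hsum : ∀ u v, ∑ e, M' u e * M' v e = φ (b u) (cp u v) := by
    intro u v
    rw [Fintype.sum_prod_type, Finset.sum_eq_single (trunc H₁ u)]
    · simp only [hM', if_true]
      by_cases huv : Agree H₁ u v
      · simp only [trunc_eq_iff.2 huv, if_true, ← hbA u v huv, hM]
      · have hcp : cp u v ≤ H₁ := by
          by_contra h
          exact huv ((le_cp_iff hH.le).1 (not_le.1 h).le)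
        simp [trunc_eq_iff, huv, hφ, hcp]
    · intro a _ ha
      simp [hM', ha]
    · simp
  have hsq : ∀ u, ∑ e, M' u e ^ 2 = 1 := fun u => by
    have h := hsum u u
    rw [cp_self, hφH] at h
    rw [← h]
    exact Finset.sum_congr rfl fun e _ => sq _
  refine ⟨M', hsq, fun u v => ?_⟩
  have hF : Continuous fun p : V × V => (inner ℝ (f (b u + τ • p.1)) (f (b v + τ • p.2)) : ℝ) := by
    fun_prop
  have h01 := hφ01 (b u) (cp u v)
  have key := integral_pi_pair (V := V) (α := M' u) (β := M' v) (a := 1) (c := φ (b u) (cp u v))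
    (d := √(1 - φ (b u) (cp u v) ^ 2)) (by rw [hsq]; simp) (by rw [hsum]; simp) (by
      rw [hsq, Real.sq_sqrt (by nlinarith)]; ring) hF
  simp only [one_smul] at key
  rw [key]
  change |noiseCorr f τ (b u) (b v) (φ (b u) (cp u v)) - Q (cp u v)| ≤ κ
  by_cases h1 : cp u v ≤ H₁
  · have : φ (b u) (cp u v) = 0 := by simp [hφ, h1]
    rw [this, noiseCorr_zero hf hb]
    simpa [min_eq_left h1] using hκ u v
  have hbuv : b u = b v := hbA u v ((le_cp_iff hH.le).1 (not_le.1 h1).le)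
  rw [← hbuv]
  by_cases h2 : cp u v < H
  · have : φ (b u) (cp u v) = r (b u) (cp u v) := by simp [hφ, h1, h2]
    rw [this, hr]
    have h3 := hκ u u
    rw [cp_self, min_eq_right hH.le, ← noiseCorr_zero hf hb] at h3
    have h4 := hκ' u
    have h5 := hQ (not_le.1 h1).le
    have h6 := hQ h2.le
    rw [abs_le] at h3 h4 ⊢
    constructor
    · have : Q (cp u v) - κ ≤ min (Q (cp u v)) (noiseCorr f τ (b u) (b u) 1) :=
        le_min (by linarith) (by linarith)
      linarith [le_max_right (noiseCorr f τ (b u) (b u) 0)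
        (min (Q (cp u v)) (noiseCorr f τ (b u) (b u) 1))]
    · rw [sub_le_iff_le_add]
      exact max_le (by linarith) ((min_le_left _ _).trans (by linarith))
  · have h3 : cp u v = H := le_antisymm (cp_le u v) (not_lt.1 h2)
    rw [h3, hφH]
    exact hκ' u

end Correlation

section LeafFields

variable {V E : Type*} [NormedAddCommGroup V] [InnerProductSpace ℝ V] [FiniteDimensional ℝ V]
  [MeasurableSpace V] [BorelSpace V]
  [NormedAddCommGroup E] [InnerProductSpace ℝ E] [FiniteDimensional ℝ E]
  [MeasurableSpace E] [BorelSpace E] {I : Type*} [Fintype I]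

lemma norm_combination_le {m : I → ℝ} (hm : ∑ e, m e ^ 2 = 1) (Z : PiLp 2 fun _ : I => V) :
    ‖∑ e, m e • Z e‖ ≤ ‖Z‖ := by
  have h1 : ‖∑ e, m e • Z e‖ ≤ ∑ e, |m e| * ‖Z e‖ :=
    (norm_sum_le _ _).trans (Finset.sum_le_sum fun e _ => by rw [norm_smul, Real.norm_eq_abs])
  have h2 := Finset.sum_mul_sq_le_sq_mul_sq Finset.univ (fun e => |m e|) fun e => ‖Z e‖
  simp only [sq_abs] at h2
  rw [hm, one_mul, ← PiLp.norm_sq_eq_of_L2] at h2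
  exact h1.trans (abs_le_of_sq_le_sq' h2 (norm_nonneg _)).2

lemma map_combination {m : I → ℝ} (hm : ∑ e, m e ^ 2 = 1) :
    (stdGaussian (PiLp 2 fun _ : I => V)).map (fun Z => ∑ e, m e • Z e) = stdGaussian V := by
  have h := map_pi_sum (V := V) (α := m) (a := 1) (by simpa using hm)
  rw [pi_stdGaussian_eq_map, Measure.map_map
    (Continuous.measurable (by fun_prop)) (PiLp.continuous_ofLp 2 (fun _ : I => V)).measurable] at h
  simpa [Function.comp_def] using h

lemma map_coordinate [DecidableEq I] (e : I) :
    (stdGaussian (PiLp 2 fun _ : I => V)).map (fun Z => Z e) = stdGaussian V := by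
  simpa [Pi.single_apply] using
    map_combination (V := V) (m := Pi.single e (1 : ℝ)) (by simp [Pi.single_apply])

variable {f : V → E} {L : ℝ≥0}

lemma dist_noise_le {m : I → ℝ} (hm : ∑ e, m e ^ 2 = 1) {τ : ℝ} (hτ : 0 ≤ τ) (b : V)
    (Z Z' : PiLp 2 fun _ : I => V) :
    dist (b + τ • ∑ e, m e • Z e) (b + τ • ∑ e, m e • Z' e) ≤ τ * dist Z Z' := by
  rw [dist_add_left, dist_smul₀, Real.norm_eq_abs, abs_of_nonneg hτ, dist_eq_norm, dist_eq_norm,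
    ← Finset.sum_sub_distrib]
  simp_rw [← smul_sub]
  exact mul_le_mul_of_nonneg_left (norm_combination_le hm (Z - Z')) hτ

lemma abs_inner_sub_inner_le {E : Type*} [NormedAddCommGroup E] [InnerProductSpace ℝ E]
    {x y x' y' : E} (hx' : ‖x'‖ ≤ 1) (hy : ‖y‖ ≤ 1) :
    |inner ℝ x y - inner ℝ x' y'| ≤ ‖x - x'‖ + ‖y - y'‖ := by
  have h3 : inner ℝ x y - inner ℝ x' y' = inner ℝ (x - x') y + inner ℝ x' (y - y') := by
    rw [inner_sub_left, inner_sub_right]; ring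
  rw [h3]
  have h4 := abs_real_inner_le_norm (x - x') y
  have h5 := abs_real_inner_le_norm x' (y - y')
  have h6 : ‖x - x'‖ * ‖y‖ ≤ ‖x - x'‖ := mul_le_of_le_one_right (norm_nonneg _) hy
  have h7 : ‖x'‖ * ‖y - y'‖ ≤ ‖y - y'‖ := mul_le_of_le_one_left (norm_nonneg _) hx'
  have := abs_add_le (inner ℝ (x - x') y) (inner ℝ x' (y - y'))
  linarith

lemma lipschitzWith_overlap (hf : LipschitzWith L f) (hb : ∀ x, ‖f x‖ ≤ 1) {m m' : I → ℝ}
    (hm : ∑ e, m e ^ 2 = 1) (hm' : ∑ e, m' e ^ 2 = 1) {τ : ℝ} (hτ : 0 ≤ τ) (b b' : V) :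
    LipschitzWith (2 * L * τ.toNNReal) fun Z : PiLp 2 fun _ : I => V =>
      (inner ℝ (f (b + τ • ∑ e, m e • Z e)) (f (b' + τ • ∑ e, m' e • Z e)) : ℝ) := by
  refine LipschitzWith.of_dist_le_mul fun Z Z' => ?_
  have h1 := (hf.dist_le_mul _ _).trans (mul_le_mul_of_nonneg_left
    (dist_noise_le hm hτ b Z Z') L.coe_nonneg)
  have h2 := (hf.dist_le_mul _ _).trans (mul_le_mul_of_nonneg_left
    (dist_noise_le hm' hτ b' Z Z') L.coe_nonneg)
  rw [dist_eq_norm] at h1 h2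
  push_cast
  rw [Real.coe_toNNReal _ hτ, Real.dist_eq]
  have h3 := abs_inner_sub_inner_le (x := f (b + τ • ∑ e, m e • Z e))
    (y := f (b' + τ • ∑ e, m' e • Z e)) (x' := f (b + τ • ∑ e, m e • Z' e))
    (y' := f (b' + τ • ∑ e, m' e • Z' e)) (hb _) (hb _)
  linarith

/-- If a Gaussian point hits a set with a fair probability, then it is typically close to it. -/
lemma measure_infDist_ge_le {m : I → ℝ} (hm : ∑ e, m e ^ 2 = 1) {τ : ℝ} (hτ : 0 ≤ τ) (b : V)
    {S₀ : Set V} (hS : MeasurableSet S₀) {p r : ℝ} (hp : 0 < p) (hr : 0 < r)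
    (hpS : p ≤ (stdGaussian V).real {ω | b + τ • ω ∈ S₀}) (hpr : 8 * τ ^ 2 ≤ p * r ^ 2) :
    stdGaussian (PiLp 2 fun _ : I => V)
      {Z | r ≤ Metric.infDist (b + τ • ∑ e, m e • Z e) S₀} ≤ ENNReal.ofReal (8 * τ ^ 2 / r ^ 2) := by
  set F : (PiLp 2 fun _ : I => V) → ℝ := fun Z => Metric.infDist (b + τ • ∑ e, m e • Z e) S₀ with hF
  have hL : LipschitzWith τ.toNNReal F := by
    refine LipschitzWith.of_dist_le_mul fun Z Z' => ?_
    rw [Real.coe_toNNReal _ hτ]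
    have := (Metric.lipschitz_infDist_pt S₀).dist_le_mul (b + τ • ∑ e, m e • Z e)
      (b + τ • ∑ e, m e • Z' e)
    rw [NNReal.coe_one, one_mul] at this
    exact this.trans (dist_noise_le hm hτ b Z Z')
  set μ := ∫ Z, F Z ∂(stdGaussian (PiLp 2 fun _ : I => V)) with hμ
  have hmean : μ ≤ r / 2 := by
    by_contra hlt
    push Not at hlt
    have hμ0 : 0 < μ := by linarith
    have h1 := measure_abs_sub_ge_le_of_lipschitz hL hμ0
    rw [← hμ, Real.coe_toNNReal _ hτ] at h1
    have h2 : (stdGaussian V) {ω | b + τ • ω ∈ S₀} ≤ stdGaussian (PiLp 2 fun _ : I => V)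
        {g | μ ≤ |F g - μ|} := by
      have h3 : MeasurableSet {ω : V | b + τ • ω ∈ S₀} :=
        (Continuous.measurable (by fun_prop : Continuous fun ω : V => b + τ • ω)) hS
      have h4 : Measurable fun Z : PiLp 2 fun _ : I => V => ∑ e, m e • Z e :=
        Continuous.measurable (by fun_prop)
      rw [← map_combination (V := V) hm, Measure.map_apply h4 h3]
      refine measure_mono fun Z hZ => ?_
      have h0 : F Z = 0 := Metric.infDist_zero_of_mem hZ
      change μ ≤ |F Z - μ|
      rw [h0, zero_sub, abs_neg, abs_of_pos hμ0]
    have h3 : p ≤ 2 * τ ^ 2 / μ ^ 2 :=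
      hpS.trans (ENNReal.toReal_le_of_le_ofReal (by positivity) (h2.trans h1))
    rw [le_div_iff₀ (by positivity)] at h3
    have h4 : (r / 2) ^ 2 < μ ^ 2 := by gcongr
    nlinarith
  refine le_trans (measure_mono ?_) ((measure_abs_sub_ge_le_of_lipschitz hL (half_pos hr)).trans ?_)
  · intro Z (hZ : r ≤ F Z)
    change r / 2 ≤ |F Z - μ|
    exact le_trans (by linarith) (le_abs_self _)
  · rw [Real.coe_toNNReal _ hτ]
    refine ENNReal.ofReal_le_ofReal (le_of_eq ?_)
    field_simp
    ring

lemma exists_leaf_fields {U : Type*} [Fintype U] (hf : LipschitzWith L f) (hb : ∀ x, ‖f x‖ ≤ 1)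
    {M : U → I → ℝ} (hM : ∀ u, ∑ e, M u e ^ 2 = 1) {τ : ℝ} (hτ : 0 ≤ τ) (b : U → V)
    {S₀ : Set V} (hS : MeasurableSet S₀) {p r κ δ : ℝ} (hp : 0 < p) (hr : 0 < r) (hκ : 0 < κ)
    (hpS : ∀ u, p ≤ (stdGaussian V).real {ω | b u + τ • ω ∈ S₀}) (hpr : 8 * τ ^ 2 ≤ p * r ^ 2)
    {T : Set V} (hT : stdGaussian V T ≤ ENNReal.ofReal δ) (hδ : 0 ≤ δ)
    (h₁ : (Fintype.card U : ℝ) ^ 2 * (8 * L ^ 2 * τ ^ 2 / κ ^ 2) < 1 / 4)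
    (h₂ : (Fintype.card U : ℝ) * (8 * τ ^ 2 / r ^ 2) < 1 / 4)
    (h₃ : (Fintype.card I : ℝ) * δ < 1 / 4) :
    ∃ Z : I → V, (∀ u v, |inner ℝ (f (b u + τ • ∑ e, M u e • Z e))
        (f (b v + τ • ∑ e, M v e • Z e)) -
        ∫ Z : I → V, inner ℝ (f (b u + τ • ∑ e, M u e • Z e)) (f (b v + τ • ∑ e, M v e • Z e))
          ∂(Measure.pi fun _ => stdGaussian V)| ≤ κ) ∧
      (∀ u, Metric.infDist (b u + τ • ∑ e, M u e • Z e) S₀ < r) ∧ ∀ e, Z e ∉ T := by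
  classical
  set μ := stdGaussian (PiLp 2 fun _ : I => V) with hμ
  set F : U → U → (I → V) → ℝ := fun u v Z =>
    inner ℝ (f (b u + τ • ∑ e, M u e • Z e)) (f (b v + τ • ∑ e, M v e • Z e)) with hF
  have hint : ∀ u v, ∫ Z, F u v Z ∂(Measure.pi fun _ => stdGaussian V) =
      ∫ Z, F u v (WithLp.ofLp Z) ∂μ := fun u v => by
    have := hf.continuous
    rw [pi_stdGaussian_eq_map, integral_map
      (PiLp.continuous_ofLp 2 (fun _ : I => V)).measurable.aemeasurable
      (Continuous.aestronglyMeasurable (by simp only [hF]; fun_prop))]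
  set X₁ : U → U → Set (PiLp 2 fun _ : I => V) := fun u v =>
    {Z | κ ≤ |F u v (WithLp.ofLp Z) - ∫ Z, F u v (WithLp.ofLp Z) ∂μ|} with hX₁
  set X₂ : U → Set (PiLp 2 fun _ : I => V) := fun u =>
    {Z | r ≤ Metric.infDist (b u + τ • ∑ e, M u e • Z e) S₀} with hX₂
  set X₃ : I → Set (PiLp 2 fun _ : I => V) := fun e => {Z | Z e ∈ T} with hX₃
  have m₁ : ∀ u v, μ (X₁ u v) ≤ ENNReal.ofReal (8 * L ^ 2 * τ ^ 2 / κ ^ 2) := fun u v => by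
    refine (measure_abs_sub_ge_le_of_lipschitz
      (lipschitzWith_overlap hf hb (hM u) (hM v) hτ (b u) (b v)) hκ).trans (le_of_eq ?_)
    push_cast
    rw [Real.coe_toNNReal _ hτ]
    ring_nf
  have m₂ : ∀ u, μ (X₂ u) ≤ ENNReal.ofReal (8 * τ ^ 2 / r ^ 2) := fun u =>
    measure_infDist_ge_le (hM u) hτ (b u) hS hp hr (hpS u) hpr
  have m₃ : ∀ e, μ (X₃ e) ≤ ENNReal.ofReal δ := fun e => by
    refine le_trans ?_ hT
    rw [← map_coordinate (V := V) e]
    exact Measure.le_map_apply (Continuous.aemeasurable (by fun_prop)) T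
  have hU : μ ((⋃ u, ⋃ v, X₁ u v) ∪ (⋃ u, X₂ u) ∪ ⋃ e, X₃ e) < 1 := by
    calc _ ≤ (∑ u, ∑ v, μ (X₁ u v)) + (∑ u, μ (X₂ u)) + ∑ e, μ (X₃ e) := by
          refine (measure_union_le _ _).trans (add_le_add ((measure_union_le _ _).trans
            (add_le_add ?_ (measure_iUnion_fintype_le _ _))) (measure_iUnion_fintype_le _ _))
          exact (measure_iUnion_fintype_le _ _).trans
            (Finset.sum_le_sum fun u _ => measure_iUnion_fintype_le _ _)
      _ ≤ (∑ _u : U, ∑ _v : U, ENNReal.ofReal (8 * L ^ 2 * τ ^ 2 / κ ^ 2)) +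
          (∑ _u : U, ENNReal.ofReal (8 * τ ^ 2 / r ^ 2)) + ∑ _e : I, ENNReal.ofReal δ := by
          gcongr with u _ v _ u _ e _
          · exact m₁ u v
          · exact m₂ u
          · exact m₃ e
      _ = ENNReal.ofReal ((Fintype.card U : ℝ) ^ 2 * (8 * L ^ 2 * τ ^ 2 / κ ^ 2) +
          (Fintype.card U : ℝ) * (8 * τ ^ 2 / r ^ 2) + (Fintype.card I : ℝ) * δ) := by
          simp only [Finset.sum_const, Finset.card_univ, nsmul_eq_mul]
          rw [ENNReal.ofReal_add (by positivity) (by positivity),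
            ENNReal.ofReal_add (by positivity) (by positivity), sq (Fintype.card U : ℝ),
            mul_assoc (Fintype.card U : ℝ)]
          repeat rw [ENNReal.ofReal_mul (Nat.cast_nonneg _)]
          simp only [ENNReal.ofReal_natCast]
      _ < 1 := by
          rw [← ENNReal.ofReal_one]
          exact (ENNReal.ofReal_lt_ofReal_iff one_pos).2 (by linarith)
  obtain ⟨Z, hZ⟩ : ∃ Z, Z ∉ (⋃ u, ⋃ v, X₁ u v) ∪ (⋃ u, X₂ u) ∪ ⋃ e, X₃ e := by
    by_contra! h
    rw [Set.eq_univ_of_forall h, measure_univ] at hU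
    exact lt_irrefl _ hU
  simp only [Set.mem_union, Set.mem_iUnion, not_or, not_exists] at hZ
  refine ⟨WithLp.ofLp Z, fun u v => ?_, fun u => not_le.1 (hZ.1.2 u), fun e => hZ.2 e⟩
  have := hint u v
  simp only [hF] at this
  rw [this]
  exact (not_le.1 (hZ.1.1 u v)).le

end LeafFields

section EnergeticTree

lemma le_measure_forall_words {V : Type*} [NormedAddCommGroup V] [InnerProductSpace ℝ V]
    [FiniteDimensional ℝ V] [MeasurableSpace V] [BorelSpace V] (K D : ℕ) {good : Set (Fin D → V)}
    (hgood : MeasurableSet good) :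
    ((Measure.pi fun _ : Fin D => stdGaussian V) good) ^ (K ^ D) ≤
      stdGaussian (PiLp 2 fun _ : Fin D × Fin K => V)
        {Z | ∀ w : Fin D → Fin K, (fun d => Z (d, w d)) ∈ good} := by
  refine (pow_le_measure_forall_words (stdGaussian V) K D good hgood).trans ?_
  have hms : MeasurableSet {Z : Fin D → Fin K → V | ∀ w : Fin D → Fin K,
      (fun d => Z d (w d)) ∈ good} := by
    have h : {Z : Fin D → Fin K → V | ∀ w : Fin D → Fin K, (fun d => Z d (w d)) ∈ good} =
        ⋂ w : Fin D → Fin K, (fun Z : Fin D → Fin K → V => fun d => Z d (w d)) ⁻¹' good := by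
      ext Z; simp
    rw [h]
    refine MeasurableSet.iInter fun w => ?_
    exact (show Measurable fun Z : Fin D → Fin K → V => fun d => Z d (w d) by fun_prop) hgood
  have hc := Measure.infinitePi_map_curry (ι := Fin D) (κ := Fin K) (X := V)
    (fun _ _ => stdGaussian V)
  simp only [Measure.infinitePi_eq_pi] at hc
  rw [← hc, Measure.map_apply (MeasurableEquiv.measurable _) hms, pi_stdGaussian_eq_map,
    Measure.map_apply (PiLp.continuous_ofLp 2 (fun _ : Fin D × Fin K => V)).measurable
      ((MeasurableEquiv.measurable _) hms)]
  exact le_rfl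

/-- The overlap profile with values in a finite grid, raised by `s` at the leaves. -/
def gridProfile (H R : ℕ) (s : ℝ) (a : Fin (H + 1) → Fin (2 * R + 1)) (k : ℕ) : ℝ :=
  (a ⟨min k H, by omega⟩ : ℕ) / (R : ℝ) + if k < H then 0 else s

/-- The overlap profiles to which the bound on tree energies applies. -/
def IsProfile (H : ℕ) (η : ℝ) (q : ℕ → ℝ) : Prop :=
  (∀ k < H, q k ≤ q (k + 1)) ∧ 0 ≤ q 0 ∧ (∀ k < H, q (k + 1) - q k ≤ η) ∧ q H ≤ 1 + η

lemma exists_gridProfile {H R : ℕ} (hR : 1 ≤ R) {s η : ℝ} (hs : 0 ≤ s) {Q : ℕ → ℝ}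
    (hQ : Monotone Q) (hQ0 : 0 ≤ Q 0) (hQη : ∀ k, Q (k + 1) - Q k ≤ η / 2) (hQH : Q H ≤ 1 + η / 2)
    (hη1 : η ≤ 1) (hRη : 1 / (R : ℝ) ≤ η / 4) (hsη : s ≤ η / 4) :
    ∃ a : Fin (H + 1) → Fin (2 * R + 1), IsProfile H η (gridProfile H R s a) ∧
      ∀ k ≤ H, |Q k + (if k < H then 0 else s) - gridProfile H R s a k| ≤ 1 / R := by
  have hR0 : (0 : ℝ) < R := by exact_mod_cast hR
  have hQn : ∀ k, 0 ≤ Q k := fun k => hQ0.trans (hQ (Nat.zero_le k))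
  have hfl : ∀ k ≤ H, ⌊(R : ℝ) * Q k⌋₊ < 2 * R + 1 := fun k hk => by
    rw [Nat.lt_succ_iff]
    refine Nat.floor_le_of_le ?_
    push_cast
    have := hQ hk
    nlinarith
  set a : Fin (H + 1) → Fin (2 * R + 1) := fun k => ⟨⌊(R : ℝ) * Q k⌋₊, hfl k (by omega)⟩ with ha
  have hav : ∀ k ≤ H, gridProfile H R s a k = (⌊(R : ℝ) * Q k⌋₊ : ℝ) / R +
      if k < H then 0 else s := fun k hk => by
    simp [gridProfile, ha, min_eq_left hk]
  have hlo : ∀ k, (⌊(R : ℝ) * Q k⌋₊ : ℝ) / R ≤ Q k := fun k => by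
    rw [div_le_iff₀ hR0, mul_comm (Q k)]
    exact Nat.floor_le (mul_nonneg hR0.le (hQn k))
  have hhi : ∀ k, Q k ≤ (⌊(R : ℝ) * Q k⌋₊ : ℝ) / R + 1 / R := fun k => by
    rw [← add_div, le_div_iff₀ hR0, mul_comm (Q k)]
    exact (Nat.lt_floor_add_one _).le
  have hmon : ∀ k, (⌊(R : ℝ) * Q k⌋₊ : ℝ) / R ≤ (⌊(R : ℝ) * Q (k + 1)⌋₊ : ℝ) / R := fun k => by
    have := hQ (Nat.le_succ k)
    gcongr
  refine ⟨a, ⟨fun k hk => ?_, ?_, fun k hk => ?_, ?_⟩, fun k hk => ?_⟩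
  · rw [hav k hk.le, hav (k + 1) hk, if_pos hk]
    have := hmon k
    split_ifs <;> linarith
  · unfold gridProfile
    have : 0 ≤ (if 0 < H then 0 else s) := by split_ifs <;> simp [hs]
    positivity
  · rw [hav k hk.le, hav (k + 1) hk, if_pos hk]
    have h1 := hlo (k + 1)
    have h2 := hhi k
    have h3 := hQη k
    split_ifs <;> linarith
  · rw [hav H le_rfl]
    have h1 := hlo H
    simp only [lt_irrefl, if_false]
    linarith
  · rw [hav k hk, abs_le]
    have h1 := hlo k
    have h2 := hhi k
    have h3 : 0 ≤ 1 / (R : ℝ) := by positivity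
    constructor <;> linarith

variable {N P : ℕ} {c : ℕ → ℝ}

lemma norm_feat_le {x : EuclideanSpace ℝ (Fin N)} (hx : ‖x‖ ≤ 1) :
    ‖feat P c x‖ ≤ √(xiFun P c 1) := by
  apply Real.le_sqrt_of_sq_le
  rw [← real_inner_self_eq_norm_sq, inner_feat, real_inner_self_eq_norm_sq]
  exact xiFun_mono P c (sq_nonneg _) (pow_le_one₀ (norm_nonneg _) hx)

lemma feat_zero : feat P c (0 : EuclideanSpace ℝ (Fin N)) = 0 := by
  rw [← inner_self_eq_zero (𝕜 := ℝ), inner_feat, inner_zero_left]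
  refine Finset.sum_eq_zero fun k hk => ?_
  have : k ≠ 0 := by have := (Finset.mem_Icc.1 hk).1; omega
  simp [this]

lemma Tame.abs_inner_le {C : ℝ} (hC : 0 ≤ C) {g : EuclideanSpace ℝ (GIdx N P)} (hg : Tame c C g)
    {x : EuclideanSpace ℝ (Fin N)} (hx : ‖x‖ ≤ 1) : |inner ℝ (feat P c x) g| ≤ C * √N := by
  have h := hg x 0 (hx.trans one_le_two) (by simp)
  rw [feat_zero, inner_zero_left, sub_zero, sub_zero] at h
  exact h.trans (mul_le_of_le_one_right (by positivity) hx)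

variable {H K : ℕ} [NeZero K] {L : ℝ≥0}
  {f : EuclideanSpace ℝ (GIdx N P) → EuclideanSpace ℝ (Fin N)}

lemma exists_energetic_tree (hN : 1 ≤ N) (hf : LipschitzWith L f) (hb : ∀ x, ‖f x‖ ≤ 1) {e₀ : ℝ}
    {S₀ : Set (EuclideanSpace ℝ (GIdx N P))} (hS : MeasurableSet S₀)
    (hS₀ : ∀ g ∈ S₀, √N * e₀ ≤ inner ℝ (feat P c (f g)) g)
    {C : ℝ} (hC : 0 ≤ C)
    (hNT : stdGaussian (EuclideanSpace ℝ (GIdx N P)) {g | ¬ Tame c C g} ≤ ENNReal.ofReal (2 * P / N))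
    {τ p r κ κ₁ κ₂ η ε : ℝ} {n I : ℕ} (hn : n = Fintype.card (Fin H → Fin K))
    (hI : I = Fintype.card ((Fin H → Fin K) × (Fin (H + 1) × (Fin H → Fin K))))
    (hτ : 0 ≤ τ) {H₁ : ℕ} (hH : H₁ < H) (b : (Fin H → Fin K) → EuclideanSpace ℝ (GIdx N P))
    (hbA : ∀ u v, Agree H₁ u v → b u = b v) (hbt : ∀ u, Tame c C (b u))
    (hp : 0 < p) (hr : 0 < r) (hκ₂ : 0 < κ₂)
    (hpS : ∀ u, p ≤ (stdGaussian _).real {ω | b u + τ • ω ∈ S₀}) (hpr : 8 * τ ^ 2 ≤ p * r ^ 2)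
    (h₁ : (n : ℝ) ^ 2 * (8 * L ^ 2 * τ ^ 2 / κ₂ ^ 2) < 1 / 4)
    (h₂ : (n : ℝ) * (8 * τ ^ 2 / r ^ 2) < 1 / 4)
    (h₃ : (I : ℝ) * (2 * P / N) < 1 / 4)
    {Q : ℕ → ℝ} (hQ : Monotone Q) (hQ0 : 0 ≤ Q 0) (hQη : ∀ k, Q (k + 1) - Q k ≤ η / 2)
    (hQH : Q H ≤ 1 + η / 2)
    (hκ₁ : ∀ u v, |inner ℝ (smooth f τ (b u)) (smooth f τ (b v)) - Q (min (cp u v) H₁)| ≤ κ₁)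
    (hκ₁' : ∀ u, |noiseCorr f τ (b u) (b u) 1 - Q H| ≤ κ₁)
    (hη1 : η ≤ 1) {R : ℕ} (hR : 1 ≤ R) (hRη : 1 / (R : ℝ) ≤ η / 4) (hκ : 0 ≤ κ)
    (hnκ : n * κ ≤ η / 4) (hκs : 2 * L * r + κ₁ + κ₂ + 1 / R ≤ κ) (hnN : 2 * n ≤ N)
    (hε₁ : √(xiFun P c 1) * r ≤ ε / 12) (hε₂ : τ * (I * C) ≤ ε / 12)
    (hε₃ : C * √((n + 1) * κ) ≤ ε / 12) :
    ∃ (a : Fin (H + 1) → Fin (2 * R + 1)) (x : (Fin H → Fin K) → EuclideanSpace ℝ (Fin N)),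
      IsProfile H η (gridProfile H R (n * κ) a) ∧
      (∀ u v, inner ℝ (x u) (x v) = gridProfile H R (n * κ) a (cp u v)) ∧
      n * (√N * (e₀ - ε / 4)) ≤ ∑ u, inner ℝ (feat P c (x u)) (b u) := by
  classical
  have hN0 : (0 : ℝ) < N := by exact_mod_cast hN
  have hsN : 1 ≤ √(N : ℝ) := by rw [Real.one_le_sqrt]; exact_mod_cast hN
  obtain ⟨M, hM, hMQ⟩ := exists_tree_noise hf.continuous hb τ hH b hbA hQ hκ₁ hκ₁'
  obtain ⟨Z, hZ, hZS, hZT⟩ := exists_leaf_fields hf hb hM hτ b hS hp hr hκ₂ hpS hpr hNT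
    (by positivity) (by rw [← hn]; exact h₁) (by rw [← hn]; exact h₂) (by rw [← hI]; exact h₃)
  set ω : (Fin H → Fin K) → EuclideanSpace ℝ (GIdx N P) := fun u => ∑ e, M u e • Z e with hω
  have hne : S₀.Nonempty := by
    have h := hp.trans_le (hpS fun _ => 0)
    obtain ⟨w, hw⟩ : {w | b (fun _ => 0) + τ • w ∈ S₀}.Nonempty := by
      rw [Set.nonempty_iff_ne_empty]
      intro h0
      rw [h0] at h
      simp at h
    exact ⟨_, hw⟩
  have hg : ∀ u, ∃ g ∈ S₀, dist (b u + τ • ω u) g < r := fun u =>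
    (Metric.infDist_lt_iff hne).1 (hZS u)
  choose g hgS hgr using hg
  set x : (Fin H → Fin K) → EuclideanSpace ℝ (Fin N) := fun u => f (g u) with hx
  have hxf : ∀ u, ‖x u - f (b u + τ • ω u)‖ ≤ L * r := fun u => by
    rw [← dist_eq_norm]
    refine (hf.dist_le_mul _ _).trans (mul_le_mul_of_nonneg_left ?_ L.coe_nonneg)
    rw [dist_comm]; exact (hgr u).le
  have hov : ∀ u v, |inner ℝ (x u) (x v) - Q (cp u v)| ≤ 2 * L * r + κ₁ + κ₂ := fun u v => by
    have e1 := abs_inner_sub_inner_le (x := x u) (y := x v) (x' := f (b u + τ • ω u))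
      (y' := f (b v + τ • ω v)) (hb _) (hb _)
    have e2 := hZ u v
    have e3 := hMQ u v
    have e4 := hxf u
    have e5 := hxf v
    rw [abs_le] at e1 e2 e3 ⊢
    simp only [hω] at e1 e4 e5
    constructor <;> linarith [e1.1, e1.2, e2.1, e2.2, e3.1, e3.2]
  have hωf : ∀ u (y : EuclideanSpace ℝ (Fin N)), ‖y‖ ≤ 1 →
      |inner ℝ (feat P c y) (ω u)| ≤ I * C * √N := fun u y hy => by
    simp only [hω, inner_sum, inner_smul_right]
    refine (Finset.abs_sum_le_sum_abs _ _).trans ?_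
    have : ∀ e, |M u e * inner ℝ (feat P c y) (Z e)| ≤ C * √N := fun e => by
      have h1 : |M u e| ≤ 1 := by
        rw [← sq_le_one_iff_abs_le_one, ← hM u]
        exact Finset.single_le_sum (f := fun e => M u e ^ 2) (fun _ _ => sq_nonneg _)
          (Finset.mem_univ e)
      have h2 : Tame c C (Z e) := not_not.1 (hZT e)
      rw [abs_mul]
      exact (mul_le_of_le_one_left (abs_nonneg _) h1).trans (h2.abs_inner_le hC hy)
    refine (Finset.sum_le_sum fun e _ => this e).trans (le_of_eq ?_)
    rw [Finset.sum_const, Finset.card_univ, ← hI, nsmul_eq_mul, mul_assoc]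
  have hen : ∀ u, √N * (e₀ - ε / 6) ≤ inner ℝ (feat P c (x u)) (b u) := fun u => by
    have e1 := hS₀ _ (hgS u)
    have e2 := abs_real_inner_le_norm (feat P c (x u)) (g u - (b u + τ • ω u))
    have e3 : ‖feat P c (x u)‖ * ‖g u - (b u + τ • ω u)‖ ≤ √(xiFun P c 1) * r := by
      refine mul_le_mul (norm_feat_le (hb _)) ?_ (norm_nonneg _) (Real.sqrt_nonneg _)
      rw [← dist_eq_norm, dist_comm]; exact (hgr u).le
    have e4 := hωf u (x u) (hb _)
    have e5 : inner ℝ (feat P c (x u)) (g u) = inner ℝ (feat P c (x u)) (b u) +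
        τ * inner ℝ (feat P c (x u)) (ω u) +
        inner ℝ (feat P c (x u)) (g u - (b u + τ • ω u)) := by
      rw [inner_sub_right, inner_add_right, inner_smul_right]; ring
    have e6 : τ * inner ℝ (feat P c (x u)) (ω u) ≤ ε / 12 * √N := by
      calc τ * inner ℝ (feat P c (x u)) (ω u) ≤ τ * (I * C * √N) :=
            mul_le_mul_of_nonneg_left ((le_abs_self _).trans e4) hτ
        _ = τ * (I * C) * √N := by ring
        _ ≤ _ := by gcongr
    have e7 : 0 ≤ ε / 12 := le_trans (by positivity) hε₁
    have e8 : ε / 12 ≤ ε / 12 * √N := le_mul_of_one_le_right e7 hsN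
    change √N * e₀ ≤ inner ℝ (feat P c (x u)) (g u) at e1
    have := (abs_le.1 e2).2
    linarith
  obtain ⟨a, ha, haQ⟩ := exists_gridProfile (H := H) (s := n * κ) hR (by positivity) hQ hQ0 hQη hQH
    hη1 hRη hnκ
  set Q' : ℕ → ℝ := fun k => gridProfile H R (n * κ) a k - if k < H then 0 else n * κ with hQ'
  obtain ⟨z, hz, hzx⟩ := exists_gram_correction (κ := κ) x (fun u v => Q' (cp u v))
    (fun u v => by rw [cp_comm]) (fun u v => by
      have e1 := hov u v
      have e2 := haQ (cp u v) (cp_le u v)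
      rw [abs_le] at e1 e2 ⊢
      simp only [hQ']
      constructor <;> linarith [e1.1, e1.2, e2.1, e2.2]) (by rw [← hn]; simpa using hnN)
  have hzg : ∀ u v, inner ℝ (z u) (z v) = gridProfile H R (n * κ) a (cp u v) := fun u v => by
    rw [hz, ← hn]
    simp only [hQ']
    by_cases huv : u = v
    · subst huv
      rw [if_pos rfl, cp_self, if_neg (lt_irrefl _)]; ring
    · have h : cp u v < H := lt_of_le_of_ne (cp_le u v) fun h => huv (eq_of_cp_eq h)
      rw [if_neg huv, if_pos h]; ring
  refine ⟨a, z, ha, hzg, ?_⟩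
  have hfin : ∀ u, √N * (e₀ - ε / 4) ≤ inner ℝ (feat P c (z u)) (b u) := fun u => by
    have h1 : ‖z u‖ ≤ 2 := by
      have h : ‖z u‖ ^ 2 ≤ 2 := by
        rw [← real_inner_self_eq_norm_sq, hzg, cp_self]
        exact ha.2.2.2.trans (by linarith)
      nlinarith [norm_nonneg (z u)]
    have h2 := hbt u (z u) (x u) h1 ((hb _).trans one_le_two)
    have h3 : ‖z u - x u‖ ≤ √((n + 1) * κ) := by
      apply Real.le_sqrt_of_sq_le
      rw [hn]; exact hzx u
    have h4 : C * √N * ‖z u - x u‖ ≤ ε / 12 * √N := by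
      calc C * √N * ‖z u - x u‖ ≤ C * √N * √((n + 1) * κ) := by gcongr
        _ = C * √((n + 1) * κ) * √N := by ring
        _ ≤ _ := by gcongr
    have h5 := (abs_le.1 h2).1
    have h6 := hen u
    linarith
  calc n * (√N * (e₀ - ε / 4)) = ∑ _u : Fin H → Fin K, √N * (e₀ - ε / 4) := by
        rw [Finset.sum_const, Finset.card_univ, ← hn, nsmul_eq_mul]
    _ ≤ _ := Finset.sum_le_sum fun u _ => hfin u

end EnergeticTree

section Pools

variable {N P : ℕ} {c : ℕ → ℝ} {D K' : ℕ}

/-- The coefficients of the field read along a word in a family of pools. -/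
def wordCoeff (σ : ℝ) (w : Fin D → Fin K') (e : Fin D × Fin K') : ℝ := if w e.1 = e.2 then σ else 0

lemma sum_wordCoeff_smul {V : Type*} [AddCommGroup V] [Module ℝ V] (σ : ℝ) (w : Fin D → Fin K')
    (Z : Fin D × Fin K' → V) : ∑ e, wordCoeff σ w e • Z e = σ • ∑ d, Z (d, w d) := by
  rw [Fintype.sum_prod_type, Finset.smul_sum]
  refine Finset.sum_congr rfl fun d _ => ?_
  rw [Finset.sum_eq_single (w d)]
  · simp [wordCoeff]
  · intro j _ hj
    simp [wordCoeff, hj.symm]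
  · simp

lemma sum_wordCoeff_mul (σ : ℝ) (w w' : Fin D → Fin K') :
    ∑ e, wordCoeff σ w e * wordCoeff σ w' e =
      (Finset.univ.filter fun i => w i = w' i).card * σ ^ 2 := by
  have h := sum_wordCoeff_smul σ w (fun e => wordCoeff σ w' e)
  simp only [smul_eq_mul] at h
  rw [h, Finset.mul_sum, ← nsmul_eq_mul, ← Finset.sum_const, Finset.sum_filter]
  refine Finset.sum_congr rfl fun d _ => ?_
  by_cases hd : w d = w' d
  · simp [wordCoeff, hd, sq]
  · simp [wordCoeff, hd, Ne.symm hd]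

lemma isClosed_tame (C : ℝ) : IsClosed {g : EuclideanSpace ℝ (GIdx N P) | Tame c C g} := by
  have : {g : EuclideanSpace ℝ (GIdx N P) | Tame c C g} = ⋂ (x : EuclideanSpace ℝ (Fin N))
      (y : EuclideanSpace ℝ (Fin N)) (_ : ‖x‖ ≤ 2) (_ : ‖y‖ ≤ 2),
      {g | |inner ℝ (feat P c x) g - inner ℝ (feat P c y) g| ≤ C * √N * ‖x - y‖} := by
    ext g; simp [Tame]
  rw [this]
  exact isClosed_iInter fun x => isClosed_iInter fun y => isClosed_iInter fun _ =>
    isClosed_iInter fun _ => isClosed_le (by fun_prop) (by fun_prop)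

lemma Tame.smul {C : ℝ} {g : EuclideanSpace ℝ (GIdx N P)} (hg : Tame c C g) {a : ℝ} (ha : |a| ≤ 1) :
    Tame c C (a • g) := fun x y hx hy => by
  rw [inner_smul_right, inner_smul_right, ← mul_sub, abs_mul]
  exact (mul_le_of_le_one_left (abs_nonneg _) ha).trans (hg x y hx hy)

lemma measure_word_not_tame_le {C : ℝ}
    (hNT : stdGaussian (EuclideanSpace ℝ (GIdx N P)) {g | ¬ Tame c C g} ≤ ENNReal.ofReal (2 * P / N))
    {σ : ℝ} (hσ : D * σ ^ 2 ≤ 1) (w : Fin D → Fin K') :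
    stdGaussian (PiLp 2 fun _ : Fin D × Fin K' => EuclideanSpace ℝ (GIdx N P))
      {Z | ¬ Tame c C (∑ e, wordCoeff σ w e • Z e)} ≤ ENNReal.ofReal (2 * P / N) := by
  have h0 : ∑ e, wordCoeff σ w e ^ 2 = √(D * σ ^ 2) ^ 2 := by
    have h := sum_wordCoeff_mul σ w w
    simp only [Finset.filter_true, Finset.card_univ, Fintype.card_fin] at h
    rw [Real.sq_sqrt (by positivity), ← h]
    exact Finset.sum_congr rfl fun e _ => sq _
  have hm := map_pi_sum (V := EuclideanSpace ℝ (GIdx N P)) h0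
  have hmeas : Measurable fun Z : Fin D × Fin K' → EuclideanSpace ℝ (GIdx N P) =>
    ∑ e, wordCoeff σ w e • Z e := Continuous.measurable (by fun_prop)
  rw [pi_stdGaussian_eq_map, Measure.map_map hmeas (PiLp.continuous_ofLp 2
    (fun _ : Fin D × Fin K' => EuclideanSpace ℝ (GIdx N P))).measurable] at hm
  have hms : MeasurableSet {g : EuclideanSpace ℝ (GIdx N P) | ¬ Tame c C g} :=
    (isClosed_tame C).measurableSet.compl
  have h1 := congrArg (fun ν => ν {g : EuclideanSpace ℝ (GIdx N P) | ¬ Tame c C g}) hm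
  simp only at h1
  rw [Measure.map_apply (hmeas.comp (PiLp.continuous_ofLp 2
    (fun _ : Fin D × Fin K' => EuclideanSpace ℝ (GIdx N P))).measurable) hms,
    Measure.map_apply (Continuous.measurable (by fun_prop)) hms] at h1
  have hsub : (fun g : EuclideanSpace ℝ (GIdx N P) => √(D * σ ^ 2) • g) ⁻¹' {g | ¬ Tame c C g} ⊆
      {g | ¬ Tame c C g} := fun g hg (ht : Tame c C g) => by
    refine absurd (Tame.smul ht (a := √(D * σ ^ 2)) ?_) hg
    rw [abs_of_nonneg (Real.sqrt_nonneg _)]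
    exact Real.sqrt_le_one.2 hσ
  exact le_trans (le_of_eq h1) ((measure_mono hsub).trans hNT)

variable {H K : ℕ} [NeZero K]

/-- The words of a tree agree on a number of letters governed by the last common ancestor. -/
def IsWordTree (j : ℕ) (W : (Fin H → Fin K) → Fin D → Fin K') : Prop :=
  ∃ d : ℕ → ℕ, (∀ u v, (Finset.univ.filter fun i => W u i = W v i).card = d (cp u v)) ∧
    Monotone d ∧ (∀ k, d k ≤ D) ∧ d 0 ≤ j

/-- Some tree of configurations with the given profile has an exceptional energy. -/
def HasEnergeticTree (c : ℕ → ℝ) (σ η B : ℝ) (j : ℕ) (q : ℕ → ℝ)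
    (W : (Fin H → Fin K) → Fin D → Fin K') (Z : Fin D × Fin K' → EuclideanSpace ℝ (GIdx N P)) :
    Prop :=
  IsWordTree j W ∧ IsProfile H η q ∧ ∃ x : (Fin H → Fin K) → EuclideanSpace ℝ (Fin N),
    (∀ u v, inner ℝ (x u) (x v) = q (cp u v)) ∧ ((K : ℝ) ^ H * √N) * B <
      ∑ u, inner ℝ (feat P c (x u)) (∑ e, wordCoeff σ (W u) e • Z e)

lemma measure_hasEnergeticTree_le (heven : ∀ k, Odd k → c k = 0) (hN : 1 ≤ N)
    {ϑ η t₀ σ : ℝ} (hϑ : 0 < ϑ) (hη : 0 ≤ η) (hη1 : η ≤ 1) (hσ : D * σ ^ 2 ≤ 1) {j : ℕ}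
    (hj : j * σ ^ 2 ≤ t₀) (q : ℕ → ℝ) (W : (Fin H → Fin K) → Fin D → Fin K')
    {B δ : ℝ} (hδ : 0 < δ) (hB : (∫ x in Set.Ioo (0 : ℝ) 1, √(xiD2 P c x)) +
      (3 * η * √(xiD2 P c 2) + 2 * ϑ + t₀ * xiD1 P c 2 / ϑ + xiD1 P c 2 / (K * ϑ)) / 2 ≤ B) :
    stdGaussian (PiLp 2 fun _ : Fin D × Fin K' => EuclideanSpace ℝ (GIdx N P))
      {Z | HasEnergeticTree c σ η (B + δ) j q W Z} ≤
      ENNReal.ofReal (2 * (xiFun P c 2 / N) / δ ^ 2) := by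
  by_cases h : IsWordTree j W ∧ IsProfile H η q
  swap
  · have : {Z : PiLp 2 fun _ : Fin D × Fin K' => EuclideanSpace ℝ (GIdx N P) |
        HasEnergeticTree c σ η (B + δ) j q W Z} = ∅ := by
      rw [Set.eq_empty_iff_forall_notMem]
      exact fun Z hZ => h ⟨hZ.1, hZ.2.1⟩
    rw [this]; simp
  obtain ⟨⟨d, hd, hdm, hdD, hd0⟩, hq⟩ := h
  have hσ0 := sq_nonneg σ
  refine (measure_mono fun Z hZ => hZ.2.2).trans (measure_tree_energy_gt_le heven hN hϑ hη hη1
    (t₀ := t₀) (le_trans (by positivity) hj) hq.1 hq.2.1 hq.2.2.1 hq.2.2.2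
    (t := fun k => d k * σ ^ 2) (fun k _ => ?_) (by positivity) ?_ ?_
    (fun u => wordCoeff σ (W u)) (fun u v => ?_) hδ hB)
  · have := hdm (Nat.le_succ k)
    gcongr
  · exact le_trans (by have := hdD H; gcongr) hσ
  · exact le_trans (by gcongr) hj
  · rw [sum_wordCoeff_mul, hd]

lemma measure_bad_pools_le (heven : ∀ k, Odd k → c k = 0) (hN : 1 ≤ N) {C : ℝ}
    (hNT : stdGaussian (EuclideanSpace ℝ (GIdx N P)) {g | ¬ Tame c C g} ≤ ENNReal.ofReal (2 * P / N))
    {ϑ η t₀ σ s : ℝ} (hϑ : 0 < ϑ) (hη : 0 ≤ η) (hη1 : η ≤ 1) (hσ : D * σ ^ 2 ≤ 1) {j R : ℕ}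
    (hj : j * σ ^ 2 ≤ t₀)
    {B δ : ℝ} (hδ : 0 < δ) (hB : (∫ x in Set.Ioo (0 : ℝ) 1, √(xiD2 P c x)) +
      (3 * η * √(xiD2 P c 2) + 2 * ϑ + t₀ * xiD1 P c 2 / ϑ + xiD1 P c 2 / (K * ϑ)) / 2 ≤ B) :
    stdGaussian (PiLp 2 fun _ : Fin D × Fin K' => EuclideanSpace ℝ (GIdx N P))
      ({Z | ∃ w : Fin D → Fin K', ¬ Tame c C (∑ e, wordCoeff σ w e • Z e)} ∪
        {Z | ∃ (W : (Fin H → Fin K) → Fin D → Fin K') (a : Fin (H + 1) → Fin (2 * R + 1)),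
          HasEnergeticTree c σ η (B + δ) j (gridProfile H R s a) W Z}) ≤
      ENNReal.ofReal ((Fintype.card (Fin D → Fin K') * (2 * P) +
        Fintype.card ((Fin H → Fin K) → Fin D → Fin K') *
          (Fintype.card (Fin (H + 1) → Fin (2 * R + 1)) * (2 * xiFun P c 2 / δ ^ 2))) / N) := by
  classical
  have hN0 : (0 : ℝ) < N := by exact_mod_cast hN
  have hξ := xiFun_nonneg P c zero_le_two
  have e1 : {Z : PiLp 2 fun _ : Fin D × Fin K' => EuclideanSpace ℝ (GIdx N P) |
      ∃ w : Fin D → Fin K', ¬ Tame c C (∑ e, wordCoeff σ w e • Z e)} =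
      ⋃ w : Fin D → Fin K', {Z | ¬ Tame c C (∑ e, wordCoeff σ w e • Z e)} := by
    ext Z; simp
  have e2 : {Z : PiLp 2 fun _ : Fin D × Fin K' => EuclideanSpace ℝ (GIdx N P) |
      ∃ (W : (Fin H → Fin K) → Fin D → Fin K') (a : Fin (H + 1) → Fin (2 * R + 1)),
          HasEnergeticTree c σ η (B + δ) j (gridProfile H R s a) W Z} =
      ⋃ (W : (Fin H → Fin K) → Fin D → Fin K') (a : Fin (H + 1) → Fin (2 * R + 1)),
        {Z : PiLp 2 fun _ : Fin D × Fin K' => EuclideanSpace ℝ (GIdx N P) |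
          HasEnergeticTree c σ η (B + δ) j (gridProfile H R s a) W Z} := by
    ext Z; simp
  rw [e1, e2]
  refine (measure_union_le _ _).trans ((add_le_add (measure_iUnion_fintype_le _ _)
    ((measure_iUnion_fintype_le _ _).trans
      (Finset.sum_le_sum fun W _ => measure_iUnion_fintype_le _ _))).trans ?_)
  refine (add_le_add (Finset.sum_le_sum fun w _ => measure_word_not_tame_le hNT hσ w)
    (Finset.sum_le_sum fun W _ => Finset.sum_le_sum fun a _ =>
      measure_hasEnergeticTree_le heven hN hϑ hη hη1 hσ hj _ W hδ hB)).trans (le_of_eq ?_)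
  simp only [Finset.sum_const, Finset.card_univ, nsmul_eq_mul]
  simp only [← ENNReal.ofReal_natCast]
  rw [← ENNReal.ofReal_mul (Nat.cast_nonneg _), ← ENNReal.ofReal_mul (Nat.cast_nonneg _),
    ← ENNReal.ofReal_mul (Nat.cast_nonneg _), ← ENNReal.ofReal_add (by positivity) (by positivity)]
  congr 1
  ring

end Pools

section Combine

/-- A profile that is constant after `H₁` can be raised in steps to a higher final level. -/
lemma exists_raised_profile {q : ℕ → ℝ} (hq : Monotone q) (hq0 : 0 ≤ q 0) {α : ℝ} (hα : 0 ≤ α)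
    (hqα : ∀ k, q (k + 1) - q k ≤ α) {H₁ H : ℕ} (hqH : ∀ k, H₁ ≤ k → q k = q H₁) (hH : H₁ ≤ H)
    {Qe : ℝ} (hQe : Qe ≤ q H₁ + (H - H₁ : ℕ) * α) :
    ∃ Q : ℕ → ℝ, Monotone Q ∧ 0 ≤ Q 0 ∧ (∀ k, Q (k + 1) - Q k ≤ α) ∧ (∀ k ≤ H₁, Q k = q k) ∧
      Q H = max Qe (q H₁) := by
  have hlow : ∀ k ≤ H₁, min (q k + (k - H₁ : ℕ) * α) (max Qe (q H₁)) = q k := fun k hk => by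
    rw [Nat.sub_eq_zero_of_le hk, Nat.cast_zero, zero_mul, add_zero, min_eq_left]
    exact (hq hk).trans (le_max_right _ _)
  refine ⟨fun k => min (q k + (k - H₁ : ℕ) * α) (max Qe (q H₁)), fun k l hkl => ?_, ?_, fun k => ?_,
    hlow, ?_⟩
  · have h1 := hq hkl
    have h2 : ((k - H₁ : ℕ) : ℝ) ≤ (l - H₁ : ℕ) := by exact_mod_cast Nat.sub_le_sub_right hkl H₁
    exact min_le_min_right _ (by gcongr)
  · beta_reduce
    rw [hlow 0 (Nat.zero_le _)]
    exact hq0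
  · have key : q (k + 1) + (k + 1 - H₁ : ℕ) * α ≤ q k + (k - H₁ : ℕ) * α + α := by
      rcases Nat.lt_or_ge k H₁ with hk | hk
      · rw [Nat.sub_eq_zero_of_le hk.le, Nat.sub_eq_zero_of_le hk]
        have := hqα k
        simp only [Nat.cast_zero, zero_mul, add_zero]
        linarith
      · rw [hqH k hk, hqH (k + 1) (by omega), Nat.sub_add_comm hk]
        push_cast
        linarith
    rw [sub_le_iff_le_add', ← sub_le_iff_le_add]
    refine le_min ?_ ?_
    · linarith [min_le_left (q (k + 1) + (k + 1 - H₁ : ℕ) * α) (max Qe (q H₁))]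
    · linarith [min_le_right (q (k + 1) + (k + 1 - H₁ : ℕ) * α) (max Qe (q H₁))]
  · refine min_eq_right (max_le ?_ ?_)
    · rw [hqH H hH]
      exact hQe
    · exact (hq hH).trans (le_add_of_nonneg_right (by positivity))

lemma norm_smooth_sub_smooth_le_of_influence_le {V E : Type*} [NormedAddCommGroup V]
    [InnerProductSpace ℝ V] [FiniteDimensional ℝ V] [MeasurableSpace V] [BorelSpace V]
    [NormedAddCommGroup E] [InnerProductSpace ℝ E] [FiniteDimensional ℝ E]
    [MeasurableSpace E] [BorelSpace E] {f : V → E} {σ τ η : ℝ} {D : ℕ}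
    {i : Fin D} {z z' : Fin D → V} (h : ∀ d, d ≠ i → z d = z' d) (hz : influence f σ τ i z ≤ η)
    (hz' : influence f σ τ i z' ≤ η) :
    ‖smooth f τ (σ • ∑ d, z d) - smooth f τ (σ • ∑ d, z' d)‖ ≤ 2 * √η := by
  have e : ∑ d, (if d = i then (0 : ℝ) else 1) • z d = ∑ d, (if d = i then (0 : ℝ) else 1) • z' d :=
    Finset.sum_congr rfl fun d _ => by
      by_cases hd : d = i
      · simp [hd]
      · simp [hd, h d hd]
  unfold influence at hz hz'
  rw [← e] at hz'
  have h1 := norm_sub_le_norm_sub_add_norm_sub (smooth f τ (σ • ∑ d, z d))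
    (smooth (smooth f τ) σ (σ • ∑ d, (if d = i then (0 : ℝ) else 1) • z d))
    (smooth f τ (σ • ∑ d, z' d))
  rw [norm_sub_rev (smooth (smooth f τ) σ _) (smooth f τ (σ • ∑ d, z' d))] at h1
  linarith [Real.le_sqrt_of_sq_le hz, Real.le_sqrt_of_sq_le hz']

lemma exists_hasEnergeticTree (P : ℕ) (c : ℕ → ℝ) (D H₁ K M R : ℕ) (J : ℝ) [NeZero K] (hH₁ : 1 ≤ H₁)
    (hM : 1 ≤ M) (hR : 1 ≤ R) : ∃ K' : ℕ, ∀ {N : ℕ} (_ : 1 ≤ N) {L : ℝ≥0}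
      {f : EuclideanSpace ℝ (GIdx N P) → EuclideanSpace ℝ (Fin N)} (_ : LipschitzWith L f)
      (_ : ∀ x, ‖f x‖ ≤ 1) {e₀ : ℝ} {S₀ : Set (EuclideanSpace ℝ (GIdx N P))} (_ : MeasurableSet S₀)
      (_ : ∀ g ∈ S₀, √N * e₀ ≤ inner ℝ (feat P c (f g)) g) {C : ℝ} (_ : 0 ≤ C)
      (_ : stdGaussian (EuclideanSpace ℝ (GIdx N P)) {g | ¬ Tame c C g} ≤ ENNReal.ofReal (2 * P / N))
      {σ τ p r κ κ₂ η η₁ ε B : ℝ} {n I : ℕ}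
      (_ : n = Fintype.card (Fin (2 * H₁) → Fin K))
      (_ : I = Fintype.card ((Fin (2 * H₁) → Fin K) × (Fin (2 * H₁ + 1) × (Fin (2 * H₁) → Fin K))))
      (_ : 0 ≤ τ) (_ : 0 < p) (_ : 0 < r) (_ : 0 < κ₂) (_ : 8 * τ ^ 2 ≤ p * r ^ 2)
      (_ : (n : ℝ) ^ 2 * (8 * L ^ 2 * τ ^ 2 / κ₂ ^ 2) < 1 / 4)
      (_ : (n : ℝ) * (8 * τ ^ 2 / r ^ 2) < 1 / 4) (_ : (I : ℝ) * (2 * P / N) < 1 / 4)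
      (_ : 0 ≤ η) (_ : η ≤ 1) (_ : 2 ≤ H₁ * (η / 4)) (_ : 2 / R + 2 * √η₁ ≤ η / 4)
      (_ : 1 / (R : ℝ) ≤ η / 4) (_ : 3 / (R : ℝ) + 2 / M ≤ η / 2) (_ : 0 ≤ κ) (_ : n * κ ≤ η / 4)
      (_ : 2 * L * r + (3 / R + 2 / M) + κ₂ + 1 / R ≤ κ) (_ : 2 * n ≤ N)
      (_ : √(xiFun P c 1) * r ≤ ε / 12) (_ : τ * (I * C) ≤ ε / 12)
      (_ : C * √((n + 1) * κ) ≤ ε / 12) (_ : B < e₀ - ε / 4)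
      (Z : Fin D × Fin K' → EuclideanSpace ℝ (GIdx N P))
      (_ : ∀ w : Fin D → Fin K', (fun d => Z (d, w d)) ∈ goodWords f σ τ D S₀ p η₁ J)
      (_ : ∀ w : Fin D → Fin K', Tame c C (∑ e, wordCoeff σ w e • Z e)),
      ∃ (W : (Fin (2 * H₁) → Fin K) → Fin D → Fin K') (a : Fin (2 * H₁ + 1) → Fin (2 * R + 1)),
        HasEnergeticTree c σ η B ⌊J⌋₊ (gridProfile (2 * H₁) R (n * κ) a) W Z := by
  obtain ⟨K', hK'⟩ := exists_tree_of_words D H₁ (2 * H₁) K ⌊J⌋₊ M R (by omega) hH₁ hM hR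
  refine ⟨K', fun {N} hN {L f} hf hb {e₀ S₀} hS hS₀ {C} hC hNT {σ τ p r κ κ₂ η η₁ ε B n I} hn hI hτ
    hp hr hκ₂ hpr h₁ h₂ h₃ hη hη1 hH₁η hRρ hRη hRM hκ hnκ hκs hnN hε₁ hε₂ hε₃ hBe Z hZ hZt => ?_⟩
  have hR0 : (0 : ℝ) < R := by exact_mod_cast hR
  have hR1 : (0 : ℝ) ≤ 1 / R := by positivity
  have hM1 : (0 : ℝ) ≤ 2 / M := by positivity
  have hR3 : (3 : ℝ) / R = 3 * (1 / R) := by ring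
  have hR2 : (2 : ℝ) / R = 2 * (1 / R) := by ring
  set bw : (Fin D → Fin K') → EuclideanSpace ℝ (GIdx N P) := fun w => σ • ∑ d, Z (d, w d) with hbw
  have hn₂ : ∀ w, |noiseCorr f τ (bw w) (bw w) 1| ≤ 1 := fun w => by
    have := norm_integral_le_one (μ := stdGaussian (EuclideanSpace ℝ (GIdx N P)))
      (g := fun ω => ‖f (bw w + τ • ω)‖ ^ 2) fun ω => by
        rw [Real.norm_eq_abs, abs_of_nonneg (by positivity)]
        exact pow_le_one₀ (norm_nonneg _) (hb _)
    rw [noiseCorr_one]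
    exact this
  obtain ⟨W, d, q, Qe, hWA, hWd, hdm, hdD, hd0, hqm, hq0, hqη, hqH, hqy, hQe⟩ := hK'
    (fun w => smooth f τ (bw w)) (fun w => noiseCorr f τ (bw w) (bw w) 1)
    (fun w => Finset.univ.filter fun i => η₁ < influence f σ τ i fun d => Z (d, w d))
    (ρ := 2 * √η₁) (η := η / 4) (by positivity) (by positivity)
    (fun w => norm_smooth_le hb _ _) hn₂ (fun w => Nat.le_floor (hZ w).2)
    (fun w w' i hww hw hw' => norm_smooth_sub_smooth_le_of_influence_le
      (z := fun d => Z (d, w d)) (z' := fun d => Z (d, w' d)) (fun d hd => by simp only [hww d hd])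
      (by simpa using hw) (by simpa using hw')) hH₁η
  set u₀ : Fin (2 * H₁) → Fin K := fun _ => 0 with hu₀
  have hQe1 : Qe ≤ 1 + 1 / R := by
    linarith [(abs_le.1 (hQe u₀)).1, (abs_le.1 (hn₂ (W u₀))).2]
  have hqs : ∀ u, |inner ℝ (smooth f τ (bw (W u))) (smooth f τ (bw (W u))) - q H₁| ≤ 3 / R + 2 / M :=
    fun u => by
      have h := hqy u u
      rw [cp_self, hqH (2 * H₁) (by omega)] at h
      exact h
  have hqH1 : q H₁ ≤ 1 + (3 / R + 2 / M) := by
    have h := (abs_le.1 (hqs u₀)).1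
    have h2 := real_inner_le_norm (smooth f τ (bw (W u₀))) (smooth f τ (bw (W u₀)))
    have h3 := norm_smooth_le hb τ (bw (W u₀))
    have h4 := mul_le_one₀ h3 (norm_nonneg _) h3
    linarith
  have hq0H : 0 ≤ q H₁ := hq0.trans (hqm (Nat.zero_le _))
  obtain ⟨Q, hQm, hQ0, hQη, hQl, hQH⟩ := exists_raised_profile hqm hq0 (α := η / 2) (by positivity)
    (fun k => (hqη k).trans (by linarith)) hqH (show H₁ ≤ 2 * H₁ by omega) (Qe := Qe) (by
      rw [show 2 * H₁ - H₁ = H₁ by omega]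
      linarith)
  obtain ⟨a, x, ha, hx, hE⟩ := exists_energetic_tree hN hf hb hS hS₀ hC hNT hn hI hτ
    (show H₁ < 2 * H₁ by omega) (fun u => bw (W u)) (fun u v huv => by simp only [hWA u v huv])
    (fun u => by
      have := hZt (W u)
      rwa [sum_wordCoeff_smul] at this) hp hr hκ₂ (fun u => (hZ (W u)).1) hpr h₁ h₂ h₃ hQm hQ0 hQη
    (by rw [hQH]; exact max_le (by linarith) (by linarith)) (κ₁ := 3 / R + 2 / M)
    (fun u v => by
      rw [hQl _ (min_le_right _ _)]
      rcases le_total (cp u v) H₁ with h | h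
      · rw [min_eq_left h]; exact hqy u v
      · rw [min_eq_right h, ← hqH _ h]; exact hqy u v)
    (fun u => by
      rw [hQH]
      have h1 := abs_le.1 (hQe u)
      have h2 := abs_le.1 (hqs u)
      have h3 := noiseCorr_zero_le_one hf.continuous hb τ (bw (W u))
      rw [noiseCorr_zero hf.continuous hb] at h3
      rw [abs_le]
      constructor
      · rcases max_choice Qe (q H₁) with h | h <;> rw [h] <;> linarith
      · linarith [le_max_left Qe (q H₁)])
    hη1 hR hRη hκ hnκ hκs hnN hε₁ hε₂ hε₃
  refine ⟨W, a, ⟨d, hWd, hdm, hdD, hd0⟩, ha, x, hx, ?_⟩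
  simp only [sum_wordCoeff_smul]
  refine lt_of_lt_of_le ?_ hE
  have hN0 : (0 : ℝ) < N := by exact_mod_cast hN
  have hK0 : 0 < K := Nat.pos_of_ne_zero (NeZero.ne K)
  rw [hn]
  simp only [Fintype.card_pi, Fintype.card_fin, Finset.prod_const, Finset.card_univ, Nat.cast_pow]
  rw [mul_assoc]
  gcongr

end Combine

section Threshold

lemma exists_error_parameters {ε X₁ X₂ : ℝ} (hε : 0 < ε) (hX₁ : 0 ≤ X₁) (hX₂ : 0 ≤ X₂) :
    ∃ (ϑ η t₀ : ℝ) (K : ℕ), 0 < ϑ ∧ 0 < η ∧ η ≤ 1 ∧ 0 < t₀ ∧ K ≠ 0 ∧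
      (3 * η * X₂ + 2 * ϑ + t₀ * X₁ / ϑ + X₁ / (K * ϑ)) / 2 ≤ ε / 4 := by
  obtain ⟨K, hK⟩ := exists_nat_ge (8 * X₁ / (ε / 16 * ε))
  refine ⟨ε / 16, min 1 (ε / (24 * (X₂ + 1))), ε * (ε / 16) / (8 * (X₁ + 1)), K + 1, by positivity,
    by positivity, min_le_left _ _, by positivity, by omega, ?_⟩
  have h1 : 3 * min 1 (ε / (24 * (X₂ + 1))) * X₂ ≤ ε / 8 := by
    have : ε / (24 * (X₂ + 1)) * X₂ ≤ ε / 24 := by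
      rw [div_mul_eq_mul_div, div_le_div_iff₀ (by positivity) (by positivity)]
      nlinarith
    have h2 := mul_le_mul_of_nonneg_right (min_le_right 1 (ε / (24 * (X₂ + 1)))) hX₂
    linarith
  have h2 : ε * (ε / 16) / (8 * (X₁ + 1)) * X₁ / (ε / 16) ≤ ε / 8 := by
    have : ε * (ε / 16) / (8 * (X₁ + 1)) * X₁ / (ε / 16) = ε / 8 * (X₁ / (X₁ + 1)) := by
      field_simp
    rw [this]
    exact mul_le_of_le_one_right (by positivity) ((div_le_one (by positivity)).2 (by linarith))
  have h3 : X₁ / ((K + 1 : ℕ) * (ε / 16)) ≤ ε / 8 := by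
    rw [div_le_iff₀ (by positivity)] at hK ⊢
    push_cast
    nlinarith
  linarith

/-- The scales of the noise, of the discretisation and of the branching. -/
lemma exists_scale_parameters {ε η t₀ C X p : ℝ} {n I : ℕ} (L : ℝ≥0) (hε : 0 < ε) (hη : 0 < η)
    (ht₀ : 0 < t₀) (hp : 0 < p) :
    ∃ (κ r η₁ σ : ℝ) (R S m : ℕ), 0 < κ ∧ 0 < r ∧ 0 < η₁ ∧ 1 ≤ R ∧ 1 ≤ S ∧ 1 ≤ m ∧ 0 ≤ σ ∧
      ((m * (S - 1) : ℕ) : ℝ) * σ ^ 2 + (σ * √m) ^ 2 = 1 ∧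
      ⌊4 * S / (η₁ * p)⌋₊ * σ ^ 2 ≤ t₀ ∧
      8 * (σ * √m) ^ 2 ≤ p / 2 * r ^ 2 ∧
      (n : ℝ) ^ 2 * (8 * L ^ 2 * (σ * √m) ^ 2 / (κ / 4) ^ 2) < 1 / 4 ∧
      (n : ℝ) * (8 * (σ * √m) ^ 2 / r ^ 2) < 1 / 4 ∧
      2 / R + 2 * √η₁ ≤ η / 4 ∧ 1 / (R : ℝ) ≤ η / 4 ∧ 3 / (R : ℝ) + 2 / R ≤ η / 2 ∧
      n * κ ≤ η / 4 ∧ 2 * L * r + (3 / R + 2 / R) + κ / 4 + 1 / R ≤ κ ∧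
      X * r ≤ ε / 12 ∧ σ * √m * (I * C) ≤ ε / 12 ∧ C * √((n + 1) * κ) ≤ ε / 12 := by
  obtain ⟨κ, hκ, hκ1, hκ2⟩ : ∃ κ : ℝ, 0 < κ ∧ (n + 1) * κ ≤ η / 4 ∧ C * √((n + 1) * κ) ≤ ε / 12 := by
    have hc : Tendsto (fun κ : ℝ => (n + 1) * κ) (nhds 0) (nhds 0) :=
      Continuous.tendsto' (by fun_prop) _ _ (by simp)
    have hc' : Tendsto (fun κ : ℝ => C * √((n + 1) * κ)) (nhds 0) (nhds 0) :=
      Continuous.tendsto' (by fun_prop) _ _ (by simp)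
    obtain ⟨κ, ⟨h1, h2⟩, h3⟩ := (((hc.eventually_le_const (show 0 < η / 4 by positivity)).and
      (hc'.eventually_le_const (show 0 < ε / 12 by positivity))).filter_mono
        nhdsWithin_le_nhds).and (self_mem_nhdsWithin (s := Set.Ioi (0 : ℝ))) |>.exists
    exact ⟨κ, h3, h1, h2⟩
  obtain ⟨r, hr, hr1, hr2⟩ : ∃ r : ℝ, 0 < r ∧ 2 * L * r ≤ κ / 4 ∧ X * r ≤ ε / 12 := by
    have hc : Tendsto (fun r : ℝ => 2 * L * r) (nhds 0) (nhds 0) :=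
      Continuous.tendsto' (by fun_prop) _ _ (by simp)
    have hc' : Tendsto (fun r : ℝ => X * r) (nhds 0) (nhds 0) :=
      Continuous.tendsto' (by fun_prop) _ _ (by simp)
    obtain ⟨r, ⟨h1, h2⟩, h3⟩ := (((hc.eventually_le_const (show 0 < κ / 4 by positivity)).and
      (hc'.eventually_le_const (show 0 < ε / 12 by positivity))).filter_mono
        nhdsWithin_le_nhds).and (self_mem_nhdsWithin (s := Set.Ioi (0 : ℝ))) |>.exists
    exact ⟨r, h3, h1, h2⟩
  obtain ⟨S, hS, hS1, hS2, hS3, hS4⟩ : ∃ S : ℕ, 1 ≤ S ∧ 8 * (√S)⁻¹ ^ 2 ≤ p / 2 * r ^ 2 ∧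
      (n : ℝ) ^ 2 * (8 * L ^ 2 * (√S)⁻¹ ^ 2 / (κ / 4) ^ 2) < 1 / 4 ∧
      (n : ℝ) * (8 * (√S)⁻¹ ^ 2 / r ^ 2) < 1 / 4 ∧ (√S)⁻¹ * (I * C) ≤ ε / 12 := by
    have ht : Tendsto (fun S : ℕ => (√(S : ℝ))⁻¹) atTop (nhds 0) :=
      tendsto_inv_atTop_zero.comp (Real.tendsto_sqrt_atTop.comp tendsto_natCast_atTop_atTop)
    have c1 : Tendsto (fun τ : ℝ => 8 * τ ^ 2) (nhds 0) (nhds 0) :=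
      Continuous.tendsto' (by fun_prop) _ _ (by simp)
    have c2 : Tendsto (fun τ : ℝ => (n : ℝ) ^ 2 * (8 * L ^ 2 * τ ^ 2 / (κ / 4) ^ 2)) (nhds 0)
        (nhds 0) := Continuous.tendsto' (by fun_prop) _ _ (by simp)
    have c3 : Tendsto (fun τ : ℝ => (n : ℝ) * (8 * τ ^ 2 / r ^ 2)) (nhds 0) (nhds 0) :=
      Continuous.tendsto' (by fun_prop) _ _ (by simp)
    have c4 : Tendsto (fun τ : ℝ => τ * (I * C)) (nhds 0) (nhds 0) :=
      Continuous.tendsto' (by fun_prop) _ _ (by simp)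
    exact ((eventually_ge_atTop 1).and (((c1.comp ht).eventually_le_const
      (show 0 < p / 2 * r ^ 2 by positivity)).and (((c2.comp ht).eventually_lt_const
      (show (0 : ℝ) < 1 / 4 by norm_num)).and (((c3.comp ht).eventually_lt_const
      (show (0 : ℝ) < 1 / 4 by norm_num)).and ((c4.comp ht).eventually_le_const
      (show 0 < ε / 12 by positivity)))))).exists
  obtain ⟨R, hR⟩ := exists_nat_ge (20 / κ + 1)
  have hR1 : (1 : ℝ) ≤ R := le_trans (by linarith [show 0 < 20 / κ by positivity]) hR
  have hRκ : 1 / (R : ℝ) ≤ κ / 20 := by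
    rw [div_le_div_iff₀ (by positivity) (by positivity)]
    have : 20 / κ ≤ R := by linarith
    rw [div_le_iff₀ hκ] at this
    linarith
  have hR2 : (2 : ℝ) / R = 2 * (1 / R) := by ring
  have hR3 : (3 : ℝ) / R = 3 * (1 / R) := by ring
  have hnκ : n * κ + κ ≤ η / 4 := by linarith
  have hnκ0 : 0 ≤ n * κ := by positivity
  obtain ⟨m, hm⟩ := exists_nat_ge (4 * S / ((η / 32) ^ 2 * p) / t₀ + 1)
  have hS0 : (0 : ℝ) < S := by exact_mod_cast hS
  have hJ : 0 ≤ 4 * S / ((η / 32) ^ 2 * p) := by positivity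
  have hm1 : (1 : ℝ) ≤ m := le_trans (le_add_of_nonneg_left (by positivity)) hm
  have hτ : (√(m * S : ℝ))⁻¹ * √m = (√S)⁻¹ := by
    rw [Real.sqrt_mul (by positivity)]
    have : √(m : ℝ) ≠ 0 := by positivity
    field_simp
  have hσ2 : ((√(m * S : ℝ))⁻¹) ^ 2 = 1 / (m * S) := by
    rw [inv_pow, Real.sq_sqrt (by positivity), one_div]
  refine ⟨κ, r, (η / 32) ^ 2, (√(m * S : ℝ))⁻¹, R, S, m, hκ, hr, by positivity, by exact_mod_cast hR1,
    hS, by exact_mod_cast hm1, by positivity, ?_, ?_, ?_⟩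
  · rw [mul_pow, hσ2, Real.sq_sqrt (by positivity)]
    push_cast [Nat.cast_sub hS]
    field_simp
    ring
  · rw [hσ2, mul_one_div, div_le_iff₀ (by positivity)]
    refine (Nat.floor_le hJ).trans ?_
    have h1 : 4 * S / ((η / 32) ^ 2 * p) ≤ t₀ * m := by
      rw [mul_comm t₀, ← div_le_iff₀ ht₀]
      linarith
    have h2 : (1 : ℝ) ≤ S := by exact_mod_cast hS
    nlinarith [mul_pos ht₀ (lt_of_lt_of_le one_pos hm1)]
  · rw [hτ, Real.sqrt_sq (by positivity), hR2, hR3]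
    exact ⟨hS1, hS2, hS3, by linarith, by linarith, by linarith, by linarith, by linarith, hr2, hS4,
      hκ2⟩

/-- A Lipschitz map of the Gaussian couplings into the unit ball has small probability of reaching
an energy above the algorithmic threshold. -/
theorem measure_energy_ge_lt (P : ℕ) (c : ℕ → ℝ) (heven : ∀ k, Odd k → c k = 0) (L : ℝ≥0) {ε p : ℝ}
    (hε : 0 < ε) (hp : 0 < p) : ∀ᶠ N : ℕ in atTop,
      ∀ f : EuclideanSpace ℝ (GIdx N P) → EuclideanSpace ℝ (Fin N), LipschitzWith L f →
      (∀ x, ‖f x‖ ≤ 1) → (stdGaussian (EuclideanSpace ℝ (GIdx N P))).real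
        {g | √N * ((∫ t in Set.Ioo (0 : ℝ) 1, √(xiD2 P c t)) + ε) ≤ inner ℝ (feat P c (f g)) g} < p := by
  obtain ⟨ϑ, η, t₀, K, hϑ, hη, hη1, ht₀, hK, herr⟩ := exists_error_parameters hε
    (xiD1_nonneg P c zero_le_two) (Real.sqrt_nonneg (xiD2 P c 2))
  have : NeZero K := ⟨hK⟩
  obtain ⟨H₁, hH₁⟩ := exists_nat_ge (8 / η)
  have hH₁0 : 1 ≤ H₁ := by
    have : (0 : ℝ) < H₁ := lt_of_lt_of_le (by positivity) hH₁
    exact_mod_cast this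
  have hH₁η : 2 ≤ H₁ * (η / 4) := by
    rw [div_le_iff₀ hη] at hH₁
    linarith
  obtain ⟨C, hC, hNT⟩ := exists_measure_not_tame_le P c
  set n := Fintype.card (Fin (2 * H₁) → Fin K) with hn
  set I := Fintype.card ((Fin (2 * H₁) → Fin K) × (Fin (2 * H₁ + 1) × (Fin (2 * H₁) → Fin K)))
    with hI
  obtain ⟨κ, r, η₁, σ, R, S, m, hκ, hr, hη₁, hR, hS, hm, hσ, hσ1, hj, h1, h2, h3, h4, h5, h6, h7, h8,
    h9, h10, h11⟩ := exists_scale_parameters (n := n) (I := I) L hε hη ht₀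
      (X := √(xiFun P c 1)) (C := C) hp
  set D := m * (S - 1) with hD
  obtain ⟨K', hK'⟩ := exists_hasEnergeticTree P c D H₁ K R R (4 * S / (η₁ * p)) hH₁0 hR hR
  set bad : ℝ := Fintype.card (Fin D → Fin K') * (2 * P) +
    Fintype.card ((Fin (2 * H₁) → Fin K) → Fin D → Fin K') *
      (Fintype.card (Fin (2 * H₁ + 1) → Fin (2 * R + 1)) * (2 * xiFun P c 2 / (ε / 4) ^ 2)) with hbad
  have hlim : ∀ a : ℝ, Tendsto (fun N : ℕ => a / (N : ℝ)) atTop (nhds 0) := fun a =>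
    tendsto_const_nhds.div_atTop tendsto_natCast_atTop_atTop
  filter_upwards [eventually_ge_atTop 1, eventually_ge_atTop (2 * n),
    (hlim (I * (2 * P))).eventually_lt_const (show (0 : ℝ) < 1 / 4 by norm_num),
    (hlim bad).eventually_lt_const (show 0 < (p / 4) ^ (K' ^ D) by positivity)]
    with N hN hNn hNI hNbad f hf hb
  by_contra! hcon
  set S₀ : Set (EuclideanSpace ℝ (GIdx N P)) :=
    {g | √N * ((∫ t in Set.Ioo (0 : ℝ) 1, √(xiD2 P c t)) + ε) ≤ inner ℝ (feat P c (f g)) g} with hS₀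
  have hS₀m : MeasurableSet S₀ := by
    have hcf : Continuous fun g => feat P c (f g) := continuous_feat.comp hf.continuous
    exact (isClosed_le continuous_const (hcf.inner continuous_id)).measurableSet
  have hDm : (D : ℝ) ≤ S * (m + 1) := by
    have : D ≤ S * (m + 1) := by
      rw [hD, mul_comm]
      exact Nat.mul_le_mul (Nat.sub_le _ _) (Nat.le_succ _)
    exact_mod_cast this
  have hgood := le_measure_goodWords hf hb hm σ D (s := S) (by exact_mod_cast hS) hσ1 hDm hS₀m hp
    hcon hη₁
  have hgm := measurableSet_goodWords hf hb σ (σ * √m) D hS₀m (p / 2) η₁ (4 * S / (η₁ * p))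
  have hall := le_measure_forall_words K' D hgm
  have hσ2 : D * σ ^ 2 ≤ 1 := by linarith [sq_nonneg (σ * √m)]
  have hbadm := measure_bad_pools_le (H := 2 * H₁) (K := K) (K' := K') (D := D) heven hN (hNT N hN)
    (s := n * κ) (R := R) hϑ hη.le hη1 hσ2 hj
    (B := (∫ t in Set.Ioo (0 : ℝ) 1, √(xiD2 P c t)) + ε / 4) (δ := ε / 4) (by positivity)
    (by linarith)
  have hlt := lt_of_le_of_lt hbadm ((ENNReal.ofReal_lt_ofReal_iff (by positivity)).2 hNbad)
  rw [ENNReal.ofReal_pow (by positivity)] at hlt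
  have hlt2 := hlt.trans_le ((pow_le_pow_left' (ENNReal.ofReal_le_of_le_toReal hgood) _).trans hall)
  obtain ⟨Z, hZ, hZb⟩ := Set.not_subset.1 fun h => absurd (measure_mono h) (not_le.2 hlt2)
  rw [Set.mem_union, not_or] at hZb
  refine hZb.2 (hK' hN hf hb hS₀m (fun g hg => hg) hC (hNT N hN) hn hI (by positivity)
    (half_pos hp) hr (show 0 < κ / 4 by positivity) h1 h2 h3 (by rwa [← mul_div_assoc]) hη.le hη1
    hH₁η h4 h5 h6 hκ.le h7 h8 hNn h9 h10 h11 (by linarith) Z hZ fun w => ?_)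
  by_contra hw
  exact hZb.1 ⟨w, hw⟩

end Threshold

section Hamiltonian

variable {N P : ℕ} {c : ℕ → ℝ}

lemma hamiltonian_eq_inner (hN : 1 ≤ N) (g : GIdx N P → ℝ) (s : Fin N → ℝ) :
    hamiltonian N P c (unflatten N P g) s =
      √N * inner ℝ (feat P c ((√N)⁻¹ • WithLp.toLp 2 s)) (WithLp.toLp 2 g) := by
  have hN0 : (0 : ℝ) < N := by exact_mod_cast hN
  have hs : √(N : ℝ) ≠ 0 := by positivity
  have hpow : ∀ k : ℕ, (N : ℝ) ^ (-(((k : ℝ) - 1) / 2)) = √N * (√N)⁻¹ ^ k := fun k => by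
    rw [inv_pow, Real.sqrt_eq_rpow, ← Real.rpow_natCast, ← Real.rpow_mul hN0.le, ← Real.rpow_neg hN0.le,
      ← Real.rpow_add hN0]
    congr 1
    ring
  unfold hamiltonian
  rw [PiLp.inner_apply, Fintype.sum_sigma, Finset.mul_sum, ← Finset.sum_coe_sort]
  refine Finset.sum_congr rfl fun k _ => ?_
  rw [hpow, Finset.mul_sum, Finset.mul_sum]
  refine Finset.sum_congr rfl fun j _ => ?_
  have hg : unflatten N P g k j = g ⟨k, j⟩ := by
    unfold unflatten
    rw [dif_pos k.2]
  rw [hg]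
  simp [feat, Finset.prod_mul_distrib]
  ring

lemma measure_map_toLp_eq {Ω : Type*} [MeasurableSpace Ω] {μ : Measure Ω} {ι : Type*} [Fintype ι]
    {G : Ω → ι → ℝ} (hG : Measure.map G μ = Measure.pi fun _ => gaussianReal 0 1)
    {T : Set (EuclideanSpace ℝ ι)} (hT : MeasurableSet T) :
    μ {ω | WithLp.toLp 2 (G ω) ∈ T} = stdGaussian (EuclideanSpace ℝ ι) T := by
  have hGm : AEMeasurable G μ := AEMeasurable.of_map_ne_zero (by
    rw [hG]
    exact IsProbabilityMeasure.ne_zero _)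
  have ht : Measurable (WithLp.toLp 2 : (ι → ℝ) → EuclideanSpace ℝ ι) := by fun_prop
  rw [← map_pi_eq_stdGaussian, ← hG, Measure.map_apply ht hT, Measure.map_apply_of_aemeasurable hGm
    (ht hT)]
  rfl

/-- The normalised output of an algorithm, as a map of Euclidean spaces. -/
def normalized (A : (GIdx N P → ℝ) → Fin N → ℝ) (g : EuclideanSpace ℝ (GIdx N P)) :
    EuclideanSpace ℝ (Fin N) := (√N)⁻¹ • WithLp.toLp 2 (A g)

lemma norm_normalized_le {A : (GIdx N P → ℝ) → Fin N → ℝ} (hA : ∀ g, ∑ i, A g i ^ 2 ≤ N)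
    (g : EuclideanSpace ℝ (GIdx N P)) : ‖normalized A g‖ ≤ 1 := by
  unfold normalized
  rw [norm_smul, EuclideanSpace.norm_eq, Real.norm_of_nonneg (by positivity), inv_mul_eq_div]
  simp only [Real.norm_eq_abs, sq_abs]
  exact div_le_one_of_le₀ (Real.sqrt_le_sqrt (hA g)) (Real.sqrt_nonneg _)

lemma lipschitzWith_normalized (hN : 1 ≤ N) {A : (GIdx N P → ℝ) → Fin N → ℝ} {L : ℝ≥0}
    (hA : ∀ g g', √(∑ i, (A g i - A g' i) ^ 2) ≤ L * √N * √(∑ x, (g x - g' x) ^ 2)) :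
    LipschitzWith L (normalized A) := by
  have hN0 : (0 : ℝ) < √N := Real.sqrt_pos.2 (by exact_mod_cast hN)
  refine LipschitzWith.of_dist_le_mul fun g g' => ?_
  unfold normalized
  rw [dist_eq_norm, ← smul_sub, norm_smul, ← WithLp.toLp_sub, EuclideanSpace.norm_eq,
    EuclideanSpace.dist_eq, Real.norm_of_nonneg (by positivity), inv_mul_le_iff₀ hN0]
  simp only [Real.norm_eq_abs, Real.dist_eq, sq_abs, Pi.sub_apply]
  refine (hA g g').trans (le_of_eq ?_)
  ring

end Hamiltonian

end SpinGlass

/-- no Lipschitz algorithm can beat `ALG = ∫₀¹ √(ξ''(t)) dt` for even mixtures. -/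
theorem statement_17 {Ω : Type*} [MeasureSpace Ω] [IsProbabilityMeasure (ℙ : Measure Ω)]
    (P : ℕ) (hP : 2 ≤ P) (c : ℕ → ℝ) (hc : ∃ k ∈ Finset.Icc 2 P, c k ≠ 0)
    (heven : ∀ k, Odd k → c k = 0)
    (G : (N : ℕ) → Ω → GIdx N P → ℝ)
    (hG : ∀ N, 1 ≤ N →
      Measure.map (G N) ℙ = Measure.pi fun _ : GIdx N P => gaussianReal 0 1)
    (L : ℝ) (hL : 0 < L)
    (A : (N : ℕ) → (GIdx N P → ℝ) → (Fin N → ℝ))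
    (hAmeas : ∀ N, Measurable (A N))
    (hAball : ∀ N g, ∑ i, (A N g i) ^ 2 ≤ (N : ℝ))
    (hAlip : ∀ N g g', Real.sqrt (∑ i, (A N g i - A N g' i) ^ 2)
        ≤ L * Real.sqrt N * Real.sqrt (∑ x, (g x - g' x) ^ 2))
    (ε : ℝ) (hε : 0 < ε) :
    Tendsto (fun N : ℕ =>
        (ℙ {ω | (N : ℝ) * ((∫ t in Set.Ioo (0 : ℝ) 1, Real.sqrt (xiD2 P c t)) + ε)
          ≤ hamiltonian N P c (unflatten N P (G N ω)) (A N (G N ω))}).toReal)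
      atTop (nhds 0) := by
  have key : ∀ p : ℝ, 0 < p → ∀ᶠ N : ℕ in atTop,
      (ℙ {ω | (N : ℝ) * ((∫ t in Set.Ioo (0 : ℝ) 1, Real.sqrt (xiD2 P c t)) + ε)
        ≤ hamiltonian N P c (unflatten N P (G N ω)) (A N (G N ω))}).toReal < p := fun p hp => by
    filter_upwards [eventually_ge_atTop 1,
      SpinGlass.measure_energy_ge_lt P c heven ⟨L, hL.le⟩ hε hp] with N hN hmeas
    have hN0 : (0 : ℝ) < √N := Real.sqrt_pos.2 (by exact_mod_cast hN)
    have hlip : LipschitzWith ⟨L, hL.le⟩ (SpinGlass.normalized (A N)) :=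
      SpinGlass.lipschitzWith_normalized hN (hAlip N)
    have hT : MeasurableSet {g : EuclideanSpace ℝ (GIdx N P) |
        √N * ((∫ t in Set.Ioo (0 : ℝ) 1, √(xiD2 P c t)) + ε) ≤
          inner ℝ (SpinGlass.feat P c (SpinGlass.normalized (A N) g)) g} :=
      (isClosed_le continuous_const ((SpinGlass.continuous_feat.comp hlip.continuous).inner
        continuous_id)).measurableSet
    refine lt_of_eq_of_lt ?_ (hmeas _ hlip (SpinGlass.norm_normalized_le (hAball N)))
    rw [measureReal_def, ← SpinGlass.measure_map_toLp_eq (hG N hN) hT]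
    congr 3
    ext ω
    rw [SpinGlass.hamiltonian_eq_inner hN]
    nth_rewrite 1 [← Real.mul_self_sqrt (Nat.cast_nonneg N)]
    rw [mul_assoc]
    exact mul_le_mul_iff_right₀ hN0
  refine tendsto_order.2 ⟨fun a ha => Eventually.of_forall fun N => ha.trans_le ENNReal.toReal_nonneg,
    fun a ha => key a ha⟩
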